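/- Let H ∈ (0, 1/2) and T > 0. Then, as u → ∞, P(M_H(T) > u) = (T/H) · (1/2)^{1/H} · 𝓗_{2H}² · u^{2/H − 2} · Ψ(u) · (1 + o(1)); that is, the ratio P(M_H(T) > u) / ((T/H) (1/2)^{1/H} 𝓗_{2H}² u^{2/H − 2} Ψ(u)) tends to 1 as u → ∞. -/

import Mathlib

open MeasureTheory ProbabilityTheory Real Filter Set

/-- Tail `Ψ(u) = P(N > u)` of a standard normal random variable. -/
noncomputable def stdNormalTail (u : ℝ) : ℝ :=
  ((ProbabilityTheory.gaussianReal 0 1) (Set.Ioi u)).toReal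

/-- A measurable centered Gaussian process with the covariance of a fractional Brownian motion of
Hurst index `a / 2` on the positive half-line. -/
structure IsFBM {Ω : Type*} [MeasurableSpace Ω] (μ : Measure Ω) (a : ℝ) (B : ℝ → Ω → ℝ) :
    Prop where
  meas : ∀ t, Measurable (B t)
  zero : ∀ ω, B 0 ω = 0
  gauss : ∀ (n : ℕ) (c : Fin n → ℝ) (t : Fin n → ℝ),
    ∃ v : NNReal, μ.map (fun ω => ∑ i, c i * B (t i) ω) = gaussianReal 0 v
  integral_mul : ∀ t s : ℝ, 0 ≤ t → 0 ≤ s →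
    ∫ ω, B t ω * B s ω ∂μ = (t ^ a + s ^ a - |t - s| ^ a) / 2

theorem ProbabilityTheory.IsGaussianProcess.hasGaussianLaw_comp {Ω S κ : Type*} [MeasurableSpace Ω]
    {μ : Measure Ω} {X : S → Ω → ℝ} (hX : IsGaussianProcess X μ) [Fintype κ] (f : κ → S) :
    HasGaussianLaw (fun ω k => X (f k) ω) μ := by
  have h := (hX.comp_right f).hasGaussianLaw Finset.univ
  let L : (↥(Finset.univ : Finset κ) → ℝ) →L[ℝ] (κ → ℝ) :=
    ContinuousLinearMap.pi fun k => ContinuousLinearMap.proj ⟨k, Finset.mem_univ k⟩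
  exact h.map L

namespace IsFBM

variable {Ω : Type*} [MeasurableSpace Ω] {μ : Measure Ω} [IsProbabilityMeasure μ]
  {a : ℝ} {B : ℝ → Ω → ℝ}

omit [IsProbabilityMeasure μ] in
theorem isGaussianProcess (hB : IsFBM μ a B) : IsGaussianProcess B μ where
  hasGaussianLaw I := by
    constructor
    have hm : Measurable (fun ω => I.restrict (B · ω)) :=
      measurable_pi_lambda _ fun i => hB.meas i
    refine isGaussian_of_map_eq_gaussianReal fun L => ?_
    obtain ⟨v, hv⟩ := hB.gauss (Fintype.card I)
      (fun k => L (Pi.single ((Fintype.equivFin I).symm k) 1)) (fun k => (Fintype.equivFin I).symm k)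
    refine ⟨0, v, ?_⟩
    rw [Measure.map_map L.measurable hm, ← hv]
    congr 1
    ext ω
    simp only [Function.comp]
    change (L : (I → ℝ) →ₗ[ℝ] ℝ) _ = _
    rw [LinearMap.pi_apply_eq_sum_univ]
    rw [← (Fintype.equivFin I).symm.sum_comp]
    refine Finset.sum_congr rfl fun k _ => ?_
    simp only [smul_eq_mul, Finset.restrict]
    rw [mul_comm]
    congr 1
    exact congrArg L (by ext j; simp [Pi.single_apply, eq_comm])

omit [IsProbabilityMeasure μ] in
theorem memLp (hB : IsFBM μ a B) (t : ℝ) : MemLp (B t) 2 μ :=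
  (hB.isGaussianProcess.hasGaussianLaw_eval t).memLp_two

omit [IsProbabilityMeasure μ] in
theorem integral_eq_zero (hB : IsFBM μ a B) (t : ℝ) : ∫ ω, B t ω ∂μ = 0 := by
  obtain ⟨v, hv⟩ := hB.gauss 1 (fun _ => 1) (fun _ => t)
  simp only [Finset.univ_unique, Fin.default_eq_zero, one_mul, Finset.sum_const,
    Finset.card_singleton, one_smul] at hv
  have : ∫ x, x ∂(μ.map (fun ω => B t ω)) = ∫ ω, B t ω ∂μ :=
    integral_map (hB.meas t).aemeasurable (by fun_prop)
  rw [← this, hv, integral_id_gaussianReal]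

theorem covariance_eq (hB : IsFBM μ a B) {t s : ℝ} (ht : 0 ≤ t) (hs : 0 ≤ s) :
    cov[B t, B s; μ] = (t ^ a + s ^ a - |t - s| ^ a) / 2 := by
  rw [covariance_eq_sub (hB.memLp t) (hB.memLp s), ← hB.integral_mul t s ht hs,
    hB.integral_eq_zero t]
  simp

/-- The increment of a process over `[p.1, p.2]`. -/
def incr (B : ℝ → Ω → ℝ) (p : ℝ × ℝ) (ω : Ω) : ℝ := B p.2 ω - B p.1 ω

omit [IsProbabilityMeasure μ] in
theorem isGaussianProcess_incr (hB : IsFBM μ a B) : IsGaussianProcess (incr B) μ :=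
  hB.isGaussianProcess.of_isGaussianProcess fun p => ⟨{p.1, p.2},
    (ContinuousLinearMap.proj ⟨p.2, by simp⟩ - ContinuousLinearMap.proj ⟨p.1, by simp⟩),
    fun ω => by simp [incr]⟩

omit [IsProbabilityMeasure μ] in
theorem measurable_incr (hB : IsFBM μ a B) (p : ℝ × ℝ) : Measurable (incr B p) :=
  (hB.meas _).sub (hB.meas _)

omit [IsProbabilityMeasure μ] in
theorem memLp_incr (hB : IsFBM μ a B) (p : ℝ × ℝ) : MemLp (incr B p) 2 μ :=
  (hB.isGaussianProcess_incr.hasGaussianLaw_eval p).memLp_two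

theorem integral_incr (hB : IsFBM μ a B) (p : ℝ × ℝ) : ∫ ω, incr B p ω ∂μ = 0 := by
  unfold incr
  rw [integral_sub ((hB.memLp _).integrable (by norm_num)) ((hB.memLp _).integrable (by norm_num)),
    hB.integral_eq_zero, hB.integral_eq_zero, sub_zero]

theorem covariance_incr (hB : IsFBM μ a B) {p q : ℝ × ℝ} (hp1 : 0 ≤ p.1) (hp2 : 0 ≤ p.2)
    (hq1 : 0 ≤ q.1) (hq2 : 0 ≤ q.2) :
    cov[incr B p, incr B q; μ] =
      (|p.2 - q.1| ^ a + |p.1 - q.2| ^ a - |p.2 - q.2| ^ a - |p.1 - q.1| ^ a) / 2 := by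
  have : ∀ p, incr B p = B p.2 - B p.1 := fun p => rfl
  rw [this, this, covariance_sub_left (hB.memLp _) (hB.memLp _) ((hB.memLp _).sub (hB.memLp _)),
    covariance_sub_right (hB.memLp _) (hB.memLp _) (hB.memLp _),
    covariance_sub_right (hB.memLp _) (hB.memLp _) (hB.memLp _), hB.covariance_eq hp2 hq2,
    hB.covariance_eq hp2 hq1, hB.covariance_eq hp1 hq2, hB.covariance_eq hp1 hq1]
  ring

theorem variance_incr (hB : IsFBM μ a B) (ha : 0 < a) {p : ℝ × ℝ} (hp1 : 0 ≤ p.1)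
    (hp2 : 0 ≤ p.2) : Var[incr B p; μ] = |p.2 - p.1| ^ a := by
  rw [← covariance_self (hB.measurable_incr p).aemeasurable,
    hB.covariance_incr hp1 hp2 hp1 hp2, abs_sub_comm p.1 p.2]
  simp [Real.zero_rpow ha.ne']

/-- Linear combinations of two increments are centered Gaussian. -/
theorem map_add_mul_incr (hB : IsFBM μ a B) (p q : ℝ × ℝ) (c d : ℝ) :
    μ.map (fun ω => c * incr B p ω + d * incr B q ω) =
      gaussianReal 0 (c ^ 2 * Var[incr B p; μ] + 2 * c * d * cov[incr B p, incr B q; μ] +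
        d ^ 2 * Var[incr B q; μ]).toNNReal := by
  have h := hB.isGaussianProcess_incr.hasGaussianLaw_comp (![p, q])
  let L : (Fin 2 → ℝ) →L[ℝ] ℝ := c • ContinuousLinearMap.proj 0 + d • ContinuousLinearMap.proj 1
  have h2 := (h.map L).map_eq_gaussianReal
  have e : (L ∘ fun ω k => incr B (![p, q] k) ω) =
      fun ω => c * incr B p ω + d * incr B q ω := by
    ext ω; simp [L]
  rw [e] at h2
  rw [h2]
  congr 1
  · rw [integral_add (((hB.memLp_incr _).integrable (by norm_num)).const_mul _)
      (((hB.memLp_incr _).integrable (by norm_num)).const_mul _), integral_const_mul,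
      integral_const_mul, hB.integral_incr, hB.integral_incr]
    simp
  · congr 1
    rw [variance_fun_add ((hB.memLp_incr p).const_mul c) ((hB.memLp_incr q).const_mul d)]
    rw [variance_const_mul, variance_const_mul, covariance_const_mul_left,
      covariance_const_mul_right]
    ring

end IsFBM

/-- The first-order asymptotic tail at level `x` of a centered Gaussian variable of variance `V`. -/
noncomputable def gaussTail (x V : ℝ) : ℝ := √V / x * (√(2 * π))⁻¹ * exp (-x ^ 2 / (2 * V))

theorem gaussTail_pos {x V : ℝ} (hx : 0 < x) (hV : 0 < V) : 0 < gaussTail x V := by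
  unfold gaussTail; positivity

theorem gaussTail_mono {x V W : ℝ} (hx : 0 < x) (hV : 0 < V) (h : V ≤ W) :
    gaussTail x V ≤ gaussTail x W := by
  unfold gaussTail
  have h1 : √V ≤ √W := Real.sqrt_le_sqrt h
  have h2 : -x ^ 2 / (2 * V) ≤ -x ^ 2 / (2 * W) := by
    rw [neg_div, neg_div, neg_le_neg_iff]
    gcongr
  gcongr

theorem gaussianReal_Ioi_le_gaussTail {v : NNReal} {V x : ℝ} (hV : 0 < V) (hv : v ≤ V)
    (hx : 0 < x) : (gaussianReal 0 v).real (Ioi x) ≤ gaussTail x V := by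
  by_cases hv0 : v = 0
  · subst hv0
    rw [gaussianReal_zero_var, measureReal_def, Measure.dirac_apply' _ measurableSet_Ioi]
    simpa [hx.le, not_lt.mpr hx.le] using (gaussTail_pos hx hV).le
  have hvp : (0 : ℝ) < v := by positivity
  refine le_trans ?_ (gaussTail_mono hx hvp hv)
  rw [measureReal_def, gaussianReal_apply_eq_integral _ hv0, ENNReal.toReal_ofReal
    (setIntegral_nonneg measurableSet_Ioi fun y _ => gaussianPDFReal_nonneg _ _ _)]
  set F : ℝ → ℝ := fun y => -((v : ℝ) / x * (√(2 * π * v))⁻¹ * exp (-y ^ 2 / (2 * v))) with hF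
  have hder : ∀ y ∈ Ici x, HasDerivAt F (y / x * gaussianPDFReal 0 v y) y := by
    intro y _
    have h1 : HasDerivAt (fun y : ℝ => -y ^ 2 / (2 * (v : ℝ))) (-(2 * y) / (2 * v)) y := by
      simpa using ((hasDerivAt_pow 2 y).neg).div_const (2 * (v : ℝ))
    have h2 := ((h1.exp.const_mul ((v : ℝ) / x * (√(2 * π * v))⁻¹))).neg
    refine h2.congr_deriv ?_
    simp only [gaussianPDFReal, sub_zero]
    field_simp
  have hlim : Tendsto F atTop (nhds 0) := by
    have h1 : Tendsto (fun y : ℝ => -y ^ 2 / (2 * (v : ℝ))) atTop atBot := by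
      have : Tendsto (fun y : ℝ => y ^ 2 / (2 * (v : ℝ))) atTop atTop :=
        (tendsto_pow_atTop two_ne_zero).atTop_div_const (by positivity)
      simp only [neg_div]; exact tendsto_neg_atTop_atBot.comp this
    have h2 := ((tendsto_exp_atBot.comp h1).const_mul ((v : ℝ) / x * (√(2 * π * v))⁻¹)).neg
    simpa [F] using h2
  have hnn : ∀ y ∈ Ioi x, 0 ≤ y / x * gaussianPDFReal 0 v y := fun y hy =>
    mul_nonneg (div_nonneg (hx.trans hy).le hx.le) (gaussianPDFReal_nonneg _ _ _)
  have h_int := integrableOn_Ioi_deriv_of_nonneg' hder hnn hlim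
  have hval := integral_Ioi_of_hasDerivAt_of_nonneg' hder hnn hlim
  calc ∫ y in Ioi x, gaussianPDFReal 0 v y ≤ ∫ y in Ioi x, y / x * gaussianPDFReal 0 v y := by
        refine setIntegral_mono_on (integrable_gaussianPDFReal 0 v).integrableOn h_int
          measurableSet_Ioi fun y hy => ?_
        refine le_mul_of_one_le_left (gaussianPDFReal_nonneg _ _ _) ?_
        rw [one_le_div hx]; exact (le_of_lt hy)
    _ = gaussTail x v := by
        rw [hval]
        simp only [F, gaussTail, zero_sub, neg_neg]
        congr 1
        rw [Real.sqrt_mul (by positivity)]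
        have := Real.mul_self_sqrt hvp.le
        have h3 : √(v : ℝ) ≠ 0 := by positivity
        field_simp
        nlinarith

theorem integral_exp_gaussianReal {Ω : Type*} [MeasurableSpace Ω] {μ : Measure Ω} {X : Ω → ℝ}
    {v : NNReal} (hX : μ.map X = gaussianReal 0 v) :
    ∫ ω, exp (X ω) ∂μ = exp (v / 2) := by
  have h := mgf_gaussianReal hX 1
  simpa [mgf] using h

theorem integrable_exp_gaussianReal {Ω : Type*} [MeasurableSpace Ω] {μ : Measure Ω} {X : Ω → ℝ}
    {v : NNReal} (hm : Measurable X) (hX : μ.map X = gaussianReal 0 v) :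
    Integrable (fun ω => exp (X ω)) μ := by
  have h : Integrable (fun x => exp (1 * x)) (gaussianReal 0 v) := integrable_exp_mul_gaussianReal 1
  rw [← hX] at h
  simpa [Function.comp_def] using h.comp_measurable hm

theorem HasGaussianLaw.charFun_toLp_eq {Ω F : Type*} [MeasurableSpace Ω] {μ : Measure Ω}
    [Fintype F] {V : F → Ω → ℝ} (hV : HasGaussianLaw (fun ω p => V p ω) μ)
    (t : EuclideanSpace ℝ F) :
    charFun (μ.map fun ω => WithLp.toLp 2 fun p => V p ω) t =
      Complex.exp (((∑ p, t p * ∫ ω, V p ω ∂μ : ℝ) : ℂ) * Complex.I -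
        ((∑ p, ∑ q, t p * t q * cov[V p, V q; μ] : ℝ) : ℂ) / 2) := by
  have := hV.isProbabilityMeasure
  have hL : ∀ p, MemLp (V p) 2 μ := fun p => (hV.eval p).memLp_two
  rw [(hV.toLp_pi 2).charFun_map_eq t]
  have e : (fun ω => inner ℝ t (WithLp.toLp 2 fun p => V p ω)) =
      fun ω => ∑ p, t p * V p ω := by
    ext ω; simp [PiLp.inner_apply, mul_comm]
  simp only [e]
  congr 3
  · rw [integral_finsetSum _ fun p _ => ((hL p).integrable (by norm_num)).const_mul _]
    simp only [integral_const_mul]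
  · rw [← covariance_self (Finset.aemeasurable_fun_sum _ fun p _ =>
      (hL p).aestronglyMeasurable.aemeasurable.const_mul _)]
    rw [covariance_fun_sum_fun_sum (fun p => (hL p).const_mul _) (fun p => (hL p).const_mul _)]
    push_cast
    simp only [covariance_const_mul_left, covariance_const_mul_right]
    push_cast
    refine Finset.sum_congr rfl fun p _ => Finset.sum_congr rfl fun q _ => ?_
    ring

/-- Gaussian vectors whose means and covariances converge have convergent probabilities of
entering the complement of the closed negative orthant. -/
theorem tendsto_measureReal_exists_pos {Ω Ω' ι F : Type*} [MeasurableSpace Ω]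
    [MeasurableSpace Ω'] {μ : Measure Ω} {ν : Measure Ω'} [Fintype F] [Nonempty F]
    {l : Filter ι} [l.IsCountablyGenerated] {V : ι → F → Ω → ℝ} {W : F → Ω' → ℝ}
    (hV : ∀ i, HasGaussianLaw (fun ω p => V i p ω) μ) (hW : HasGaussianLaw (fun ω p => W p ω) ν)
    (hmean : ∀ p, Tendsto (fun i => ∫ ω, V i p ω ∂μ) l (nhds (∫ ω, W p ω ∂ν)))
    (hcov : ∀ p q, Tendsto (fun i => cov[V i p, V i q; μ]) l (nhds cov[W p, W q; ν]))
    (hnull : ν {ω | ⨆ p, W p ω = 0} = 0) :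
    Tendsto (fun i => μ.real {ω | ∃ p, 0 < V i p ω}) l (nhds (ν.real {ω | ∃ p, 0 < W p ω})) := by
  refine tendsto_of_seq_tendsto fun x hx => ?_
  have := hW.isProbabilityMeasure
  have := (hV (x 0)).isProbabilityMeasure
  have mV : ∀ i, AEMeasurable (fun ω => WithLp.toLp 2 fun p => V i p ω) μ :=
    fun i => ((hV i).toLp_pi 2).aemeasurable
  have mW : AEMeasurable (fun ω => WithLp.toLp 2 fun p => W p ω) ν := (hW.toLp_pi 2).aemeasurable
  let P : ℕ → ProbabilityMeasure (EuclideanSpace ℝ F) := fun n =>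
    ⟨μ.map fun ω => WithLp.toLp 2 fun p => V (x n) p ω, Measure.isProbabilityMeasure_map (mV _)⟩
  let P0 : ProbabilityMeasure (EuclideanSpace ℝ F) :=
    ⟨ν.map fun ω => WithLp.toLp 2 fun p => W p ω, Measure.isProbabilityMeasure_map mW⟩
  have hP : Tendsto P atTop (nhds P0) := by
    refine ProbabilityMeasure.tendsto_of_tendsto_charFun fun t => ?_
    change Tendsto (fun n => charFun (μ.map fun ω => WithLp.toLp 2 fun p => V (x n) p ω) t) atTop
      (nhds (charFun (ν.map fun ω => WithLp.toLp 2 fun p => W p ω) t))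
    rw [HasGaussianLaw.charFun_toLp_eq hW]
    simp only [fun n => HasGaussianLaw.charFun_toLp_eq (hV (x n)) t]
    refine (Complex.continuous_exp.tendsto _).comp (Tendsto.sub (Tendsto.mul_const _ ?_)
      (Tendsto.div_const ?_ _))
    · refine (Complex.continuous_ofReal.tendsto _).comp (tendsto_finsetSum _ fun p _ => ?_)
      exact ((hmean p).comp hx).const_mul _
    · refine (Complex.continuous_ofReal.tendsto _).comp (tendsto_finsetSum _ fun p _ =>
        tendsto_finsetSum _ fun q _ => ?_)
      exact ((hcov p q).comp hx).const_mul _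
  let E : Set (EuclideanSpace ℝ F) := {y | ∃ p, 0 < y p}
  have hEopen : IsOpen E := by
    have : E = ⋃ p, {y | 0 < y p} := by ext; simp [E]
    rw [this]
    exact isOpen_iUnion fun p => isOpen_lt continuous_const (by fun_prop)
  have hfr : frontier E ⊆ {y | ⨆ p, y p = 0} := by
    intro y hy
    have h1 : y ∈ closure E := hy.1
    have h2 : y ∉ E := by have := hy.2; rwa [hEopen.interior_eq] at this
    have hcl : closure E ⊆ {y | ∃ p, 0 ≤ y p} := by
      refine closure_minimal (fun y ⟨p, hp⟩ => ⟨p, hp.le⟩) ?_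
      have : {y : EuclideanSpace ℝ F | ∃ p, 0 ≤ y p} = ⋃ p, {y | 0 ≤ y p} := by ext; simp
      rw [this]
      exact isClosed_iUnion_of_finite fun p => isClosed_le continuous_const (by fun_prop)
    obtain ⟨p, hp⟩ := hcl h1
    simp only [E, mem_ofPred_eq, not_exists, not_lt] at h2
    exact le_antisymm (ciSup_le h2) (hp.trans (le_ciSup (f := fun p => y p)
      (Finite.bddAbove_range _) p))
  have hEnull : (P0 : Measure (EuclideanSpace ℝ F)) (frontier E) = 0 := by
    refine measure_mono_null hfr ?_
    have hms : MeasurableSet {y : EuclideanSpace ℝ F | ⨆ p, y p = 0} := by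
      refine measurableSet_eq_fun (Measurable.iSup fun p => by fun_prop) measurable_const
    change (ν.map fun ω => WithLp.toLp 2 fun p => W p ω) _ = 0
    rw [Measure.map_apply_of_aemeasurable mW hms]
    exact hnull
  have hlim := ProbabilityMeasure.tendsto_measure_of_null_frontier_of_tendsto' hP hEnull
  have hreal := (ENNReal.tendsto_toReal (measure_ne_top (P0 : Measure _) E)).comp hlim
  have e1 : ∀ n, (P n : Measure (EuclideanSpace ℝ F)) E = μ {ω | ∃ p, 0 < V (x n) p ω} := fun n =>
    Measure.map_apply_of_aemeasurable (mV _) hEopen.measurableSet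
  have e2 : (P0 : Measure (EuclideanSpace ℝ F)) E = ν {ω | ∃ p, 0 < W p ω} :=
    Measure.map_apply_of_aemeasurable mW hEopen.measurableSet
  simp only [Function.comp_def, e1, e2] at hreal
  exact hreal

theorem measureReal_exists_gt_eq_integral {Ω F : Type*} [MeasurableSpace Ω] {μ : Measure Ω}
    [IsProbabilityMeasure μ] [Fintype F] {X : Ω → ℝ} {Y : F → Ω → ℝ} (hX : Measurable X)
    (hY : ∀ p, Measurable (Y p))
    (hG : HasGaussianLaw (fun ω => (fun _ : Unit => X ω, fun p => Y p ω)) μ)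
    (hcov : ∀ p, cov[X, Y p; μ] = 0) (hmean : ∫ ω, X ω ∂μ = 0) (hs : 0 < Var[X; μ])
    (r : F → ℝ) (v : ℝ) :
    μ.real {ω | ∃ p, v < r p * X ω + Y p ω} =
      ∫ x, gaussianPDFReal 0 Var[X; μ].toNNReal x * μ.real {ω | ∃ p, v < r p * x + Y p ω} := by
  have hind : IndepFun X (fun ω p => Y p ω) μ := by
    have := hG.indepFun_of_covariance_eval (X := fun _ : Unit => X) (fun _ p => hcov p)
    exact this.comp (measurable_pi_apply ()) measurable_id
  have hYm : Measurable fun ω p => Y p ω := measurable_pi_lambda _ hY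
  rw [indepFun_iff_map_prod_eq_prod_map_map hX.aemeasurable hYm.aemeasurable] at hind
  have hlaw : μ.map X = gaussianReal 0 Var[X; μ].toNNReal := by
    have h1 : HasGaussianLaw X μ :=
      (hG.map ((ContinuousLinearMap.proj () : (Unit → ℝ) →L[ℝ] ℝ).comp
        (ContinuousLinearMap.fst ℝ (Unit → ℝ) (F → ℝ))))
    rw [h1.map_eq_gaussianReal, hmean]
  let A : Set (ℝ × (F → ℝ)) := {z | ∃ p, v < r p * z.1 + z.2 p}
  have hA : MeasurableSet A := by
    have : A = ⋃ p, {z | v < r p * z.1 + z.2 p} := by ext; simp [A]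
    rw [this]
    exact MeasurableSet.iUnion fun p => measurableSet_lt measurable_const (by fun_prop)
  have h1 : μ {ω | ∃ p, v < r p * X ω + Y p ω} = ∫⁻ x, μ {ω | ∃ p, v < r p * x + Y p ω} ∂μ.map X := by
    have : μ {ω | ∃ p, v < r p * X ω + Y p ω} = μ.map (fun ω => (X ω, fun p => Y p ω)) A := by
      rw [Measure.map_apply (hX.prodMk hYm) hA]; rfl
    have : IsProbabilityMeasure (μ.map fun ω p => Y p ω) :=
      Measure.isProbabilityMeasure_map hYm.aemeasurable
    rw [‹μ _ = _›, hind, Measure.prod_apply hA]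
    refine lintegral_congr fun x => ?_
    rw [Measure.map_apply hYm (measurable_prodMk_left hA)]; rfl
  have hmeas : Measurable fun x => μ {ω | ∃ p, v < r p * x + Y p ω} := by
    have hS : MeasurableSet {z : ℝ × Ω | ∃ p, v < r p * z.1 + Y p z.2} := by
      have : {z : ℝ × Ω | ∃ p, v < r p * z.1 + Y p z.2} =
        ⋃ p, {z | v < r p * z.1 + Y p z.2} := by ext; simp
      rw [this]
      exact MeasurableSet.iUnion fun p => measurableSet_lt measurable_const
        (by have := hY p; fun_prop)
    exact measurable_measure_prodMk_left hS
  rw [measureReal_def, h1, ← integral_toReal hmeas.aemeasurable (ae_of_all _ fun _ =>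
    measure_lt_top _ _), hlaw, integral_gaussianReal_eq_integral_smul (by simpa using hs)]
  rfl

theorem gaussianPDFReal_zero_add_mul_div {s v : ℝ} (hs : 0 < s) (hv : 0 < v) (w : ℝ) :
    s / v * gaussianPDFReal 0 s.toNNReal (s / v * w + v) =
      gaussTail v s * exp (-w - s * w ^ 2 / (2 * v ^ 2)) := by
  have e1 : √(2 * π * s) = √(2 * π) * √s := Real.sqrt_mul (by positivity) _
  have e2 : -(s / v * w + v - 0) ^ 2 / (2 * s) =
    -v ^ 2 / (2 * s) + (-w - s * w ^ 2 / (2 * v ^ 2)) := by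
    field_simp; ring
  have e3 : s = √s * √s := (Real.mul_self_sqrt hs.le).symm
  have : √s ≠ 0 := by positivity
  rw [gaussianPDFReal, Real.coe_toNNReal _ hs.le, e1, e2, exp_add, gaussTail]
  have e4 : s / v * (√(2 * π) * √s)⁻¹ = √s / v * (√(2 * π))⁻¹ := by
    field_simp
    exact (Real.sq_sqrt hs.le).symm
  linear_combination (exp (-v ^ 2 / (2 * s)) * exp (-w - s * w ^ 2 / (2 * v ^ 2))) * e4

/-- Conditioning on the base variable and rescaling around the level `v`. -/
theorem measureReal_exists_gt_eq_gaussTail_mul {Ω F : Type*} [MeasurableSpace Ω] {μ : Measure Ω}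
    [IsProbabilityMeasure μ] [Fintype F] {X : Ω → ℝ} {Y : F → Ω → ℝ} (hX : Measurable X)
    (hY : ∀ p, Measurable (Y p))
    (hG : HasGaussianLaw (fun ω => (fun _ : Unit => X ω, fun p => Y p ω)) μ)
    (hcov : ∀ p, cov[X, Y p; μ] = 0) (hmean : ∫ ω, X ω ∂μ = 0) (hs : 0 < Var[X; μ])
    (r : F → ℝ) {v : ℝ} (hv : 0 < v) :
    μ.real {ω | ∃ p, v < r p * X ω + Y p ω} =
      gaussTail v Var[X; μ] * ∫ w, exp (-w - Var[X; μ] * w ^ 2 / (2 * v ^ 2)) *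
        μ.real {ω | ∃ p, 0 < v * Y p ω + (v ^ 2 * (r p - 1) + r p * Var[X; μ] * w)} := by
  rw [measureReal_exists_gt_eq_integral hX hY hG hcov hmean hs]
  set s := Var[X; μ]
  set g : ℝ → ℝ := fun x => gaussianPDFReal 0 s.toNNReal x * μ.real {ω | ∃ p, v < r p * x + Y p ω}
  have h1 : ∫ x, g x = s / v * ∫ w, g (s / v * w + v) := by
    rw [Measure.integral_comp_mul_left (fun y => g (y + v)), integral_add_right_eq_self,
      abs_of_pos (by positivity)]
    simp only [smul_eq_mul]
    field_simp
  rw [h1, ← integral_const_mul, ← integral_const_mul]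
  refine integral_congr_ae (ae_of_all _ fun w => ?_)
  simp only [g]
  rw [← mul_assoc, gaussianPDFReal_zero_add_mul_div hs hv, mul_assoc]
  congr 4
  ext ω
  refine exists_congr fun p => ?_
  rw [← sub_pos, ← mul_pos_iff_of_pos_left hv]
  have : v * (r p * (s / v * w + v) + Y p ω - v) = v * Y p ω + (v ^ 2 * (r p - 1) + r p * s * w) := by
    field_simp; ring
  rw [this]

theorem integral_exp_neg_mul_measureReal {Ω : Type*} [MeasurableSpace Ω] {ν : Measure Ω}
    [IsProbabilityMeasure ν] {M : Ω → ℝ} (hM : Measurable M) :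
    ∫ w, exp (-w) * ν.real {ω | 0 < w + M ω} = ∫ ω, exp (M ω) ∂ν := by
  have hS : MeasurableSet {z : ℝ × Ω | 0 < z.1 + M z.2} :=
    measurableSet_lt measurable_const (by fun_prop)
  have hmeas : Measurable fun w : ℝ => ν {ω | 0 < w + M ω} := measurable_measure_prodMk_left hS
  have h1 : ∫⁻ w : ℝ, ENNReal.ofReal (exp (-w)) * ν {ω | 0 < w + M ω} =
      ∫⁻ ω, ENNReal.ofReal (exp (M ω)) ∂ν := by
    have e1 : ∀ w : ℝ, ENNReal.ofReal (exp (-w)) * ν {ω | 0 < w + M ω} =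
        ∫⁻ ω, {z : ℝ × Ω | 0 < z.1 + M z.2}.indicator
          (fun z => ENNReal.ofReal (exp (-z.1))) (w, ω) ∂ν := by
      intro w
      have : (fun ω => {z : ℝ × Ω | 0 < z.1 + M z.2}.indicator
          (fun z => ENNReal.ofReal (exp (-z.1))) (w, ω)) = {ω | 0 < w + M ω}.indicator
          (fun _ => ENNReal.ofReal (exp (-w))) := by
        ext ω; simp [indicator]
      rw [this, lintegral_indicator_const]
      exact measurableSet_lt measurable_const (by fun_prop)
    simp_rw [e1]
    rw [lintegral_lintegral_swap]
    · refine lintegral_congr fun ω => ?_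
      have : (fun w => {z : ℝ × Ω | 0 < z.1 + M z.2}.indicator
          (fun z => ENNReal.ofReal (exp (-z.1))) (w, ω)) = (Ioi (-M ω)).indicator
          (fun w => ENNReal.ofReal (exp (-w))) := by
        ext w; simp [indicator, neg_lt_iff_pos_add]
      rw [this, lintegral_indicator measurableSet_Ioi, ← ofReal_integral_eq_lintegral_ofReal
        (integrableOn_exp_neg_Ioi _) (ae_of_all _ fun _ => (exp_pos _).le), integral_exp_neg_Ioi,
        neg_neg]
    · exact (Measurable.indicator (by fun_prop) hS).aemeasurable
  rw [integral_eq_lintegral_of_nonneg_ae (ae_of_all _ fun w => by positivity)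
      (Measurable.aestronglyMeasurable (by
        have := hmeas.ennreal_toReal
        simp only [measureReal_def]; fun_prop)),
    integral_eq_lintegral_of_nonneg_ae (ae_of_all _ fun w => by positivity)
      (by fun_prop), ← h1]
  congr 1
  refine lintegral_congr fun w => ?_
  rw [ENNReal.ofReal_mul (exp_pos _).le, measureReal_def, ENNReal.ofReal_toReal (measure_ne_top _ _)]

theorem HasGaussianLaw.add_const_pi {Ω F : Type*} [MeasurableSpace Ω] {μ : Measure Ω} [Fintype F]
    {V : F → Ω → ℝ} (hV : HasGaussianLaw (fun ω p => V p ω) μ) (m : F → ℝ) :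
    HasGaussianLaw (fun ω p => V p ω + m p) μ := by
  have := hV.isGaussian_map
  constructor
  have h : μ.map (fun ω p => V p ω + m p) = (μ.map fun ω p => V p ω).map (fun x => x + m) := by
    rw [AEMeasurable.map_map_of_aemeasurable (by fun_prop) hV.aemeasurable]; rfl
  rw [h]
  infer_instance

/-- A Chernoff bound for a centered Gaussian variable. -/
theorem HasGaussianLaw.measureReal_lt_le {Ω : Type*} [MeasurableSpace Ω] {μ : Measure Ω}
    {X : Ω → ℝ} (hX : HasGaussianLaw X μ) (hm : ∫ ω, X ω ∂μ = 0) {x V : ℝ}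
    (hV : Var[X; μ] ≤ V) {t : ℝ} (ht : 0 ≤ t) :
    μ.real {ω | x < X ω} ≤ exp (-t * x + V * t ^ 2 / 2) := by
  have := hX.isProbabilityMeasure
  have hlaw := hX.map_eq_gaussianReal
  rw [hm] at hlaw
  have h_int : Integrable (fun ω => exp (t * X ω)) μ := by
    have h : Integrable (fun x => exp (t * x)) (gaussianReal 0 Var[X; μ].toNNReal) :=
      integrable_exp_mul_gaussianReal t
    rw [← hlaw] at h
    exact (integrable_map_measure h.aestronglyMeasurable hX.aemeasurable).mp h
  refine (measureReal_mono fun ω h => ?_).trans ((measure_ge_le_exp_mul_mgf x ht h_int).trans ?_)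
  · exact (show x < X ω from h).le
  rw [mgf_gaussianReal hlaw, ← exp_add]
  refine exp_le_exp.mpr ?_
  rw [Real.coe_toNNReal _ (variance_nonneg _ _)]
  have := mul_le_mul_of_nonneg_right hV (sq_nonneg t)
  linarith

theorem ae_measure_iSup_add_eq_zero {Ω F : Type*} [MeasurableSpace Ω] {ν : Measure Ω}
    [IsProbabilityMeasure ν] [Fintype F] [Nonempty F] {W : F → Ω → ℝ}
    (hW : ∀ p, Measurable (W p)) : ∀ᵐ w : ℝ, ν {ω | ⨆ p, (W p ω + w) = 0} = 0 := by
  have hM : Measurable fun ω => -⨆ p, W p ω := (Measurable.iSup hW).neg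
  have hc := Measure.countable_meas_level_set_pos (μ := ν) hM
  filter_upwards [hc.ae_notMem volume] with w hw
  have : {ω | ⨆ p, (W p ω + w) = 0} = {ω | (-⨆ p, W p ω) = w} := by
    ext ω
    change ⨆ p, (W p ω + w) = 0 ↔ (-⨆ p, W p ω) = w
    rw [← ciSup_add (Finite.bddAbove_range _)]
    constructor <;> intro h <;> linarith
  rw [this]
  simpa using hw

/-- Pickands' local lemma: the exceedance probability of a finite Gaussian vector around a base
variable, at a high level and under the natural scaling. -/
theorem tendsto_measureReal_exists_gt_div_gaussTail {Ω Ω' ι F : Type*} [MeasurableSpace Ω]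
    [MeasurableSpace Ω'] {μ : Measure Ω} {ν : Measure Ω'} [IsProbabilityMeasure μ] [Fintype F]
    [Nonempty F] {l : Filter ι} [l.IsCountablyGenerated] {X : ι → Option F → Ω → ℝ}
    {G : F → Ω' → ℝ} {v : ι → ℝ} {d : F → ℝ}
    (hX : ∀ i o, Measurable (X i o)) (hXG : ∀ i, HasGaussianLaw (fun ω o => X i o ω) μ)
    (hXm : ∀ i o, ∫ ω, X i o ω ∂μ = 0) (hG : ∀ p, Measurable (G p))
    (hGG : HasGaussianLaw (fun ω p => G p ω) ν) (hGm : ∀ p, ∫ ω, G p ω ∂ν = 0)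
    (hv : Tendsto v l atTop) (hs : Tendsto (fun i => Var[X i none; μ]) l (nhds 1))
    (hd : ∀ p, Tendsto (fun i => v i ^ 2 * (Var[X i none; μ] - cov[X i (some p), X i none; μ])) l
      (nhds (d p)))
    (hc : ∀ p q, Tendsto (fun i => v i ^ 2 *
      cov[X i (some p) - X i none, X i (some q) - X i none; μ]) l (nhds cov[G p, G q; ν])) :
    Tendsto (fun i => μ.real {ω | ∃ p, v i < X i (some p) ω} / gaussTail (v i) Var[X i none; μ]) l
      (nhds (∫ ω, exp (⨆ p, (G p ω - d p)) ∂ν)) := by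
  have := hGG.isProbabilityMeasure
  have hL : ∀ i o, MemLp (X i o) 2 μ := fun i o => ((hXG i).eval o).memLp_two
  have hGL : ∀ p, MemLp (G p) 2 ν := fun p => (hGG.eval p).memLp_two
  set s : ι → ℝ := fun i => Var[X i none; μ] with hs_def
  set c : ι → F → ℝ := fun i p => cov[X i (some p), X i none; μ] with hc_def
  set r : ι → F → ℝ := fun i p => c i p / s i with hr_def
  let Y : ι → F → Ω → ℝ := fun i p => X i (some p) - r i p • X i none
  have hYm : ∀ i p, Measurable (Y i p) := fun i p => (hX i _).sub ((hX i _).const_smul _)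
  have hYL : ∀ i p, MemLp (Y i p) 2 μ := fun i p => (hL i _).sub ((hL i _).const_smul _)
  have hYG : ∀ i, HasGaussianLaw (fun ω => (fun _ : Unit => X i none ω, fun p => Y i p ω)) μ := by
    intro i
    let L : (Option F → ℝ) →L[ℝ] (Unit → ℝ) × (F → ℝ) :=
      (ContinuousLinearMap.pi fun _ => ContinuousLinearMap.proj none).prod
        (ContinuousLinearMap.pi fun p => ContinuousLinearMap.proj (some p) -
          r i p • ContinuousLinearMap.proj none)
    exact (hXG i).map L
  have hYG' : ∀ i, HasGaussianLaw (fun ω p => Y i p ω) μ := fun i => (hYG i).snd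
  have hYmean : ∀ i p, ∫ ω, Y i p ω ∂μ = 0 := by
    intro i p
    have : ∀ ω, Y i p ω = X i (some p) ω - r i p * X i none ω := fun ω => rfl
    simp_rw [this]
    rw [integral_sub ((hL i _).integrable (by norm_num))
      (((hL i _).integrable (by norm_num)).const_mul _), integral_const_mul, hXm, hXm]
    simp
  have hcovs : ∀ i, cov[X i none, X i none; μ] = s i := fun i =>
    covariance_self (hX i none).aemeasurable
  have hcov0 : ∀ i, 0 < s i → ∀ p, cov[X i none, Y i p; μ] = 0 := by
    intro i hi p
    simp only [Y]
    rw [covariance_sub_right (hL i _) (hL i _) ((hL i _).const_smul _), covariance_smul_right,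
      hcovs, covariance_comm]
    change c i p - c i p / s i * s i = 0
    field_simp; ring
  have hsc : ∀ p, Tendsto (fun i => s i - c i p) l (nhds 0) := by
    intro p
    have h1 := (hd p).mul ((hv.inv_tendsto_atTop).pow 2)
    simp only [ne_eq, OfNat.ofNat_ne_zero, not_false_eq_true, zero_pow, mul_zero] at h1
    refine h1.congr' ?_
    filter_upwards [hv.eventually_gt_atTop 0] with i hi
    simp only [Pi.inv_apply]
    field_simp
    rfl
  have hc1 : ∀ p, Tendsto (fun i => c i p) l (nhds 1) := by
    intro p
    have := hs.sub (hsc p)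
    simpa using this
  have hcovY : ∀ i, 0 < s i → ∀ p q, cov[Y i p, Y i q; μ] =
      cov[X i (some p) - X i none, X i (some q) - X i none; μ] -
        (s i - c i p) * (s i - c i q) / s i := by
    intro i hi p q
    simp only [Y]
    rw [covariance_sub_right (hYL i _) (hL i _) ((hL i _).const_smul _), covariance_smul_right,
      covariance_comm _ (X i none), hcov0 i hi p,
      covariance_sub_left (hL i _) ((hL i _).const_smul _) (hL i _), covariance_smul_left,
      covariance_sub_left (hL i _) (hL i _) ((hL i _).sub (hL i _)),
      covariance_sub_right (hL i _) (hL i _) (hL i _),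
      covariance_sub_right (hL i _) (hL i _) (hL i _), hcovs, covariance_comm (X i none)]
    change _ - c i p / s i * c i q - _ = _ - c i p - (c i q - s i) - _
    field_simp; ring
  have hcovYlim : ∀ p q, Tendsto (fun i => v i ^ 2 * cov[Y i p, Y i q; μ]) l
      (nhds cov[G p, G q; ν]) := by
    intro p q
    have h1 := (hc p q).sub (((hd p).mul (hsc q)).div hs one_ne_zero)
    simp only [mul_zero, zero_div, sub_zero] at h1
    refine h1.congr' ?_
    filter_upwards [hs.eventually (lt_mem_nhds one_pos)] with i hi
    rw [hcovY i hi]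
    simp only [Pi.div_apply]
    change _ - v i ^ 2 * (s i - c i p) * (s i - c i q) / s i = _
    ring
  have hmlim : ∀ p, Tendsto (fun i => v i ^ 2 * (r i p - 1)) l (nhds (- d p)) := by
    intro p
    have h1 := ((hd p).div hs one_ne_zero).neg
    simp only [div_one] at h1
    refine h1.congr' ?_
    filter_upwards [hs.eventually (lt_mem_nhds one_pos)] with i hi
    simp only [Pi.div_apply, r]
    change -(v i ^ 2 * (s i - c i p) / s i) = _
    have : s i ≠ 0 := hi.ne'
    field_simp; ring
  have hrs : ∀ i, 0 < s i → ∀ p, r i p * s i = c i p := fun i hi p => by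
    simp only [r]; field_simp
  set K : ℝ := ∑ p, (|d p| + 1) with hK
  set Kv : ℝ := ∑ p, (|cov[G p, G p; ν]| + 1) with hKv
  have hKp : ∀ p, -d p < K := by
    intro p
    have : |d p| + 1 ≤ K := Finset.single_le_sum (f := fun p => |d p| + 1)
      (fun p _ => by positivity) (Finset.mem_univ p)
    have := neg_abs_le (d p)
    linarith
  have hKvp : ∀ p, cov[G p, G p; ν] < Kv := by
    intro p
    have : |cov[G p, G p; ν]| + 1 ≤ Kv := Finset.single_le_sum
      (f := fun p => |cov[G p, G p; ν]| + 1) (fun p _ => by positivity) (Finset.mem_univ p)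
    have := le_abs_self cov[G p, G p; ν]
    linarith
  set Φ : ι → ℝ → ℝ := fun i w => exp (-w - s i * w ^ 2 / (2 * v i ^ 2)) *
        μ.real {ω | ∃ p, 0 < v i * Y i p ω + (v i ^ 2 * (r i p - 1) + r i p * s i * w)} with hΦ
  have hratio : ∀ᶠ i in l, ∫ w, Φ i w =
      μ.real {ω | ∃ p, v i < X i (some p) ω} / gaussTail (v i) (s i) := by
    filter_upwards [hs.eventually (lt_mem_nhds one_pos), hv.eventually_gt_atTop 0] with i hi hvi
    have h := measureReal_exists_gt_eq_gaussTail_mul (hX i none) (hYm i) (hYG i) (hcov0 i hi)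
      (hXm i none) hi (r i) hvi
    rw [eq_div_iff (gaussTail_pos hvi hi).ne', mul_comm, ← h]
    congr 2
    ext ω
    refine exists_congr fun p => ?_
    simp [Y]
  rw [show (∫ ω, exp (⨆ p, (G p ω - d p)) ∂ν) =
    ∫ w, exp (-w) * ν.real {ω | 0 < w + ⨆ p, (G p ω - d p)} from
    (integral_exp_neg_mul_measureReal (Measurable.iSup fun p => (hG p).sub_const _)).symm]
  refine Tendsto.congr' hratio ?_
  have hvY : ∀ i, HasGaussianLaw (fun ω p => v i * Y i p ω) μ := by
    intro i
    let L : (F → ℝ) →L[ℝ] (F → ℝ) := v i • ContinuousLinearMap.id ℝ _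
    exact (hYG' i).map L
  have hvYm : ∀ i p, ∫ ω, v i * Y i p ω ∂μ = 0 := fun i p => by
    rw [integral_const_mul, hYmean, mul_zero]
  refine tendsto_integral_filter_of_dominated_convergence
    (fun w => (Iic 0).indicator (fun w => (Fintype.card F * exp (4 * K + 8 * Kv)) * exp w) w +
      (Ioi 0).indicator (fun w => exp (-w)) w) ?_ ?_ ?_ ?_
  · refine Eventually.of_forall fun i => Measurable.aestronglyMeasurable ?_
    have hS : MeasurableSet {z : ℝ × Ω |
        ∃ p, 0 < v i * Y i p z.2 + (v i ^ 2 * (r i p - 1) + r i p * s i * z.1)} := by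
      have : {z : ℝ × Ω | ∃ p, 0 < v i * Y i p z.2 + (v i ^ 2 * (r i p - 1) + r i p * s i * z.1)} =
        ⋃ p, {z | 0 < v i * Y i p z.2 + (v i ^ 2 * (r i p - 1) + r i p * s i * z.1)} := by
          ext; simp
      rw [this]
      exact MeasurableSet.iUnion fun p => measurableSet_lt measurable_const
        (by have := hYm i p; fun_prop)
    have h2 := (measurable_measure_prodMk_left (ν := μ) hS).ennreal_toReal
    refine Measurable.mul (by fun_prop) ?_
    exact h2
  · have e1 : ∀ᶠ i in l, ∀ p, v i ^ 2 * (r i p - 1) < K :=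
      eventually_all.mpr fun p => (hmlim p).eventually (gt_mem_nhds (hKp p))
    have e2 : ∀ᶠ i in l, ∀ p, v i ^ 2 * cov[Y i p, Y i p; μ] < Kv :=
      eventually_all.mpr fun p => (hcovYlim p p).eventually (gt_mem_nhds (hKvp p))
    have e3 : ∀ᶠ i in l, ∀ p, 3 / 4 < c i p :=
      eventually_all.mpr fun p => (hc1 p).eventually (lt_mem_nhds (by norm_num))
    filter_upwards [hs.eventually (lt_mem_nhds one_pos), hv.eventually_gt_atTop 0, e1, e2, e3]
      with i hi hvi h1 h2 h3
    refine ae_of_all _ fun w => ?_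
    have hexp : exp (-w - s i * w ^ 2 / (2 * v i ^ 2)) ≤ exp (-w) := by
      refine exp_le_exp.mpr ?_
      have : 0 ≤ s i * w ^ 2 / (2 * v i ^ 2) := by positivity
      linarith
    rw [norm_of_nonneg (by positivity)]
    rcases le_or_gt w 0 with hw | hw
    · rw [indicator_of_mem (mem_Iic.mpr hw), indicator_of_notMem (by simpa using hw), add_zero]
      have hb : μ.real {ω | ∃ p, 0 < v i * Y i p ω + (v i ^ 2 * (r i p - 1) + r i p * s i * w)} ≤
          Fintype.card F * exp (4 * K + 8 * Kv + 3 * w) := by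
        have hu : {ω | ∃ p, 0 < v i * Y i p ω + (v i ^ 2 * (r i p - 1) + r i p * s i * w)} ⊆
            ⋃ p, {ω | -K - 3 / 4 * w < v i * Y i p ω} := by
          rintro ω ⟨p, hp⟩
          refine mem_iUnion.mpr ⟨p, ?_⟩
          change -K - 3 / 4 * w < v i * Y i p ω
          rw [hrs i hi] at hp
          have := h1 p
          nlinarith [h3 p]
        refine (measureReal_mono hu).trans ((measureReal_iUnion_fintype_le _).trans ?_)
        rw [← Finset.card_univ, ← nsmul_eq_mul]
        refine Finset.sum_le_card_nsmul _ _ _ fun p _ => ?_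
        refine (HasGaussianLaw.measureReal_lt_le ((hvY i).eval p) (hvYm i p) (V := Kv) ?_
          (t := 4) (by norm_num)).trans ?_
        · rw [variance_const_mul, ← covariance_self (hYm i p).aemeasurable]
          exact (h2 p).le
        · refine exp_le_exp.mpr ?_
          linarith
      calc _ ≤ exp (-w) * (Fintype.card F * exp (4 * K + 8 * Kv + 3 * w)) :=
          mul_le_mul hexp hb measureReal_nonneg (exp_pos _).le
        _ = Fintype.card F * (exp (4 * K + 8 * Kv) * exp (2 * w)) := by
          rw [mul_left_comm, ← exp_add, ← exp_add]; congr 2; ring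
        _ ≤ Fintype.card F * (exp (4 * K + 8 * Kv) * exp w) := by gcongr; linarith
        _ = _ := by ring
    · rw [indicator_of_notMem (by simpa using hw), indicator_of_mem (mem_Ioi.mpr hw), zero_add]
      calc _ ≤ exp (-w) * 1 := mul_le_mul hexp measureReal_le_one measureReal_nonneg (exp_pos _).le
        _ = _ := mul_one _
  · refine Integrable.add ?_ ?_
    · exact IntegrableOn.integrable_indicator (Integrable.const_mul (integrableOn_exp_Iic 0) _)
        measurableSet_Iic
    · exact (integrableOn_exp_neg_Ioi 0).integrable_indicator measurableSet_Ioi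
  · filter_upwards [ae_measure_iSup_add_eq_zero (ν := ν) (W := fun p ω => G p ω - d p)
      (fun p => (hG p).sub_const _)] with w hw
    refine Tendsto.mul ?_ ?_
    · refine (continuous_exp.tendsto _).comp ?_
      have h1 : Tendsto (fun i => s i * w ^ 2 / 2 * ((v i)⁻¹) ^ 2) l (nhds (1 * w ^ 2 / 2 * 0 ^ 2)) :=
        ((hs.mul_const _).div_const _).mul ((hv.inv_tendsto_atTop).pow 2)
      have h2 := h1.const_sub (-w)
      simp only [ne_eq, OfNat.ofNat_ne_zero, not_false_eq_true, zero_pow, mul_zero, sub_zero] at h2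
      refine h2.congr fun i => ?_
      rw [inv_pow]; ring
    · have hset : {ω | 0 < w + ⨆ p, (G p ω - d p)} = {ω | ∃ p, 0 < G p ω + (w - d p)} := by
        ext ω
        change 0 < w + ⨆ p, (G p ω - d p) ↔ ∃ p, 0 < G p ω + (w - d p)
        rw [← neg_lt_iff_pos_add', lt_ciSup_iff (Finite.bddAbove_range _)]
        refine exists_congr fun p => ?_
        constructor <;> intro h <;> linarith
      rw [hset]
      refine tendsto_measureReal_exists_pos
        (V := fun i p ω => v i * Y i p ω + (v i ^ 2 * (r i p - 1) + r i p * s i * w))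
        (W := fun p ω => G p ω + (w - d p))
        (fun i => HasGaussianLaw.add_const_pi (hvY i) _) (HasGaussianLaw.add_const_pi hGG _)
        ?_ ?_ ?_
      · intro p
        rw [integral_add ((hGL p).integrable (by norm_num)) (integrable_const _), hGm]
        have h1 : Tendsto (fun i => v i ^ 2 * (r i p - 1) + c i p * w) l (nhds (-d p + 1 * w)) :=
          (hmlim p).add ((hc1 p).mul_const _)
        simp only [integral_const, probReal_univ, one_smul, zero_add]
        rw [show w - d p = -d p + 1 * w by ring]
        refine h1.congr' ?_
        filter_upwards [hs.eventually (lt_mem_nhds one_pos)] with i hi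
        rw [integral_add (((hYL i p).integrable (by norm_num)).const_mul _) (integrable_const _),
          hvYm, hrs i hi]
        simp
      · intro p q
        rw [covariance_add_const_left ((hGL p).integrable (by norm_num)),
          covariance_add_const_right ((hGL q).integrable (by norm_num))]
        refine (hcovYlim p q).congr fun i => ?_
        rw [covariance_add_const_left (((hYL i p).integrable (by norm_num)).const_mul _),
          covariance_add_const_right (((hYL i q).integrable (by norm_num)).const_mul _),
          covariance_const_mul_left, covariance_const_mul_right]
        ring
      · rw [← hw]
        congr 1
        ext ω
        change (⨆ p, (G p ω + (w - d p))) = 0 ↔ ⨆ p, (G p ω - d p + w) = 0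
        simp_rw [add_sub_assoc', sub_add_eq_add_sub]

theorem tendsto_stdNormalTail_div_gaussTail :
    Tendsto (fun u => stdNormalTail u / gaussTail u 1) atTop (nhds 1) := by
  have hg : HasGaussianLaw (fun (x : ℝ) (_ : Option Unit) => x) (gaussianReal 0 1) := by
    let L : ℝ →L[ℝ] (Option Unit → ℝ) := ContinuousLinearMap.pi fun _ => ContinuousLinearMap.id ℝ ℝ
    exact HasGaussianLaw.map (X := id) ⟨by rw [Measure.map_id]; infer_instance⟩ L
  have hz : HasGaussianLaw (fun (_ : ℝ) (_ : Unit) => (0 : ℝ)) (gaussianReal 0 1) := by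
    let L : ℝ →L[ℝ] (Unit → ℝ) := 0
    exact HasGaussianLaw.map (X := id) ⟨by rw [Measure.map_id]; infer_instance⟩ L
  have hvar : Var[fun x : ℝ => x; gaussianReal 0 1] = 1 := by simp
  have h := tendsto_measureReal_exists_gt_div_gaussTail (μ := gaussianReal 0 1)
    (ν := gaussianReal 0 1) (F := Unit) (l := atTop) (X := fun (_ : ℝ) _ x => x)
    (G := fun _ _ => 0) (v := id) (d := fun _ => 0) (fun _ _ => measurable_id) (fun _ => hg)
    (fun _ _ => integral_id_gaussianReal) (fun _ => measurable_const) hz (fun _ => by simp)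
    tendsto_id (by simp) (by
      intro p
      rw [covariance_self (by fun_prop)]
      simp) (by
      intro p q
      have : (fun x : ℝ => x) - (fun x => x) = 0 := sub_self _
      simp only [this]
      rw [show (fun _ : ℝ => (0 : ℝ)) = 0 from rfl, covariance_zero_left]
      simp)
  rw [hvar] at h
  simp only [sub_self, ciSup_const, exp_zero, integral_const, probReal_univ, one_smul] at h
  refine h.congr fun u => ?_
  congr 1
  simp [stdNormalTail, measureReal_def, Ioi]

theorem ciSup_prod_add {ι κ : Type*} [Fintype ι] [Fintype κ] [Nonempty ι] [Nonempty κ] (f : ι → ℝ)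
    (g : κ → ℝ) : ⨆ p : ι × κ, (f p.1 + g p.2) = (⨆ i, f i) + ⨆ j, g j := by
  refine le_antisymm (ciSup_le fun p => add_le_add (le_ciSup (Finite.bddAbove_range f) _)
    (le_ciSup (Finite.bddAbove_range g) _)) ?_
  obtain ⟨i, hi⟩ := exists_eq_ciSup_of_finite (f := f)
  obtain ⟨j, hj⟩ := exists_eq_ciSup_of_finite (f := g)
  rw [← hi, ← hj]
  exact le_ciSup (f := fun p : ι × κ => f p.1 + g p.2) (Finite.bddAbove_range _) (i, j)

/-- Increments of `x ↦ x ^ a` near `1` are negligible against scales `h` with `v ^ 2 * h → 0`. -/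
theorem tendsto_mul_rpow_sub_rpow {ι : Type*} {l : Filter ι} {a : ℝ} {w τ h : ι → ℝ}
    (hτ : Tendsto τ l (nhds 1)) (hh : Tendsto h l (nhds 0))
    (hwh : Tendsto (fun i => w i * h i) l (nhds 0)) (x : ℝ) :
    Tendsto (fun i => w i * (|τ i + x * h i| ^ a - |τ i| ^ a)) l (nhds 0) := by
  have hd : HasStrictDerivAt (fun y : ℝ => y ^ a) (a * (1 : ℝ) ^ (a - 1)) 1 :=
    hasStrictDerivAt_rpow_const_of_ne one_ne_zero a
  have hO := hd.hasStrictFDerivAt.isBigO_sub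
  have hτ' : Tendsto (fun i => τ i + x * h i) l (nhds 1) := by
    have := hτ.add (hh.const_mul x)
    simpa using this
  have hpair : Tendsto (fun i => (τ i + x * h i, τ i)) l (nhds ((1 : ℝ), (1 : ℝ))) :=
    hτ'.prodMk_nhds hτ
  have hO2 := (Asymptotics.isBigO_refl w l).mul (hO.comp_tendsto hpair)
  have hlim : Tendsto (fun i => w i * (τ i + x * h i - τ i)) l (nhds 0) := by
    have := hwh.const_mul x
    rw [mul_zero] at this
    exact this.congr fun i => by ring
  have := hO2.trans_tendsto hlim
  refine this.congr' ?_
  filter_upwards [hτ.eventually (lt_mem_nhds one_pos), hτ'.eventually (lt_mem_nhds one_pos)]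
    with i h1 h2
  simp [abs_of_pos h1, abs_of_pos h2]

/-- The discrete Pickands functional with mesh `δ` and `n` points. -/
noncomputable def pickands {Ω : Type*} [MeasurableSpace Ω] (μ : Measure Ω) (a : ℝ)
    (B : ℝ → Ω → ℝ) (δ : ℝ) (n : ℕ) : ℝ :=
  ∫ ω, exp (⨆ i : Fin n, (√2 * B (i * δ) ω - (i * δ) ^ a)) ∂μ

namespace IsFBM

variable {Ω : Type*} [MeasurableSpace Ω] {μ : Measure Ω} [IsProbabilityMeasure μ]
  {a : ℝ} {B : ℝ → Ω → ℝ}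

/-- The limiting additive field of the local analysis. -/
noncomputable def addField (B : ℝ → Ω → ℝ) (p : ℝ × ℝ) (z : Ω × Ω) : ℝ := √2 * B p.1 z.1 + √2 * B p.2 z.2

theorem hasGaussianLaw_addField (hB : IsFBM μ a B) {F : Type*} [Fintype F] (f : F → ℝ × ℝ) :
    HasGaussianLaw (fun z p => addField B (f p) z) (μ.prod μ) := by
  have h1 : HasGaussianLaw (fun ω p => B (f p).1 ω) μ :=
    hB.isGaussianProcess.hasGaussianLaw_comp fun p => (f p).1
  have h2 : HasGaussianLaw (fun ω p => B (f p).2 ω) μ :=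
    hB.isGaussianProcess.hasGaussianLaw_comp fun p => (f p).2
  have m1 : Measurable (fun ω p => B (f p).1 ω) := measurable_pi_lambda _ fun p => hB.meas _
  have m2 : Measurable (fun ω p => B (f p).2 ω) := measurable_pi_lambda _ fun p => hB.meas _
  have e1 : HasGaussianLaw (fun (z : Ω × Ω) p => B (f p).1 z.1) (μ.prod μ) := by
    refine ⟨?_⟩
    have := h1.isGaussian_map
    rwa [← (measurePreserving_fst (μ := μ) (ν := μ)).map_eq, Measure.map_map m1 measurable_fst]
      at this
  have e2 : HasGaussianLaw (fun (z : Ω × Ω) p => B (f p).2 z.2) (μ.prod μ) := by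
    refine ⟨?_⟩
    have := h2.isGaussian_map
    rwa [← (measurePreserving_snd (μ := μ) (ν := μ)).map_eq, Measure.map_map m2 measurable_snd]
      at this
  have hind := indepFun_prod (μ := μ) (ν := μ) m1 m2
  let L : (F → ℝ) × (F → ℝ) →L[ℝ] (F → ℝ) :=
    √2 • ContinuousLinearMap.fst ℝ _ _ + √2 • ContinuousLinearMap.snd ℝ _ _
  exact (hind.hasGaussianLaw e1 e2).map L

omit [IsProbabilityMeasure μ] in
theorem measurable_addField (hB : IsFBM μ a B) (p : ℝ × ℝ) : Measurable (addField B p) := by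
  have h1 := hB.meas p.1
  have h2 := hB.meas p.2
  unfold addField
  fun_prop

theorem integral_addField (hB : IsFBM μ a B) (p : ℝ × ℝ) :
    ∫ z, addField B p z ∂(μ.prod μ) = 0 := by
  have i1 : Integrable (fun z : Ω × Ω => B p.1 z.1) (μ.prod μ) :=
    ((hB.memLp p.1).integrable (by norm_num)).comp_fst μ
  have i2 : Integrable (fun z : Ω × Ω => B p.2 z.2) (μ.prod μ) :=
    ((hB.memLp p.2).integrable (by norm_num)).comp_snd μ
  unfold addField
  rw [integral_add (i1.const_mul _) (i2.const_mul _), integral_const_mul, integral_const_mul,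
    integral_fun_fst, integral_fun_snd, hB.integral_eq_zero, hB.integral_eq_zero]
  simp

theorem covariance_addField (hB : IsFBM μ a B) {p q : ℝ × ℝ} (hp1 : 0 ≤ p.1) (hp2 : 0 ≤ p.2)
    (hq1 : 0 ≤ q.1) (hq2 : 0 ≤ q.2) :
    cov[addField B p, addField B q; μ.prod μ] =
      (p.1 ^ a + q.1 ^ a - |p.1 - q.1| ^ a) + (p.2 ^ a + q.2 ^ a - |p.2 - q.2| ^ a) := by
  have l1 : ∀ t, MemLp (fun z : Ω × Ω => √2 * B t z.1) 2 (μ.prod μ) := fun t =>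
    ((hB.memLp t).comp_fst μ).const_mul _
  have l2 : ∀ t, MemLp (fun z : Ω × Ω => √2 * B t z.2) 2 (μ.prod μ) := fun t =>
    ((hB.memLp t).comp_snd μ).const_mul _
  have c1 : ∀ t s, cov[fun z : Ω × Ω => B t z.1, fun z => B s z.1; μ.prod μ] = cov[B t, B s; μ] := by
    intro t s
    rw [← covariance_map_fun (by
      rw [(measurePreserving_fst (μ := μ) (ν := μ)).map_eq]; exact (hB.meas _).aestronglyMeasurable)
      (by rw [(measurePreserving_fst (μ := μ) (ν := μ)).map_eq]
          exact (hB.meas _).aestronglyMeasurable) measurable_fst.aemeasurable,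
      (measurePreserving_fst (μ := μ) (ν := μ)).map_eq]
  have c2 : ∀ t s, cov[fun z : Ω × Ω => B t z.2, fun z => B s z.2; μ.prod μ] = cov[B t, B s; μ] := by
    intro t s
    rw [← covariance_map_fun (by
      rw [(measurePreserving_snd (μ := μ) (ν := μ)).map_eq]; exact (hB.meas _).aestronglyMeasurable)
      (by rw [(measurePreserving_snd (μ := μ) (ν := μ)).map_eq]
          exact (hB.meas _).aestronglyMeasurable) measurable_snd.aemeasurable,
      (measurePreserving_snd (μ := μ) (ν := μ)).map_eq]
  have hadd : ∀ p, addField B p = (fun z : Ω × Ω => √2 * B p.1 z.1) + fun z => √2 * B p.2 z.2 :=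
    fun p => rfl
  rw [hadd, hadd, covariance_add_left (l1 _) (l2 _) ((l1 _).add (l2 _)),
    covariance_add_right (l1 _) (l1 _) (l2 _), covariance_add_right (l2 _) (l1 _) (l2 _),
    covariance_const_mul_left, covariance_const_mul_right, covariance_const_mul_left,
    covariance_const_mul_right, covariance_const_mul_left, covariance_const_mul_right,
    covariance_const_mul_left, covariance_const_mul_right, c1, c2,
    covariance_fst_snd_prod (hB.memLp _) (hB.memLp _), covariance_comm (fun z : Ω × Ω => B p.2 z.2),
    covariance_fst_snd_prod (hB.memLp _) (hB.memLp _), hB.covariance_eq hp1 hq1,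
    hB.covariance_eq hp2 hq2]
  have : √2 * √2 = (2 : ℝ) := Real.mul_self_sqrt (by norm_num)
  linear_combination ((p.1 ^ a + q.1 ^ a - |p.1 - q.1| ^ a) / 2 +
    (p.2 ^ a + q.2 ^ a - |p.2 - q.2| ^ a) / 2) * this

theorem integral_exp_iSup_addField (μ : Measure Ω) [IsProbabilityMeasure μ] (δ : ℝ) (n : ℕ) [NeZero n] :
    ∫ z, exp (⨆ p : Fin n × Fin n, (addField B (p.1 * δ, p.2 * δ) z -
      ((p.1 * δ) ^ a + (p.2 * δ) ^ a))) ∂(μ.prod μ) = pickands μ a B δ n ^ 2 := by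
  rw [sq, pickands, ← integral_prod_mul]
  refine integral_congr_ae (ae_of_all _ fun z => ?_)
  simp only
  rw [← exp_add, ← ciSup_prod_add]
  congr 2
  ext p
  simp only [addField]
  ring

/-- Covariance of increments over `[s + i h, s + τ + j h]`, with the index pairs `(i, j)`. -/
theorem covariance_incr_block (hB : IsFBM μ a B) {s τ h : ℝ} (hs : 0 ≤ s) (hτ : 0 ≤ τ) (hh : 0 ≤ h)
    {i j i' j' : ℝ} (hi : 0 ≤ i) (hj : 0 ≤ j) (hi' : 0 ≤ i') (hj' : 0 ≤ j') :
    cov[incr B (s + i * h, s + τ + j * h), incr B (s + i' * h, s + τ + j' * h); μ] =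
      (|τ + (j - i') * h| ^ a + |τ + (j' - i) * h| ^ a -
        h ^ a * (|j - j'| ^ a + |i - i'| ^ a)) / 2 := by
  rw [hB.covariance_incr (by positivity) (by positivity) (by positivity) (by positivity)]
  have e1 : s + τ + j * h - (s + i' * h) = τ + (j - i') * h := by ring
  have e2 : |s + i * h - (s + τ + j' * h)| = |τ + (j' - i) * h| := by
    rw [← abs_neg]; congr 1; ring
  have e3 : s + τ + j * h - (s + τ + j' * h) = h * (j - j') := by ring
  have e4 : s + i * h - (s + i' * h) = h * (i - i') := by ring
  simp only
  rw [e1, e2, e3, e4, abs_mul, abs_mul, Real.mul_rpow (abs_nonneg _) (abs_nonneg _),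
    Real.mul_rpow (abs_nonneg _) (abs_nonneg _), abs_of_nonneg hh]
  ring

theorem tendsto_measureReal_block (hB : IsFBM μ a B) (ha : 0 < a) {ι : Type*} {l : Filter ι}
    [l.IsCountablyGenerated] {s τ h v : ι → ℝ} {δ : ℝ} (hδ : 0 < δ) {n : ℕ} [NeZero n]
    (hs : ∀ᶠ i in l, 0 ≤ s i) (hτ : Tendsto τ l (nhds 1)) (hhpos : ∀ᶠ i in l, 0 ≤ h i)
    (hh : Tendsto h l (nhds 0)) (hv : Tendsto v l atTop)
    (hvh : Tendsto (fun i => v i ^ 2 * h i) l (nhds 0))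
    (hvha : Tendsto (fun i => v i ^ 2 * h i ^ a) l (nhds (2 * δ ^ a))) :
    Tendsto (fun i => μ.real {ω | ∃ p : Fin n × Fin n,
        v i < incr B (s i + p.1 * h i, s i + τ i + p.2 * h i) ω} / gaussTail (v i) (τ i ^ a)) l
      (nhds (pickands μ a B δ n ^ 2)) := by
  let f : ι → Option (Fin n × Fin n) → ℝ × ℝ := fun i o =>
    o.elim (s i + 0 * h i, s i + τ i + 0 * h i) fun p => (s i + p.1 * h i, s i + τ i + p.2 * h i)
  have hpos : ∀ᶠ i in l, 0 ≤ s i ∧ 0 < τ i ∧ 0 ≤ h i := by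
    filter_upwards [hs, hτ.eventually (lt_mem_nhds one_pos), hhpos] with i h1 h2 h3
    exact ⟨h1, h2, h3⟩
  have hvar : ∀ᶠ i in l, Var[incr B (f i none); μ] = τ i ^ a := by
    filter_upwards [hpos] with i ⟨h1, h2, h3⟩
    rw [← covariance_self (hB.measurable_incr _).aemeasurable]
    simp only [f, Option.elim]
    rw [hB.covariance_incr_block h1 h2.le h3 le_rfl le_rfl le_rfl le_rfl]
    simp [Real.zero_rpow ha.ne', abs_of_pos h2]
  set E : ℝ → ι → ℝ := fun x i => v i ^ 2 * (|τ i + x * h i| ^ a - |τ i| ^ a) with hE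
  have hElim : ∀ x, Tendsto (E x) l (nhds 0) := fun x =>
    tendsto_mul_rpow_sub_rpow hτ hh hvh x
  have key := tendsto_measureReal_exists_gt_div_gaussTail (μ := μ) (ν := μ.prod μ)
    (F := Fin n × Fin n) (l := l) (X := fun i o => incr B (f i o))
    (G := fun p => addField B (p.1 * δ, p.2 * δ)) (v := v)
    (d := fun p => (p.1 * δ) ^ a + (p.2 * δ) ^ a) (fun i o => hB.measurable_incr _)
    (fun i => hB.isGaussianProcess_incr.hasGaussianLaw_comp (f i)) (fun i o => hB.integral_incr _)
    (fun p => hB.measurable_addField _)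
    (hB.hasGaussianLaw_addField fun p : Fin n × Fin n => ((p.1 : ℝ) * δ, (p.2 : ℝ) * δ))
    (fun p => hB.integral_addField _) hv ?_ ?_ ?_
  · rw [integral_exp_iSup_addField] at key
    refine key.congr' ?_
    filter_upwards [hvar] with i hi
    rw [hi]
    rfl
  · refine Tendsto.congr' (hvar.mono fun i hi => hi.symm) ?_
    have := hτ.rpow_const (p := a) (Or.inl one_ne_zero)
    simpa using this
  · intro p
    have h1 := (((hElim p.2).add (hElim (-p.1))).div_const (-2)).add
      (hvha.mul_const (((p.2 : ℝ) ^ a + (p.1 : ℝ) ^ a) / 2))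
    have e : (0 + 0) / (-2) + 2 * δ ^ a * (((p.2 : ℝ) ^ a + (p.1 : ℝ) ^ a) / 2) =
        (p.1 * δ) ^ a + (p.2 * δ) ^ a := by
      rw [Real.mul_rpow (by positivity) hδ.le, Real.mul_rpow (by positivity) hδ.le]; ring
    rw [e] at h1
    refine h1.congr' ?_
    filter_upwards [hvar, hpos] with i hi ⟨h1, h2, h3⟩
    rw [hi]
    simp only [f, Option.elim, hE]
    rw [hB.covariance_incr_block h1 h2.le h3 (by positivity) (by positivity) le_rfl le_rfl]
    simp only [sub_zero, zero_sub, abs_of_pos h2, Nat.abs_cast]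
    ring
  · intro p q
    have hp1 : (0 : ℝ) ≤ p.1 := by positivity
    have hp2 : (0 : ℝ) ≤ p.2 := by positivity
    have hq1 : (0 : ℝ) ≤ q.1 := by positivity
    have hq2 : (0 : ℝ) ≤ q.2 := by positivity
    rw [hB.covariance_addField (by positivity) (by positivity) (by positivity) (by positivity)]
    have h1 := (((((hElim (p.2 - q.1)).add (hElim (q.2 - p.1))).sub
      ((hElim p.2).add (hElim (-p.1)))).sub ((hElim q.2).add (hElim (-q.1)))).div_const 2).add
      (hvha.mul_const ((((p.2 : ℝ) ^ a + (p.1 : ℝ) ^ a) + ((q.2 : ℝ) ^ a + (q.1 : ℝ) ^ a) -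
        (|(p.2 : ℝ) - q.2| ^ a + |(p.1 : ℝ) - q.1| ^ a)) / 2))
    refine (h1.congr' ?_).trans_eq ?_
    · filter_upwards [hvar, hpos] with i hi ⟨h1, h2, h3⟩
      have hL : ∀ o, MemLp (incr B (f i o)) 2 μ := fun o => hB.memLp_incr _
      rw [covariance_sub_right ((hL _).sub (hL _)) (hL _) (hL _),
        covariance_sub_left (hL _) (hL _) (hL _), covariance_sub_left (hL _) (hL _) (hL _),
        covariance_self (hB.measurable_incr _).aemeasurable, hi,
        covariance_comm (incr B (f i none))]
      simp only [f, Option.elim, hE]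
      rw [hB.covariance_incr_block h1 h2.le h3 hp1 hp2 hq1 hq2,
        hB.covariance_incr_block h1 h2.le h3 hp1 hp2 le_rfl le_rfl,
        hB.covariance_incr_block h1 h2.le h3 hq1 hq2 le_rfl le_rfl]
      simp only [sub_zero, zero_sub, abs_of_pos h2, Nat.abs_cast]
      ring
    · congr 1
      simp only
      rw [← sub_mul, ← sub_mul, abs_mul, abs_mul, Real.mul_rpow (abs_nonneg _) (abs_nonneg _),
        Real.mul_rpow (abs_nonneg _) (abs_nonneg _), Real.mul_rpow hp1 hδ.le,
        Real.mul_rpow hp2 hδ.le, Real.mul_rpow hq1 hδ.le, Real.mul_rpow hq2 hδ.le,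
        abs_of_pos hδ]
      ring

end IsFBM

/-- `exp (-c x⁻ᵇ)` beats every power of `x` as `x → 0`. -/
theorem exists_exp_neg_mul_rpow_neg_le {b c : ℝ} (hb : 0 < b) (hc : 0 < c) (m : ℕ) :
    ∃ C > 0, ∀ x : ℝ, 0 < x → x ≤ 1 → exp (-(c * x ^ (-b))) ≤ C * x ^ m := by
  obtain ⟨N, hN⟩ := exists_nat_ge (m / b)
  refine ⟨N.factorial / c ^ N, by positivity, fun x hx hx1 => ?_⟩
  have hy : 0 < c * x ^ (-b) := by positivity
  have h1 := Real.pow_div_factorial_le_exp (c * x ^ (-b)) hy.le N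
  have h2 : x ^ (b * N) ≤ x ^ (m : ℝ) := by
    refine Real.rpow_le_rpow_of_exponent_ge hx hx1 ?_
    rwa [div_le_iff₀ hb, mul_comm] at hN
  have h3 : (x ^ (-b)) ^ N = (x ^ (b * N))⁻¹ := by
    rw [← Real.rpow_natCast, ← Real.rpow_mul hx.le, ← Real.rpow_neg hx.le]; ring_nf
  rw [Real.exp_neg]
  have h4 : 0 < (c * x ^ (-b)) ^ N / N.factorial := by positivity
  refine (inv_anti₀ h4 h1).trans ?_
  rw [mul_pow, h3, inv_div]
  have h5 : (N.factorial : ℝ) / (c ^ N * (x ^ (b * N))⁻¹) =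
      N.factorial / c ^ N * x ^ (b * N) := by
    have : 0 < x ^ (b * N) := by positivity
    field_simp
  rw [h5]
  rw [Real.rpow_natCast] at h2
  gcongr

namespace IsFBM

variable {Ω : Type*} [MeasurableSpace Ω] {μ : Measure Ω} [IsProbabilityMeasure μ]
  {a : ℝ} {B : ℝ → Ω → ℝ}

/-- The process with drift whose exponential supremum defines the Pickands constant. -/
noncomputable def drift (a : ℝ) (B : ℝ → Ω → ℝ) (t : ℝ) (ω : Ω) : ℝ := √2 * B t ω - t ^ a

omit [IsProbabilityMeasure μ] in
theorem measurable_drift (hB : IsFBM μ a B) (t : ℝ) : Measurable (drift a B t) :=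
  ((hB.meas t).const_mul _).sub_const _

theorem map_linear_drift (hB : IsFBM μ a B) {p q : ℝ} (hp : 0 ≤ p) (hq : 0 ≤ q) (ha : 0 < a)
    (θ : ℝ) : μ.map (fun ω => √2 * (1 + θ) * B p ω - √2 * θ * B q ω) =
      gaussianReal 0 (2 * ((1 + θ) ^ 2 * p ^ a - θ * (1 + θ) * (p ^ a + q ^ a - |p - q| ^ a) +
        θ ^ 2 * q ^ a)).toNNReal := by
  have h := hB.map_add_mul_incr (0, p) (0, q) (√2 * (1 + θ)) (-(√2 * θ))
  have e : ∀ ω, √2 * (1 + θ) * incr B (0, p) ω + -(√2 * θ) * incr B (0, q) ω =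
      √2 * (1 + θ) * B p ω - √2 * θ * B q ω := by
    intro ω; simp only [incr, hB.zero]; ring
  simp only [e] at h
  rw [h, hB.variance_incr ha le_rfl hp, hB.variance_incr ha le_rfl hq,
    hB.covariance_incr le_rfl hp le_rfl hq]
  simp only [sub_zero, zero_sub, abs_neg, abs_of_nonneg hp, abs_of_nonneg hq, abs_zero,
    Real.zero_rpow ha.ne']
  have h2 : √2 ^ 2 = (2 : ℝ) := Real.sq_sqrt (by norm_num)
  congr 2
  linear_combination ((1 + θ) ^ 2 * p ^ a - θ * (1 + θ) * (p ^ a + q ^ a - |p - q| ^ a) +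
        θ ^ 2 * q ^ a) * h2

theorem integrable_exp_tilt (hB : IsFBM μ a B) {p q : ℝ} (hp : 0 ≤ p) (hq : 0 ≤ q) (ha : 0 < a)
    (θ g : ℝ) : Integrable (fun ω => exp (drift a B p ω + θ * (drift a B p ω - drift a B q ω - g)))
      μ := by
  have h := (integrable_exp_gaussianReal (by have := hB.meas p; have := hB.meas q; fun_prop)
    (hB.map_linear_drift hp hq ha θ)).const_mul (exp (-(1 + θ) * p ^ a + θ * q ^ a - θ * g))
  refine h.congr (ae_of_all _ fun ω => ?_)
  simp only [← exp_add, drift]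
  congr 1; ring

theorem integral_exp_tilt_le (hB : IsFBM μ a B) {p q : ℝ} (hp : 0 ≤ p) (hq : 0 ≤ q) (ha : 0 < a)
    {θ κ : ℝ} (hθ : 0 ≤ θ) (hκ : |p - q| ^ a ≤ κ) (g : ℝ) :
    ∫ ω, exp (drift a B p ω + θ * (drift a B p ω - drift a B q ω - g)) ∂μ ≤
      exp (θ * (1 + θ) * κ - θ * g) := by
  have e : ∀ ω, exp (drift a B p ω + θ * (drift a B p ω - drift a B q ω - g)) =
      exp (-(1 + θ) * p ^ a + θ * q ^ a - θ * g) *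
        exp (√2 * (1 + θ) * B p ω - √2 * θ * B q ω) := by
    intro ω
    simp only [← exp_add, drift]
    congr 1; ring
  simp only [e]
  rw [integral_const_mul, integral_exp_gaussianReal (hB.map_linear_drift hp hq ha θ), ← exp_add]
  have hnn : 0 ≤ 2 * ((1 + θ) ^ 2 * p ^ a - θ * (1 + θ) * (p ^ a + q ^ a - |p - q| ^ a) +
        θ ^ 2 * q ^ a) := by
    have hv := variance_nonneg (fun ω => √2 * (1 + θ) * B p ω + -(√2 * θ) * B q ω) μ
    rw [variance_fun_add ((hB.memLp p).const_mul _) ((hB.memLp q).const_mul _),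
      variance_const_mul, variance_const_mul, covariance_const_mul_left, covariance_const_mul_right,
      ← covariance_self (hB.meas p).aemeasurable, ← covariance_self (hB.meas q).aemeasurable,
      hB.covariance_eq hp hp, hB.covariance_eq hq hq, hB.covariance_eq hp hq] at hv
    simp only [sub_self, abs_zero, Real.zero_rpow ha.ne'] at hv
    have h2 : √2 ^ 2 = (2 : ℝ) := Real.sq_sqrt (by norm_num)
    refine hv.trans_eq ?_
    linear_combination ((1 + θ) ^ 2 * p ^ a - θ * (1 + θ) * (p ^ a + q ^ a - |p - q| ^ a) +
        θ ^ 2 * q ^ a) * h2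
  rw [Real.coe_toNNReal _ hnn]
  refine exp_le_exp.mpr ?_
  have : θ * (1 + θ) * |p - q| ^ a ≤ θ * (1 + θ) * κ := by gcongr
  linarith

/-- Maximum of the drifted process over the `k`-th dyadic refinement of a grid of mesh `δ`. -/
noncomputable def gridMax (a : ℝ) (B : ℝ → Ω → ℝ) (δ : ℝ) (n k : ℕ) (ω : Ω) : ℝ :=
  ⨆ i : Fin (n * 2 ^ k), drift a B (i * (δ / 2 ^ k)) ω

omit [IsProbabilityMeasure μ] in
theorem measurable_gridMax (hB : IsFBM μ a B) (δ : ℝ) (n k : ℕ) :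
    Measurable (gridMax a B δ n k) :=
  Measurable.iSup fun _ => hB.measurable_drift _

omit [MeasurableSpace Ω] in
theorem exp_gridMax_succ_le (a : ℝ) (B : ℝ → Ω → ℝ) (δ : ℝ) (n k : ℕ) [NeZero n] {θ : ℝ}
    (hθ : 0 ≤ θ) (g : ℝ) (ω : Ω) :
    exp (gridMax a B δ n (k + 1) ω) ≤ exp g * exp (gridMax a B δ n k ω) +
      ∑ i : Fin (n * 2 ^ (k + 1)), exp (drift a B (i * (δ / 2 ^ (k + 1))) ω +
        θ * (drift a B (i * (δ / 2 ^ (k + 1))) ω -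
          drift a B (((i / 2 : ℕ) : ℝ) * (δ / 2 ^ k)) ω - g)) := by
  have : NeZero (n * 2 ^ (k + 1)) := ⟨by have := NeZero.ne n; positivity⟩
  obtain ⟨i, hi⟩ := exists_eq_ciSup_of_finite
    (f := fun i : Fin (n * 2 ^ (k + 1)) => drift a B (i * (δ / 2 ^ (k + 1))) ω)
  rw [gridMax, ← hi]
  set f : Fin (n * 2 ^ (k + 1)) → ℝ := fun i => exp (drift a B (i * (δ / 2 ^ (k + 1))) ω +
        θ * (drift a B (i * (δ / 2 ^ (k + 1))) ω -
          drift a B (((i / 2 : ℕ) : ℝ) * (δ / 2 ^ k)) ω - g)) with hf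
  have hf0 : ∀ i, 0 ≤ f i := fun i => (exp_pos _).le
  have hlt : (i : ℕ) / 2 < n * 2 ^ k := by
    refine Nat.div_lt_of_lt_mul (i.2.trans_eq ?_)
    ring
  rcases le_or_gt (drift a B (i * (δ / 2 ^ (k + 1))) ω)
    (drift a B (((i / 2 : ℕ) : ℝ) * (δ / 2 ^ k)) ω + g) with h | h
  · have h1 : drift a B (((i / 2 : ℕ) : ℝ) * (δ / 2 ^ k)) ω ≤ gridMax a B δ n k ω :=
      le_ciSup (f := fun j : Fin (n * 2 ^ k) => drift a B (j * (δ / 2 ^ k)) ω)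
        (Finite.bddAbove_range _) ⟨i / 2, hlt⟩
    have h2 : 0 ≤ ∑ i, f i := Finset.sum_nonneg fun i _ => hf0 i
    rw [← exp_add]
    have h3 := exp_le_exp.mpr (h.trans (add_le_add h1 le_rfl))
    rw [add_comm (gridMax _ _ _ _ _ _)] at h3
    linarith
  · have h1 : f i ≤ ∑ i, f i := Finset.single_le_sum (fun i _ => hf0 i) (Finset.mem_univ i)
    have h2 : exp (drift a B (i * (δ / 2 ^ (k + 1))) ω) ≤ f i := by
      refine exp_le_exp.mpr ?_
      nlinarith
    have h3 : 0 < exp g * exp (gridMax a B δ n k ω) := by positivity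
    linarith

theorem integrable_exp_gridMax (hB : IsFBM μ a B) (ha : 0 < a) {δ : ℝ} (hδ : 0 < δ) (n k : ℕ)
    [NeZero n] : Integrable (fun ω => exp (gridMax a B δ n k ω)) μ := by
  have : NeZero (n * 2 ^ k) := ⟨by have := NeZero.ne n; positivity⟩
  have h_int : ∀ i : Fin (n * 2 ^ k), Integrable (fun ω => exp (drift a B (i * (δ / 2 ^ k)) ω)) μ := by
    intro i
    have := hB.integrable_exp_tilt (p := i * (δ / 2 ^ k)) (q := 0) (by positivity) le_rfl ha 0 0
    simpa using this
  refine (integrable_finsetSum (Finset.univ : Finset (Fin (n * 2 ^ k))) fun i _ => h_int i).mono'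
    (hB.measurable_gridMax δ n k).exp.aestronglyMeasurable (ae_of_all _ fun ω => ?_)
  rw [norm_of_nonneg (exp_pos _).le]
  obtain ⟨i, hi⟩ := exists_eq_ciSup_of_finite
    (f := fun i : Fin (n * 2 ^ k) => drift a B (i * (δ / 2 ^ k)) ω)
  rw [gridMax, ← hi]
  exact Finset.single_le_sum (f := fun i : Fin (n * 2 ^ k) => exp (drift a B (i * (δ / 2 ^ k)) ω))
    (fun i _ => (exp_pos _).le) (Finset.mem_univ i)

end IsFBM

theorem two_rpow_neg_lt_one {b : ℝ} (hb : 0 < b) : (2 : ℝ) ^ (-b) < 1 :=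
  Real.rpow_lt_one_of_one_lt_of_neg one_lt_two (by linarith)

theorem div_two_pow_rpow {δ b : ℝ} (hδ : 0 < δ) (k : ℕ) :
    (δ / 2 ^ k) ^ b = δ ^ b * ((2 : ℝ) ^ (-b)) ^ k := by
  rw [Real.div_rpow hδ.le (by positivity), ← Real.rpow_natCast, ← Real.rpow_natCast,
    ← Real.rpow_mul (by norm_num), ← Real.rpow_mul (by norm_num), div_eq_mul_inv,
    ← Real.rpow_neg (by norm_num)]
  ring_nf

theorem sum_div_two_pow_rpow_le {δ b : ℝ} (hδ : 0 < δ) (hb : 0 < b) (k : ℕ) :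
    ∑ j ∈ Finset.range k, (δ / 2 ^ (j + 1)) ^ b ≤ δ ^ b * (1 - (2 : ℝ) ^ (-b))⁻¹ := by
  have hq := two_rpow_neg_lt_one hb
  have hq0 : (0 : ℝ) < 2 ^ (-b) := by positivity
  rw [← tsum_geometric_of_lt_one hq0.le hq]
  simp_rw [div_two_pow_rpow hδ]
  rw [← Finset.mul_sum]
  refine mul_le_mul_of_nonneg_left ?_ (by positivity)
  refine (Finset.sum_le_sum fun j _ => ?_).trans
    ((summable_geometric_of_lt_one hq0.le hq).sum_le_tsum (Finset.range k) fun j _ => by positivity)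
  rw [pow_succ]
  exact mul_le_of_le_one_right (by positivity) hq.le

theorem sum_div_two_pow_le {δ : ℝ} (hδ : 0 < δ) (k : ℕ) :
    ∑ j ∈ Finset.range k, δ / 2 ^ (j + 1) ≤ δ := by
  have h : ∀ k : ℕ, ∑ j ∈ Finset.range k, δ / 2 ^ (j + 1) = δ - δ / 2 ^ k := by
    intro k
    induction k with
    | zero => simp
    | succ k ih => rw [Finset.sum_range_succ, ih]; field_simp; ring
  rw [h]
  have : 0 < δ / 2 ^ k := by positivity
  linarith

namespace IsFBM

variable {Ω : Type*} [MeasurableSpace Ω] {μ : Measure Ω} [IsProbabilityMeasure μ]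
  {a : ℝ} {B : ℝ → Ω → ℝ}

theorem integral_exp_gridMax_succ_le (hB : IsFBM μ a B) (ha : 0 < a) {C : ℝ}
    (hC : ∀ x : ℝ, 0 < x → x ≤ 1 → exp (-(1 * x ^ (-(a / 4)))) ≤ C * x ^ 2) {δ : ℝ} (hδ : 0 < δ)
    (hδ1 : δ ≤ 1) (n k : ℕ) [NeZero n] :
    ∫ ω, exp (gridMax a B δ n (k + 1) ω) ∂μ ≤
      exp ((δ / 2 ^ (k + 1)) ^ (a / 4)) * ∫ ω, exp (gridMax a B δ n k ω) ∂μ +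
        n * δ * (exp 2 * C * (δ / 2 ^ (k + 1))) := by
  set ρ := δ / 2 ^ (k + 1) with hρ
  have hρ0 : 0 < ρ := by positivity
  have hρ1 : ρ ≤ 1 := by
    refine (div_le_self hδ.le ?_).trans hδ1
    exact one_le_pow₀ (by norm_num)
  set θ := ρ ^ (-(a / 2)) with hθ
  set g := ρ ^ (a / 4) with hg
  have hθ0 : 0 ≤ θ := by positivity
  have h_int : ∀ i : Fin (n * 2 ^ (k + 1)), Integrable (fun ω => exp (drift a B (i * ρ) ω +
      θ * (drift a B (i * ρ) ω - drift a B (((i / 2 : ℕ) : ℝ) * (δ / 2 ^ k)) ω - g))) μ :=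
    fun i => hB.integrable_exp_tilt (by positivity) (by positivity) ha _ _
  have h1 : ∫ ω, exp (gridMax a B δ n (k + 1) ω) ∂μ ≤ ∫ ω, (exp g * exp (gridMax a B δ n k ω) +
      ∑ i : Fin (n * 2 ^ (k + 1)), exp (drift a B (i * ρ) ω +
        θ * (drift a B (i * ρ) ω - drift a B (((i / 2 : ℕ) : ℝ) * (δ / 2 ^ k)) ω - g))) ∂μ :=
    integral_mono (hB.integrable_exp_gridMax ha hδ n _)
      (((hB.integrable_exp_gridMax ha hδ n k).const_mul _).add
        (integrable_finsetSum _ fun i _ => h_int i))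
      fun ω => exp_gridMax_succ_le a B δ n k hθ0 g ω
  refine h1.trans ?_
  rw [integral_add ((hB.integrable_exp_gridMax ha hδ n k).const_mul _)
    (integrable_finsetSum _ fun i _ => h_int i), integral_const_mul,
    integral_finsetSum _ fun i _ => h_int i]
  gcongr
  have hterm : ∀ i : Fin (n * 2 ^ (k + 1)), ∫ ω, exp (drift a B (i * ρ) ω +
      θ * (drift a B (i * ρ) ω - drift a B (((i / 2 : ℕ) : ℝ) * (δ / 2 ^ k)) ω - g)) ∂μ ≤
      exp 2 * (C * ρ ^ 2) := by
    intro i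
    have hd : |(i : ℝ) * ρ - ((i / 2 : ℕ) : ℝ) * (δ / 2 ^ k)| ≤ ρ := by
      have e1 : δ / 2 ^ k = 2 * ρ := by rw [hρ]; field_simp; ring
      have e2 : (i : ℝ) = 2 * ((i / 2 : ℕ) : ℝ) + ((i % 2 : ℕ) : ℝ) := by
        exact_mod_cast (Nat.div_add_mod (i : ℕ) 2).symm
      have e3 : ((i % 2 : ℕ) : ℝ) ≤ 1 := by
        exact_mod_cast Nat.le_of_lt_succ (Nat.mod_lt _ (by norm_num))
      have e4 : (i : ℝ) * ρ - ((i / 2 : ℕ) : ℝ) * (δ / 2 ^ k) = ((i % 2 : ℕ) : ℝ) * ρ := by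
        rw [e1]; linear_combination ρ * e2
      rw [e4, abs_of_nonneg (by positivity)]
      exact mul_le_of_le_one_left hρ0.le e3
    refine (hB.integral_exp_tilt_le (by positivity) (by positivity) ha hθ0
      (Real.rpow_le_rpow (abs_nonneg _) hd ha.le) g).trans ?_
    have e1 : θ * (1 + θ) * ρ ^ a = ρ ^ (a / 2) + 1 := by
      have : θ * ρ ^ a = ρ ^ (a / 2) := by
        rw [hθ, ← Real.rpow_add hρ0]; congr 1; ring
      have h2 : θ * ρ ^ (a / 2) = 1 := by
        rw [hθ, ← Real.rpow_add hρ0]; simp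
      linear_combination (1 + θ) * this + h2
    have e2 : θ * g = 1 * ρ ^ (-(a / 4)) := by
      rw [hθ, hg, ← Real.rpow_add hρ0, one_mul]; congr 1; ring
    have e3 : ρ ^ (a / 2) ≤ 1 := Real.rpow_le_one hρ0.le hρ1 (by positivity)
    rw [e1, e2, sub_eq_add_neg, exp_add]
    gcongr
    · linarith
    · exact hC ρ hρ0 hρ1
  refine (Finset.sum_le_card_nsmul _ _ _ fun i _ => hterm i).trans_eq ?_
  rw [Finset.card_univ, Fintype.card_fin, nsmul_eq_mul]
  push_cast
  have : (2 : ℝ) ^ (k + 1) * ρ = δ := by rw [hρ]; field_simp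
  linear_combination (n * exp 2 * C * ρ) * this

omit [IsProbabilityMeasure μ] in
theorem integral_exp_gridMax_zero (μ : Measure Ω) (a : ℝ) (B : ℝ → Ω → ℝ) (δ : ℝ) (n : ℕ) :
    ∫ ω, exp (gridMax a B δ n 0 ω) ∂μ = pickands μ a B δ n := by
  unfold pickands gridMax drift
  congr 1
  ext ω
  congr 1
  exact (finCongr (by simp : n * 2 ^ 0 = n)).iSup_congr fun i => by simp

theorem exists_integral_exp_gridMax_le (hB : IsFBM μ a B) (ha : 0 < a) : ∃ C > 0, ∀ δ : ℝ, 0 < δ →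
    δ ≤ 1 → ∀ n k : ℕ, n ≠ 0 → ∫ ω, exp (gridMax a B δ n k ω) ∂μ ≤
      exp (C * δ ^ (a / 4)) * (pickands μ a B δ n + n * δ * (C * δ)) := by
  obtain ⟨C, hC0, hC⟩ := exists_exp_neg_mul_rpow_neg_le (b := a / 4) (c := 1) (by positivity)
    one_pos 2
  have hq : (0 : ℝ) < 1 - 2 ^ (-(a / 4)) := sub_pos.mpr (two_rpow_neg_lt_one (by positivity))
  refine ⟨max (1 - (2 : ℝ) ^ (-(a / 4)))⁻¹ (exp 2 * C), lt_max_of_lt_right (by positivity),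
    fun δ hδ hδ1 n k hn => ?_⟩
  have : NeZero n := ⟨hn⟩
  have hstep := hB.integral_exp_gridMax_succ_le ha hC hδ hδ1 n
  have hpick : 0 ≤ pickands μ a B δ n := integral_nonneg fun ω => (exp_pos _).le
  have key : ∀ k, ∫ ω, exp (gridMax a B δ n k ω) ∂μ ≤
      exp (∑ j ∈ Finset.range k, (δ / 2 ^ (j + 1)) ^ (a / 4)) * (pickands μ a B δ n +
        n * δ * (exp 2 * C * ∑ j ∈ Finset.range k, δ / 2 ^ (j + 1))) := by
    intro k
    induction k with
    | zero => simp [integral_exp_gridMax_zero]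
    | succ k ih =>
      refine (hstep k).trans ?_
      rw [Finset.sum_range_succ, Finset.sum_range_succ, exp_add]
      set S := ∑ j ∈ Finset.range k, (δ / 2 ^ (j + 1)) ^ (a / 4)
      set S' := ∑ j ∈ Finset.range k, δ / 2 ^ (j + 1)
      set g := (δ / 2 ^ (k + 1)) ^ (a / 4)
      have hS : 0 ≤ S := Finset.sum_nonneg fun j _ => by positivity
      have h1 : exp g * ∫ ω, exp (gridMax a B δ n k ω) ∂μ ≤
          exp g * (exp S * (pickands μ a B δ n + n * δ * (exp 2 * C * S'))) := by gcongr
      have h2 : n * δ * (exp 2 * C * (δ / 2 ^ (k + 1))) ≤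
          exp S * exp g * (n * δ * (exp 2 * C * (δ / 2 ^ (k + 1)))) := by
        refine le_mul_of_one_le_left (by positivity) ?_
        rw [← exp_add]
        exact one_le_exp (by positivity)
      refine (add_le_add h1 h2).trans_eq ?_
      ring
  refine (key k).trans ?_
  have h1 := sum_div_two_pow_rpow_le hδ (show 0 < a / 4 by positivity) k
  have h2 := sum_div_two_pow_le hδ k
  have h3 : (0 : ℝ) ≤ ∑ j ∈ Finset.range k, δ / 2 ^ (j + 1) :=
    Finset.sum_nonneg fun j _ => by positivity
  have h4 : exp 2 * C ≤ max (1 - (2 : ℝ) ^ (-(a / 4)))⁻¹ (exp 2 * C) := le_max_right _ _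
  gcongr
  · rw [mul_comm] at h1
    exact h1.trans (by gcongr; exact le_max_left _ _)

omit [MeasurableSpace Ω] in
theorem tendsto_gridMax {ω : Ω} (hc : Continuous fun t => B t ω) (ha : 0 ≤ a) {δ : ℝ} (hδ : 0 < δ)
    (n : ℕ) [NeZero n] : Tendsto (fun k => gridMax a B δ n k ω) atTop
      (nhds (⨆ t : Icc (0 : ℝ) (n * δ), drift a B t ω)) ∧
    ∀ k, gridMax a B δ n k ω ≤ ⨆ t : Icc (0 : ℝ) (n * δ), drift a B t ω := by
  have hn : 0 < n := Nat.pos_of_ne_zero (NeZero.ne n)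
  have hW : Continuous fun t => drift a B t ω :=
    (hc.const_mul _).sub (Real.continuous_rpow_const ha)
  have hbdd : BddAbove (range fun t : Icc (0 : ℝ) (n * δ) => drift a B t ω) := by
    have := (isCompact_range (hW.comp continuous_subtype_val :
      Continuous fun t : Icc (0 : ℝ) (n * δ) => drift a B t ω)).bddAbove
    exact this
  have hk : ∀ k, NeZero (n * 2 ^ k) := fun k => ⟨by positivity⟩
  have hle : ∀ k, gridMax a B δ n k ω ≤ ⨆ t : Icc (0 : ℝ) (n * δ), drift a B t ω := by
    intro k
    have := hk k
    refine ciSup_le fun i => ?_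
    have hmem : (i : ℝ) * (δ / 2 ^ k) ∈ Icc (0 : ℝ) (n * δ) := by
      refine ⟨by positivity, ?_⟩
      have h1 : (i : ℝ) ≤ n * 2 ^ k := by exact_mod_cast i.2.le
      calc (i : ℝ) * (δ / 2 ^ k) ≤ (n * 2 ^ k) * (δ / 2 ^ k) := by gcongr
        _ = n * δ := by field_simp
    exact le_ciSup hbdd ⟨_, hmem⟩
  refine ⟨tendsto_order.mpr ⟨fun x hx => ?_, fun x hx => Eventually.of_forall fun k =>
    (hle k).trans_lt hx⟩, hle⟩
  have : Nonempty (Icc (0 : ℝ) (n * δ)) := ⟨⟨0, le_rfl, by positivity⟩⟩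
  obtain ⟨⟨t, ht0, ht1⟩, ht⟩ := exists_lt_of_lt_ciSup hx
  let j : ℕ → ℕ := fun k => min ⌊t / (δ / 2 ^ k)⌋₊ (n * 2 ^ k - 1)
  have hj : ∀ k, j k < n * 2 ^ k := fun k =>
    (min_le_right _ _).trans_lt (Nat.sub_lt (by positivity) one_pos)
  have hjd : ∀ k, |(j k : ℝ) * (δ / 2 ^ k) - t| ≤ δ / 2 ^ k := by
    intro k
    have hpos : 0 < δ / 2 ^ k := by positivity
    have h1 : (j k : ℝ) ≤ t / (δ / 2 ^ k) :=
      (Nat.cast_le.mpr (min_le_left _ _)).trans (Nat.floor_le (by positivity))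
    have h2 : t / (δ / 2 ^ k) ≤ j k + 1 := by
      rcases min_choice ⌊t / (δ / 2 ^ k)⌋₊ (n * 2 ^ k - 1) with h | h
      · simp only [j, h]
        exact (Nat.lt_floor_add_one _).le
      · simp only [j, h]
        have h3 : ((n * 2 ^ k - 1 : ℕ) : ℝ) + 1 = n * 2 ^ k := by
          have : n * 2 ^ k - 1 + 1 = n * 2 ^ k := Nat.sub_add_cancel (Nat.pos_of_ne_zero (hk k).ne)
          exact_mod_cast this
        rw [h3, div_le_iff₀ hpos]
        calc t ≤ n * δ := ht1
          _ = _ := by field_simp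
    rw [le_div_iff₀ hpos] at h1
    rw [div_le_iff₀ hpos] at h2
    rw [abs_le]
    constructor <;> linarith
  have hlim : Tendsto (fun k => (j k : ℝ) * (δ / 2 ^ k)) atTop (nhds t) := by
    rw [tendsto_iff_dist_tendsto_zero]
    refine squeeze_zero (fun _ => dist_nonneg) (fun k => hjd k) ?_
    exact tendsto_const_nhds.div_atTop (tendsto_pow_atTop_atTop_of_one_lt (r := (2 : ℝ)) (by norm_num))
  filter_upwards [((hW.tendsto t).comp hlim).eventually (lt_mem_nhds ht)] with k hkx
  refine lt_of_lt_of_le hkx ?_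
  exact le_ciSup (f := fun i : Fin (n * 2 ^ k) => drift a B (i * (δ / 2 ^ k)) ω)
    (Finite.bddAbove_range _) ⟨j k, hj k⟩

theorem exists_integral_exp_iSup_drift_le (hB : IsFBM μ a B) (ha : 0 < a)
    (hc : ∀ᵐ ω ∂μ, Continuous fun t => B t ω) : ∃ C > 0, ∀ δ : ℝ, 0 < δ →
    δ ≤ 1 → ∀ n : ℕ, n ≠ 0 → ∫ ω, exp (⨆ t : Icc (0 : ℝ) (n * δ), drift a B t ω) ∂μ ≤
      exp (C * δ ^ (a / 4)) * (pickands μ a B δ n + n * δ * (C * δ)) := by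
  obtain ⟨C, hC0, hC⟩ := hB.exists_integral_exp_gridMax_le ha
  refine ⟨C, hC0, fun δ hδ hδ1 n hn => ?_⟩
  have : NeZero n := ⟨hn⟩
  by_cases h_int : Integrable (fun ω => exp (⨆ t : Icc (0 : ℝ) (n * δ), drift a B t ω)) μ
  · refine le_of_tendsto (tendsto_integral_of_dominated_convergence _
      (fun k => (hB.measurable_gridMax δ n k).exp.aestronglyMeasurable) h_int
      (fun k => ?_) ?_) (Eventually.of_forall fun k => hC δ hδ hδ1 n k hn)
    · filter_upwards [hc] with ω hω
      rw [norm_of_nonneg (exp_pos _).le]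
      exact exp_le_exp.mpr ((tendsto_gridMax hω ha.le hδ n).2 k)
    · filter_upwards [hc] with ω hω
      exact (continuous_exp.tendsto _).comp (tendsto_gridMax hω ha.le hδ n).1
  · rw [integral_undef h_int]
    have : 0 ≤ pickands μ a B δ n := integral_nonneg fun ω => (exp_pos _).le
    positivity

theorem pickands_le_integral (hB : IsFBM μ a B) (ha : 0 < a)
    (hc : ∀ᵐ ω ∂μ, Continuous fun t => B t ω) {δ : ℝ} (hδ : 0 < δ) (n : ℕ) [NeZero n]
    (h_int : Integrable (fun ω => exp (⨆ t : Icc (0 : ℝ) (n * δ), drift a B t ω)) μ) :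
    pickands μ a B δ n ≤ ∫ ω, exp (⨆ t : Icc (0 : ℝ) (n * δ), drift a B t ω) ∂μ := by
  rw [← integral_exp_gridMax_zero]
  refine integral_mono_ae (hB.integrable_exp_gridMax ha hδ n 0) h_int ?_
  filter_upwards [hc] with ω hω
  exact exp_le_exp.mpr ((tendsto_gridMax hω ha.le hδ n).2 0)

/-- The discrete Pickands constants bracket the continuous one. -/
theorem pickands_asymptotics (hB : IsFBM μ a B) (ha : 0 < a)
    (hc : ∀ᵐ ω ∂μ, Continuous fun t => B t ω) {HH : ℝ} (hHH : 0 < HH)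
    (hP : Tendsto (fun lam : ℝ => lam⁻¹ * ∫ ω, exp (⨆ t : Icc (0 : ℝ) lam, drift a B t ω) ∂μ)
      atTop (nhds HH)) {ε : ℝ} (hε : 0 < ε) :
    (∀ δ : ℝ, 0 < δ → ∀ᶠ n : ℕ in atTop, pickands μ a B δ n / (n * δ) ≤ HH + ε) ∧
    ∀ᶠ δ : ℝ in nhdsWithin 0 (Ioi 0), ∀ᶠ n : ℕ in atTop, HH - ε ≤ pickands μ a B δ n / (n * δ) := by
  have hlim : ∀ δ : ℝ, 0 < δ → Tendsto (fun n : ℕ => ((n : ℝ) * δ)⁻¹ *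
      ∫ ω, exp (⨆ t : Icc (0 : ℝ) (n * δ), drift a B t ω) ∂μ) atTop (nhds HH) := fun δ hδ =>
    hP.comp (tendsto_natCast_atTop_atTop.atTop_mul_const hδ)
  constructor
  · intro δ hδ
    filter_upwards [(hlim δ hδ).eventually (gt_mem_nhds (show HH < HH + ε by linarith)),
      (hlim δ hδ).eventually (lt_mem_nhds hHH), eventually_ne_atTop 0] with n h1 h2 hn
    have : NeZero n := ⟨hn⟩
    have h_int : Integrable (fun ω => exp (⨆ t : Icc (0 : ℝ) (n * δ), drift a B t ω)) μ := by
      by_contra h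
      rw [integral_undef h] at h2
      simp at h2
    have hn0 : (0 : ℝ) < n := by positivity
    rw [div_eq_inv_mul]
    refine le_trans ?_ h1.le
    gcongr
    exact hB.pickands_le_integral ha hc hδ n h_int
  · obtain ⟨C, hC0, hC⟩ := hB.exists_integral_exp_iSup_drift_le ha hc
    have h0 : Tendsto (fun δ : ℝ => exp (-(C * δ ^ (a / 4))) * (HH - ε / 2) - C * δ)
        (nhdsWithin 0 (Ioi 0)) (nhds (HH - ε / 2)) := by
      have h1 : Tendsto (fun δ : ℝ => δ ^ (a / 4)) (nhds 0) (nhds 0) := by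
        have := (Real.continuous_rpow_const (q := a / 4) (by positivity)).tendsto 0
        rwa [Real.zero_rpow (by positivity)] at this
      have h2 : Tendsto (fun δ : ℝ => exp (-(C * δ ^ (a / 4))) * (HH - ε / 2) - C * δ)
          (nhds 0) (nhds (exp (-(C * 0)) * (HH - ε / 2) - C * 0)) :=
        (((continuous_exp.tendsto _).comp (h1.const_mul C).neg).mul_const _).sub
          (tendsto_id.const_mul C)
      simp only [mul_zero, neg_zero, exp_zero, one_mul, sub_zero] at h2
      exact h2.mono_left nhdsWithin_le_nhds
    filter_upwards [h0.eventually (lt_mem_nhds (show HH - ε < HH - ε / 2 by linarith)),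
      Ioo_mem_nhdsGT one_pos] with δ hδ1 hδ
    filter_upwards [(hlim δ hδ.1).eventually (lt_mem_nhds (show HH - ε / 2 < HH by linarith)),
      eventually_ne_atTop 0] with n h1 hn
    have hn0 : (0 : ℝ) < n := by positivity
    have hδ0 := hδ.1
    have hnd : 0 < n * δ := mul_pos hn0 hδ.1
    have h2 := hC δ hδ.1 hδ.2.le n hn
    have h3 : HH - ε / 2 < exp (C * δ ^ (a / 4)) * (pickands μ a B δ n / (n * δ) + C * δ) := by
      refine h1.trans_le ?_
      rw [inv_mul_le_iff₀ hnd]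
      refine h2.trans_eq ?_
      field_simp [hδ0.ne']
    have h4 : exp (-(C * δ ^ (a / 4))) * (HH - ε / 2) <
        pickands μ a B δ n / (n * δ) + C * δ := by
      rw [exp_neg, inv_mul_lt_iff₀ (exp_pos _)]
      exact h3
    linarith

end IsFBM

/-- Grid mesh at level `u` whose local increments have variance `2 δᵃ / u²`. -/
noncomputable def mesh (a δ u : ℝ) : ℝ := δ * 2 ^ (1 / a) * u ^ (-(2 / a))

theorem mesh_pos {a δ u : ℝ} (hδ : 0 < δ) (hu : 0 < u) : 0 < mesh a δ u := by
  unfold mesh; positivity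

theorem mesh_rpow {a δ u : ℝ} (ha : 0 < a) (hδ : 0 < δ) (hu : 0 < u) :
    mesh a δ u ^ a = 2 * δ ^ a / u ^ 2 := by
  unfold mesh
  rw [Real.mul_rpow (by positivity) (by positivity), Real.mul_rpow (by positivity) (by positivity),
    ← Real.rpow_mul (by norm_num), ← Real.rpow_mul hu.le, one_div, inv_mul_cancel₀ ha.ne',
    neg_mul, div_mul_cancel₀ _ ha.ne', Real.rpow_one, Real.rpow_neg hu.le, Real.rpow_two]
  field_simp

theorem tendsto_mesh {a : ℝ} (ha : 0 < a) (δ : ℝ) : Tendsto (mesh a δ) atTop (nhds 0) := by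
  have := (tendsto_rpow_neg_atTop (show 0 < 2 / a by positivity)).const_mul (δ * 2 ^ (1 / a))
  rwa [mul_zero] at this

theorem tendsto_sq_mul_mesh {a : ℝ} (ha : 0 < a) (ha1 : a < 1) (δ : ℝ) :
    Tendsto (fun u => u ^ 2 * mesh a δ u) atTop (nhds 0) := by
  have h1 : 0 < 2 / a - 2 := by
    rw [sub_pos, lt_div_iff₀ ha]; linarith
  have := (tendsto_rpow_neg_atTop h1).const_mul (δ * 2 ^ (1 / a))
  rw [mul_zero] at this
  refine this.congr' ?_
  filter_upwards [eventually_gt_atTop 0] with u hu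
  unfold mesh
  rw [← Real.rpow_two, show -(2 / a - 2) = 2 + -(2 / a) by ring, Real.rpow_add hu]
  ring

theorem tendsto_sub_div_atTop (Γ : ℝ) : Tendsto (fun u : ℝ => u - Γ / u) atTop atTop := by
  have h : Tendsto (fun u : ℝ => -(Γ / u)) atTop (nhds 0) := by
    simpa using (tendsto_const_nhds (x := Γ)).div_atTop tendsto_id |>.neg
  simpa [sub_eq_add_neg] using tendsto_id.atTop_add h

theorem tendsto_sub_div_div (Γ : ℝ) : Tendsto (fun u : ℝ => (u - Γ / u) / u) atTop (nhds 1) := by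
  have h : Tendsto (fun u : ℝ => 1 - Γ / u ^ 2) atTop (nhds (1 - 0)) :=
    tendsto_const_nhds.sub (tendsto_const_nhds.div_atTop (tendsto_pow_atTop two_ne_zero))
  rw [sub_zero] at h
  refine h.congr' ?_
  filter_upwards [eventually_gt_atTop 0] with u hu
  field_simp

theorem tendsto_sq_sub_sq (Γ : ℝ) :
    Tendsto (fun u : ℝ => u ^ 2 - (u - Γ / u) ^ 2) atTop (nhds (2 * Γ)) := by
  have h : Tendsto (fun u : ℝ => 2 * Γ - Γ ^ 2 / u ^ 2) atTop (nhds (2 * Γ - 0)) :=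
    tendsto_const_nhds.sub (tendsto_const_nhds.div_atTop (tendsto_pow_atTop two_ne_zero))
  rw [sub_zero] at h
  refine h.congr' ?_
  filter_upwards [eventually_gt_atTop 0] with u hu
  field_simp
  ring

theorem gaussTail_le {x W : ℝ} (hx : 0 < x) (hW : 0 < W) :
    gaussTail x W ≤ √W / x * (√(2 * π))⁻¹ * exp (-(x ^ 2 / 2 * (2 - W))) := by
  unfold gaussTail
  gcongr
  rw [neg_div, neg_le_neg_iff, le_div_iff₀ (by positivity)]
  have : W * (2 - W) ≤ 1 := by nlinarith [sq_nonneg (W - 1)]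
  nlinarith [sq_nonneg x]

theorem rpow_le_one_sub {a τ : ℝ} (ha : 0 < a) (ha1 : a < 1) (hτ : 0 ≤ τ) :
    τ ^ a ≤ 1 - a * (1 - τ) := by
  have := rpow_one_add_le_one_add_mul_self (s := τ - 1) (p := a) (by linarith) ha.le ha1.le
  rw [show 1 + (τ - 1) = τ by ring] at this
  linarith

theorem inv_one_sub_exp_neg_le {x : ℝ} (hx : 0 < x) : (1 - exp (-x))⁻¹ ≤ 1 + 1 / x := by
  have h1 : exp (-x) ≤ (1 + x)⁻¹ := by
    rw [exp_neg]
    exact inv_anti₀ (by positivity) (by linarith [add_one_le_exp x])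
  have h2 : 1 + 1 / x = (1 - (1 + x)⁻¹)⁻¹ := by
    have : 1 - (1 + x)⁻¹ = x / (1 + x) := by field_simp; ring
    rw [this, inv_div]; field_simp; ring
  rw [h2]
  refine inv_anti₀ ?_ (by linarith)
  rw [sub_pos]
  exact inv_lt_one_of_one_lt₀ (by linarith)

/-- Geometric sum of the exponential decay of the tail away from lag one. -/
theorem sum_exp_neg_lag_le {c h : ℝ} (hc : 0 < c) (hh : 0 < h) (D : ℕ) :
    ∑ d ∈ Finset.range D, exp (-(c * (1 - d * h))) ≤
      exp (-(c * (1 - D * h))) * (1 + 1 / (c * h)) := by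
  have hx : 0 < c * h := by positivity
  have hq1 : exp (-(c * h)) < 1 := exp_lt_one_iff.mpr (by linarith)
  have e : ∀ d ∈ Finset.range D, exp (-(c * (1 - d * h))) ≤
      exp (-(c * (1 - D * h))) * exp (-(c * h)) ^ (D - 1 - d) := by
    intro d hd
    rw [Finset.mem_range] at hd
    rw [← exp_nat_mul, ← exp_add]
    refine exp_le_exp.mpr ?_
    have : ((D - 1 - d : ℕ) : ℝ) = D - 1 - d := by
      rw [Nat.sub_sub, Nat.cast_sub (by omega)]; push_cast; ring
    rw [this]
    nlinarith
  refine (Finset.sum_le_sum e).trans ?_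
  rw [← Finset.mul_sum, Finset.sum_range_reflect (fun j => exp (-(c * h)) ^ j)]
  refine mul_le_mul_of_nonneg_left ?_ (exp_pos _).le
  refine le_trans ?_ (inv_one_sub_exp_neg_le hx)
  rw [← tsum_geometric_of_lt_one (exp_pos _).le hq1]
  exact (summable_geometric_of_lt_one (exp_pos _).le hq1).sum_le_tsum _ fun j _ => by positivity

namespace IsFBM

variable {Ω : Type*} [MeasurableSpace Ω] {μ : Measure Ω} [IsProbabilityMeasure μ]
  {a : ℝ} {B : ℝ → Ω → ℝ}

/-- The block asymptotics hold uniformly over the position and over lags close to one. -/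
theorem eventually_block (hB : IsFBM μ a B) (ha : 0 < a) (ha1 : a < 1) {δ : ℝ} (hδ : 0 < δ)
    (n : ℕ) [NeZero n] (Γ : ℝ) {ε : ℝ} (hε : 0 < ε) :
    ∃ η > 0, η < 1 ∧ ∀ᶠ u in atTop, ∀ s τ : ℝ, 0 ≤ s → |τ - 1| < η →
      (pickands μ a B δ n ^ 2 - ε) * gaussTail (u - Γ / u) (τ ^ a) ≤
        μ.real {ω | ∃ p : Fin n × Fin n, u - Γ / u <
          incr B (s + p.1 * mesh a δ u, s + τ + p.2 * mesh a δ u) ω} ∧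
      μ.real {ω | ∃ p : Fin n × Fin n, u - Γ / u <
          incr B (s + p.1 * mesh a δ u, s + τ + p.2 * mesh a δ u) ω} ≤
      (pickands μ a B δ n ^ 2 + ε) * gaussTail (u - Γ / u) (τ ^ a) := by
  set l : Filter (ℝ × ℝ × ℝ) := atTop ×ˢ (nhds 1 ×ˢ 𝓟 (Ici 0)) with hl
  have hu : Tendsto (fun i : ℝ × ℝ × ℝ => i.1) l atTop := tendsto_fst
  have hτ : Tendsto (fun i : ℝ × ℝ × ℝ => i.2.1) l (nhds 1) := tendsto_fst.comp tendsto_snd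
  have hs : ∀ᶠ i : ℝ × ℝ × ℝ in l, 0 ≤ i.2.2 := by
    have : Tendsto (fun i : ℝ × ℝ × ℝ => i.2.2) l (𝓟 (Ici 0)) := tendsto_snd.comp tendsto_snd
    exact this.eventually (mem_principal_self _)
  have hvu := tendsto_sub_div_div Γ
  have hvh : Tendsto (fun u => (u - Γ / u) ^ 2 * mesh a δ u) atTop (nhds 0) := by
    have := (hvu.pow 2).mul (tendsto_sq_mul_mesh ha ha1 δ)
    rw [mul_zero] at this
    refine this.congr' ?_
    filter_upwards [eventually_gt_atTop 0] with u hu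
    field_simp
  have hvha : Tendsto (fun u => (u - Γ / u) ^ 2 * mesh a δ u ^ a) atTop (nhds (2 * δ ^ a)) := by
    have := (hvu.pow 2).mul_const (2 * δ ^ a)
    rw [one_pow, one_mul] at this
    refine this.congr' ?_
    filter_upwards [eventually_gt_atTop 0] with u hu
    rw [mesh_rpow ha hδ hu]
    field_simp
  have hlim := hB.tendsto_measureReal_block ha (l := l) (s := fun i => i.2.2) (τ := fun i => i.2.1)
    (h := fun i => mesh a δ i.1) (v := fun i => i.1 - Γ / i.1) hδ (n := n) hs hτ
    (hu.eventually ((eventually_gt_atTop 0).mono fun u hu => (mesh_pos hδ hu).le))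
    ((tendsto_mesh ha δ).comp hu) ((tendsto_sub_div_atTop Γ).comp hu) (hvh.comp hu) (hvha.comp hu)
  have hev := hlim.eventually (Icc_mem_nhds (a := pickands μ a B δ n ^ 2 - ε)
    (b := pickands μ a B δ n ^ 2 + ε) (by linarith) (by linarith))
  obtain ⟨pa, hpa, pb, hpb, H⟩ := eventually_prod_iff.mp hev
  obtain ⟨pc, hpc, pd, hpd, H'⟩ := eventually_prod_iff.mp hpb
  obtain ⟨η, hη, hη'⟩ := Metric.eventually_nhds_iff.mp hpc
  refine ⟨min η (1 / 2), by positivity, (min_le_right _ _).trans_lt (by norm_num), ?_⟩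
  filter_upwards [hpa, (tendsto_sub_div_atTop Γ).eventually_gt_atTop 0] with u hu1 hu2 s τ hs hτ
  have h1 := H hu1 (H' (hη' (y := τ) (hτ.trans_le (min_le_left _ _))) (hpd (a := s) hs))
  have hτ0 : 0 < τ := by
    have := (abs_lt.mp (hτ.trans_le (min_le_right _ _))).1
    linarith
  have hg : 0 < gaussTail (u - Γ / u) (τ ^ a) := gaussTail_pos hu2 (by positivity)
  exact ⟨(le_div_iff₀ hg).mp h1.1, (div_le_iff₀ hg).mp h1.2⟩

end IsFBM

/-- The order of magnitude of the tail: one-point tail times the number of effective grid points. -/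
noncomputable def mainRate (a δ u : ℝ) : ℝ := gaussTail u 1 / (u ^ 2 * mesh a δ u ^ 2)

theorem mainRate_pos {a δ u : ℝ} (hδ : 0 < δ) (hu : 0 < u) : 0 < mainRate a δ u := by
  have := gaussTail_pos hu one_pos
  have := mesh_pos (a := a) hδ hu
  unfold mainRate; positivity

theorem inv_mul_exp_eq_mainRate {a δ u v : ℝ} (hδ : 0 < δ) (hu : 0 < u) (hv : 0 < v) :
    1 / v * (√(2 * π))⁻¹ * exp (-(v ^ 2 / 2)) =
      mainRate a δ u * (u ^ 2 * mesh a δ u ^ 2) * ((v / u)⁻¹ * exp ((u ^ 2 - v ^ 2) / 2)) := by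
  have hm := mesh_pos (a := a) hδ hu
  have e : exp (-(v ^ 2 / 2)) = exp (-u ^ 2 / (2 * 1)) * exp ((u ^ 2 - v ^ 2) / 2) := by
    rw [← exp_add]; congr 1; ring
  unfold mainRate gaussTail
  rw [e, Real.sqrt_one]
  field_simp

theorem tendsto_tail_ratio (Γ : ℝ) :
    Tendsto (fun u : ℝ => ((u - Γ / u) / u)⁻¹ * exp ((u ^ 2 - (u - Γ / u) ^ 2) / 2)) atTop
      (nhds (exp Γ)) := by
  have h1 := (tendsto_sub_div_div Γ).inv₀ one_ne_zero
  have h2 := (continuous_exp.tendsto _).comp ((tendsto_sq_sub_sq Γ).div_const 2)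
  have := h1.mul h2
  rw [inv_one, one_mul, mul_div_cancel_left₀ _ (two_ne_zero' ℝ)] at this
  exact this

namespace IsFBM

variable {Ω : Type*} [MeasurableSpace Ω] {μ : Measure Ω} [IsProbabilityMeasure μ]
  {a : ℝ} {B : ℝ → Ω → ℝ}

omit [IsProbabilityMeasure μ] in
theorem measureReal_lt_le_gaussTail {X : Ω → ℝ} (hX : Measurable X) {V : ℝ}
    (hmap : μ.map X = gaussianReal 0 V.toNNReal) {W x : ℝ} (hW : 0 < W) (hVW : V ≤ W)
    (hx : 0 < x) : μ.real {ω | x < X ω} ≤ gaussTail x W := by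
  have h : μ.real {ω | x < X ω} = (gaussianReal 0 V.toNNReal).real (Ioi x) := by
    rw [← hmap, map_measureReal_apply hX measurableSet_Ioi]
    rfl
  rw [h]
  refine gaussianReal_Ioi_le_gaussTail hW ?_ hx
  rw [Real.coe_toNNReal']
  exact max_le hVW hW.le

theorem measureReal_incr_lt_le (hB : IsFBM μ a B) (ha : 0 < a) (ha1 : a < 1) {s τ v : ℝ}
    (hs : 0 ≤ s) (hτ : 0 ≤ τ) (hv : 0 < v) : μ.real {ω | v < incr B (s, s + τ) ω} ≤
      √(1 - a * (1 - τ)) / v * (√(2 * π))⁻¹ * exp (-(v ^ 2 / 2)) *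
        exp (-(a * v ^ 2 / 2 * (1 - τ))) := by
  have hW : 0 < 1 - a * (1 - τ) := by nlinarith
  have hmap := hB.map_add_mul_incr (s, s + τ) (s, s + τ) 1 0
  simp only [one_mul, zero_mul, add_zero, one_pow, mul_zero, zero_pow two_ne_zero] at hmap
  rw [hB.variance_incr ha hs (show 0 ≤ s + τ by linarith)] at hmap
  simp only [add_sub_cancel_left, abs_of_nonneg hτ] at hmap
  refine (measureReal_lt_le_gaussTail (hB.measurable_incr _) hmap hW
    (rpow_le_one_sub ha ha1 hτ) hv).trans ((gaussTail_le hv hW).trans_eq ?_)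
  rw [mul_assoc _ (exp _), ← exp_add]
  ring_nf

omit [MeasurableSpace Ω] in
theorem near_subset_iUnion_block (n : ℕ) [NeZero n] {h v η : ℝ} (hh : 0 < h) (N D : ℕ) :
    {ω : Ω | ∃ i < N, ∃ d < D, 1 - η ≤ (d : ℝ) * h ∧
      v < incr B (i * h, i * h + d * h) ω} ⊆
    ⋃ I ∈ Finset.range (N / n + 1), ⋃ K ∈ (Finset.range (D / n + 2)).filter
      (fun K : ℕ => 1 - η - n * h ≤ K * (n * h)), {ω | ∃ p : Fin n × Fin n, v <
        incr B (I * (n * h) + p.1 * h, I * (n * h) + K * (n * h) + p.2 * h) ω} := by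
  have hn : 0 < n := Nat.pos_of_ne_zero (NeZero.ne n)
  rintro ω ⟨i, hi, d, hd, hη, hlt⟩
  have hi' : n * (i / n) + i % n = i := Nat.div_add_mod _ _
  have hj' : n * ((i + d) / n) + (i + d) % n = i + d := Nat.div_add_mod _ _
  have hle : i / n ≤ (i + d) / n := Nat.div_le_div_right (by omega)
  obtain ⟨K, hK⟩ := Nat.exists_eq_add_of_le hle
  have hm1 := Nat.mod_lt i hn
  have hm2 := Nat.mod_lt (i + d) hn
  have hkey : n * K + (i + d) % n = d + i % n := by
    rw [hK, mul_add] at hj'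
    omega
  have hkeyR : (n : ℝ) * K + ((i + d) % n : ℕ) = d + (i % n : ℕ) := by exact_mod_cast hkey
  simp only [mem_iUnion, Finset.mem_range, Finset.mem_filter, exists_prop]
  refine ⟨i / n, Nat.lt_succ_of_le (Nat.div_le_div_right hi.le), K, ⟨?_, ?_⟩,
    (⟨i % n, hm1⟩, ⟨(i + d) % n, hm2⟩), ?_⟩
  · have h1 : n * K < n * (D / n + 2) := by
      have := Nat.div_add_mod D n
      have := Nat.mod_lt D hn
      rw [mul_add]
      omega
    exact lt_of_mul_lt_mul_left h1 (Nat.zero_le _)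
  · have h2 : (((i + d) % n : ℕ) : ℝ) ≤ n := by exact_mod_cast hm2.le
    have h3 : (0 : ℝ) ≤ (i % n : ℕ) := by positivity
    nlinarith
  · have e1 : ((i / n : ℕ) : ℝ) * (n * h) + ((i % n : ℕ) : ℝ) * h = i * h := by
      have : (n : ℝ) * (i / n : ℕ) + (i % n : ℕ) = i := by exact_mod_cast hi'
      linear_combination h * this
    have e2 : ((i / n : ℕ) : ℝ) * (n * h) + K * (n * h) + (((i + d) % n : ℕ) : ℝ) * h =
        i * h + d * h := by
      linear_combination e1 + h * hkeyR
    change v < incr B (((i / n : ℕ) : ℝ) * (n * h) + ((i % n : ℕ) : ℝ) * h,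
      ((i / n : ℕ) : ℝ) * (n * h) + K * (n * h) + (((i + d) % n : ℕ) : ℝ) * h) ω
    rwa [e1, e2]

set_option maxHeartbeats 800000 in
/-- Contribution to the tail of grid points with lag close to one. -/
theorem exists_measureReal_near_le (hB : IsFBM μ a B) (ha : 0 < a) (ha1 : a < 1) {δ T : ℝ}
    (hδ : 0 < δ) (hT : 0 < T) (n : ℕ) [NeZero n] (Γ : ℝ) {ε : ℝ} (hε : 0 < ε) :
    ∃ η > 0, η < 1 ∧ ∀ᶠ u in atTop, ∀ N D : ℕ, N * mesh a δ u ≤ T + 2 * mesh a δ u →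
      D * mesh a δ u ≤ 1 + 2 * mesh a δ u →
      μ.real {ω | ∃ i < N, ∃ d < D, 1 - η ≤ (d : ℝ) * mesh a δ u ∧
        u - Γ / u < incr B (i * mesh a δ u, i * mesh a δ u + d * mesh a δ u) ω} ≤
      (2 * T / a * exp Γ * (pickands μ a B δ n / n) ^ 2 + ε) * mainRate a δ u := by
  have hn : (0 : ℝ) < n := by have := NeZero.ne n; positivity
  set p := pickands μ a B δ n
  set ε' := ε / 2 / (2 * T / a * exp Γ / n ^ 2) with hε'
  have hε'0 : 0 < ε' := by positivity
  obtain ⟨η₀, hη₀, hη₁, hblock⟩ := hB.eventually_block ha ha1 hδ n Γ hε'0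
  refine ⟨η₀ / 2, by positivity, by linarith, ?_⟩
  set h := mesh a δ with hh
  have hlim0 : Tendsto h atTop (nhds 0) := tendsto_mesh ha δ
  have hlim1 : Tendsto (fun u => u ^ 2 * h u) atTop (nhds 0) := tendsto_sq_mul_mesh ha ha1 δ
  have hvu := tendsto_sub_div_div Γ
  have hlim2 : Tendsto (fun u => a * (u - Γ / u) ^ 2 / 2 * ((2 * n + 2) * h u)) atTop (nhds 0) := by
    have := ((hvu.pow 2).mul hlim1).const_mul (a / 2 * (2 * n + 2))
    rw [mul_zero, mul_zero] at this
    refine this.congr' ?_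
    filter_upwards [eventually_gt_atTop 0] with u hu
    field_simp
  have hF : Tendsto (fun u => (p ^ 2 + ε') * ((T + 2 * h u) / n + h u) *
      √(1 + a * ((n + 2) * h u)) *
      (((u - Γ / u) / u)⁻¹ * exp ((u ^ 2 - (u - Γ / u) ^ 2) / 2)) *
      exp (a * (u - Γ / u) ^ 2 / 2 * ((2 * n + 2) * h u)) *
      (u ^ 2 * h u + 2 / (a * n) * ((u - Γ / u) / u)⁻¹ ^ 2)) atTop
      (nhds ((p ^ 2 + ε') * ((T + 2 * 0) / n + 0) * √(1 + a * ((n + 2) * 0)) * exp Γ * exp 0 *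
        (0 + 2 / (a * n) * 1⁻¹ ^ 2))) := by
    refine (((((tendsto_const_nhds.mul ((((hlim0.const_mul 2).const_add T).div_const _).add
      hlim0)).mul ?_).mul (tendsto_tail_ratio Γ)).mul
      ((continuous_exp.tendsto _).comp hlim2)).mul (hlim1.add
        (((hvu.inv₀ one_ne_zero).pow 2).const_mul _)))
    exact (Real.continuous_sqrt.tendsto _).comp
      (((hlim0.const_mul _).const_mul _).const_add 1)
  have hval : (p ^ 2 + ε') * ((T + 2 * 0) / n + 0) * √(1 + a * ((n + 2) * 0)) * exp Γ * exp 0 *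
        (0 + 2 / (a * n) * 1⁻¹ ^ 2) = 2 * T / a * exp Γ * (p / n) ^ 2 + ε / 2 := by
    have e : ε' * (2 * T / a * exp Γ / n ^ 2) = ε / 2 := by
      rw [hε', div_mul_cancel₀ _ (by positivity)]
    rw [← e]
    simp only [mul_zero, add_zero, zero_add, Real.sqrt_one, exp_zero, inv_one]
    field_simp
  rw [hval] at hF
  filter_upwards [hF.eventually (gt_mem_nhds (show _ < 2 * T / a * exp Γ * (p / n) ^ 2 + ε by
    linarith)), hblock, eventually_gt_atTop 0, (tendsto_sub_div_atTop Γ).eventually_gt_atTop 0,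
    hlim0.eventually (gt_mem_nhds (show 0 < η₀ / 2 / (n + 2) by positivity))]
    with u hu hb hu0 hv hhu N D hN hD
  have hh0 : 0 < h u := mesh_pos hδ hu0
  set v := u - Γ / u with hv_def
  rw [lt_div_iff₀ (by positivity)] at hhu
  set c := a * v ^ 2 / 2 with hc
  have hc0 : 0 < c := by positivity
  have hDn : ((D / n : ℕ) : ℝ) * n ≤ D := by exact_mod_cast Nat.div_mul_le_self D n
  have hNn : ((N / n : ℕ) : ℝ) * n ≤ N := by exact_mod_cast Nat.div_mul_le_self N n
  set A := (p ^ 2 + ε') * (√(1 + a * ((n + 2) * h u)) / v * (√(2 * π))⁻¹ * exp (-(v ^ 2 / 2)))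
    with hA
  have hA0 : 0 ≤ A := by positivity
  have hKbound : ∀ I : ℕ, ∀ K ∈ (Finset.range (D / n + 2)).filter
      (fun K : ℕ => 1 - η₀ / 2 - n * h u ≤ K * (n * h u)),
      μ.real {ω | ∃ p : Fin n × Fin n, v < incr B (I * (n * h u) + p.1 * h u,
        I * (n * h u) + K * (n * h u) + p.2 * h u) ω} ≤ A * exp (-(c * (1 - K * (n * h u)))) := by
    intro I K hK
    rw [Finset.mem_filter, Finset.mem_range] at hK
    have hK1 : (K : ℝ) ≤ (D / n : ℕ) + 1 := by exact_mod_cast Nat.lt_succ_iff.mp hK.1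
    have hK2 : (K : ℝ) * (n * h u) ≤ 1 + (n + 2) * h u := by
      calc (K : ℝ) * (n * h u) ≤ ((D / n : ℕ) + 1) * (n * h u) := by gcongr
        _ = ((D / n : ℕ) * n) * h u + n * h u := by ring
        _ ≤ D * h u + n * h u := by gcongr
        _ ≤ _ := by linarith
    have hτ : |(K : ℝ) * (n * h u) - 1| < η₀ := by
      have : n * h u < η₀ / 2 := by linarith
      rw [abs_lt]
      constructor <;> linarith
    have hτ0 : 0 < (K : ℝ) * (n * h u) := by have := (abs_lt.mp hτ).1; linarith
    refine (hb (I * (n * h u)) (K * (n * h u)) (by positivity) hτ).2.trans ?_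
    rw [hA, mul_assoc]
    refine mul_le_mul_of_nonneg_left ?_ (by positivity)
    have hW : 0 < 1 - a * (1 - K * (n * h u)) := by linarith [mul_pos ha hτ0]
    refine (gaussTail_mono hv (by positivity) (rpow_le_one_sub ha ha1 hτ0.le)).trans
      ((gaussTail_le hv hW).trans ?_)
    rw [mul_assoc _ (exp _), ← exp_add]
    have hs : √(1 - a * (1 - K * (n * h u))) ≤ √(1 + a * ((n + 2) * h u)) :=
      Real.sqrt_le_sqrt (by linarith [mul_le_mul_of_nonneg_left hK2 ha.le])
    have he : -(v ^ 2 / 2 * (2 - (1 - a * (1 - K * (n * h u))))) =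
      -(v ^ 2 / 2) + -(c * (1 - K * (n * h u))) := by rw [hc]; ring
    rw [he]
    gcongr
  have hsumK : ∑ K ∈ (Finset.range (D / n + 2)).filter
      (fun K : ℕ => 1 - η₀ / 2 - n * h u ≤ K * (n * h u)), exp (-(c * (1 - K * (n * h u)))) ≤
      exp (c * ((2 * n + 2) * h u)) * (1 + 1 / (c * (n * h u))) := by
    refine (Finset.sum_le_sum_of_subset_of_nonneg (Finset.filter_subset _ _)
      fun _ _ _ => (exp_pos _).le).trans ((sum_exp_neg_lag_le hc0 (by positivity) _).trans ?_)
    gcongr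
    push_cast
    have : ((D / n : ℕ) : ℝ) * n * h u ≤ D * h u := by gcongr
    rw [← mul_neg]
    refine mul_le_mul_of_nonneg_left ?_ hc0.le
    linarith
  refine (measureReal_mono (near_subset_iUnion_block n hh0 N D) (measure_ne_top _ _)).trans ?_
  refine (measureReal_biUnion_finset_le _ _).trans ?_
  have hI : ∀ I ∈ Finset.range (N / n + 1), μ.real (⋃ K ∈ (Finset.range (D / n + 2)).filter
      (fun K : ℕ => 1 - η₀ / 2 - n * h u ≤ K * (n * h u)), {ω | ∃ p : Fin n × Fin n, v <
        incr B (I * (n * h u) + p.1 * h u, I * (n * h u) + K * (n * h u) + p.2 * h u) ω}) ≤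
      A * (exp (c * ((2 * n + 2) * h u)) * (1 + 1 / (c * (n * h u)))) := by
    intro I _
    refine (measureReal_biUnion_finset_le _ _).trans ((Finset.sum_le_sum (hKbound I)).trans ?_)
    rw [← Finset.mul_sum]
    gcongr
  refine (Finset.sum_le_card_nsmul _ _ _ hI).trans ?_
  rw [Finset.card_range, nsmul_eq_mul]
  have hcount : (((N / n + 1 : ℕ)) : ℝ) ≤ ((T + 2 * h u) / n + h u) / h u := by
    rw [le_div_iff₀ hh0]
    push_cast
    have : ((N / n : ℕ) : ℝ) * h u ≤ (T + 2 * h u) / n := by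
      rw [le_div_iff₀ hn]
      calc ((N / n : ℕ) : ℝ) * h u * n = ((N / n : ℕ) : ℝ) * n * h u := by ring
        _ ≤ N * h u := by gcongr
        _ ≤ _ := hN
    linarith
  refine (mul_le_mul_of_nonneg_right hcount (by positivity)).trans ?_
  refine le_trans (le_of_eq ?_)
    (mul_le_mul_of_nonneg_right hu.le (mainRate_pos (a := a) hδ hu0).le)
  have e := inv_mul_exp_eq_mainRate (a := a) hδ hu0 hv
  have e2 : A = (p ^ 2 + ε') * √(1 + a * ((n + 2) * h u)) *
    (1 / v * (√(2 * π))⁻¹ * exp (-(v ^ 2 / 2))) := by rw [hA]; ring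
  rw [e2, e, ← hh, hc]
  field_simp

/-- Grid points with lag bounded away from one do not contribute to the tail. -/
theorem eventually_measureReal_far_le (hB : IsFBM μ a B) (ha : 0 < a) (ha1 : a < 1) {δ T : ℝ}
    (hδ : 0 < δ) (Γ : ℝ) {η : ℝ} (hη : 0 < η) (hη1 : η < 1) {ε : ℝ} (hε : 0 < ε) :
    ∀ᶠ u in atTop, ∀ N D : ℕ, N * mesh a δ u ≤ T + 2 * mesh a δ u →
      μ.real {ω | ∃ i < N, ∃ d < D, (d : ℝ) * mesh a δ u < 1 - η ∧
        u - Γ / u < incr B (i * mesh a δ u, i * mesh a δ u + d * mesh a δ u) ω} ≤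
      ε * mainRate a δ u := by
  set h := mesh a δ with hh
  have hlim0 : Tendsto h atTop (nhds 0) := tendsto_mesh ha δ
  have hlim1 : Tendsto (fun u => u ^ 2 * h u) atTop (nhds 0) := tendsto_sq_mul_mesh ha ha1 δ
  have hvu := tendsto_sub_div_div Γ
  have hlim2 : Tendsto (fun u => exp (-(a * (u - Γ / u) ^ 2 / 2 * (η - h u)))) atTop (nhds 0) := by
    refine tendsto_exp_atBot.comp (tendsto_neg_atTop_atBot.comp ?_)
    refine Tendsto.atTop_mul_pos hη ?_ (by simpa using hlim0.const_sub η)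
    exact (((tendsto_pow_atTop two_ne_zero).comp (tendsto_sub_div_atTop Γ)).const_mul_atTop
      ha).atTop_div_const two_pos
  have hF : Tendsto (fun u => (T + 2 * h u) *
      (((u - Γ / u) / u)⁻¹ * exp ((u ^ 2 - (u - Γ / u) ^ 2) / 2)) *
      exp (-(a * (u - Γ / u) ^ 2 / 2 * (η - h u))) *
      (u ^ 2 * h u + 2 / a * ((u - Γ / u) / u)⁻¹ ^ 2)) atTop
      (nhds ((T + 2 * 0) * exp Γ * 0 * (0 + 2 / a * 1⁻¹ ^ 2))) :=
    (((((hlim0.const_mul 2).const_add T).mul (tendsto_tail_ratio Γ)).mul hlim2).mul (hlim1.add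
        (((hvu.inv₀ one_ne_zero).pow 2).const_mul _)))
  rw [mul_zero, zero_mul] at hF
  filter_upwards [hF.eventually (gt_mem_nhds hε), eventually_gt_atTop 0,
    (tendsto_sub_div_atTop Γ).eventually_gt_atTop 0] with u hu hu0 hv N D hN
  have hh0 : 0 < h u := mesh_pos hδ hu0
  set v := u - Γ / u with hv_def
  set c := a * v ^ 2 / 2 with hc
  have hc0 : 0 < c := by positivity
  set M := ⌈(1 - η) / h u⌉₊ with hM
  have hM1 : (M : ℝ) * h u ≤ 1 - η + h u := by
    have := Nat.ceil_lt_add_one (show 0 ≤ (1 - η) / h u by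
      have : 0 < 1 - η := by linarith
      positivity)
    calc (M : ℝ) * h u ≤ ((1 - η) / h u + 1) * h u := by gcongr
      _ = _ := by field_simp
  set A := 1 / v * (√(2 * π))⁻¹ * exp (-(v ^ 2 / 2)) with hA
  have hA0 : 0 ≤ A := by positivity
  have hsub : {ω | ∃ i < N, ∃ d < D, (d : ℝ) * h u < 1 - η ∧
        v < incr B (i * h u, i * h u + d * h u) ω} ⊆
      ⋃ i ∈ Finset.range N, ⋃ d ∈ Finset.range M,
        {ω | v < incr B (i * h u, i * h u + d * h u) ω} := by
    rintro ω ⟨i, hi, d, -, hdη, hlt⟩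
    simp only [mem_iUnion, Finset.mem_range, exists_prop]
    exact ⟨i, hi, d, Nat.lt_ceil.mpr (by rwa [lt_div_iff₀ hh0]), hlt⟩
  have hpt : ∀ i : ℕ, ∀ d ∈ Finset.range M, μ.real {ω | v < incr B (i * h u, i * h u + d * h u) ω} ≤
      A * exp (-(c * (1 - d * h u))) := by
    intro i d hd
    have hd1 : (d : ℝ) * h u < 1 - η := by
      rw [← lt_div_iff₀ hh0]
      exact Nat.lt_ceil.mp (Finset.mem_range.mp hd)
    refine (hB.measureReal_incr_lt_le ha ha1 (by positivity) (by positivity) hv).trans ?_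
    have hs : √(1 - a * (1 - d * h u)) ≤ 1 := by
      have : 0 < a * (1 - d * h u) := mul_pos ha (by linarith)
      exact Real.sqrt_le_iff.mpr ⟨zero_le_one, by linarith⟩
    rw [hA]
    gcongr
  refine (measureReal_mono hsub (measure_ne_top _ _)).trans ?_
  refine (measureReal_biUnion_finset_le _ _).trans ?_
  have hI : ∀ i ∈ Finset.range N, μ.real (⋃ d ∈ Finset.range M,
        {ω | v < incr B (i * h u, i * h u + d * h u) ω}) ≤
      A * (exp (-(c * (η - h u))) * (1 + 1 / (c * h u))) := by
    intro i _
    refine (measureReal_biUnion_finset_le _ _).trans ((Finset.sum_le_sum (hpt i)).trans ?_)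
    rw [← Finset.mul_sum]
    refine mul_le_mul_of_nonneg_left ((sum_exp_neg_lag_le hc0 hh0 M).trans ?_) hA0
    exact mul_le_mul_of_nonneg_right (exp_le_exp.mpr (neg_le_neg
      (mul_le_mul_of_nonneg_left (by linarith) hc0.le))) (by positivity)
  refine (Finset.sum_le_card_nsmul _ _ _ hI).trans ?_
  rw [Finset.card_range, nsmul_eq_mul]
  have hcount : (N : ℝ) ≤ (T + 2 * h u) / h u := by
    rw [le_div_iff₀ hh0]; exact hN
  refine (mul_le_mul_of_nonneg_right hcount (by positivity)).trans ?_
  refine le_trans (le_of_eq ?_)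
    (mul_le_mul_of_nonneg_right hu.le (mainRate_pos (a := a) hδ hu0).le)
  rw [hA, inv_mul_exp_eq_mainRate (a := a) hδ hu0 hv, ← hh, hc]
  field_simp

end IsFBM

theorem rpow_abs_sub_le {a x y z : ℝ} (ha : 0 ≤ a) (ha1 : a ≤ 1) :
    |x - z| ^ a ≤ |x - y| ^ a + |y - z| ^ a :=
  (Real.rpow_le_rpow (abs_nonneg _) (abs_sub_le x y z) ha).trans
    (Real.rpow_add_le_add_rpow (abs_nonneg _) (abs_nonneg _) ha ha1)

theorem mesh_div (a δ u c : ℝ) : mesh a (δ / c) u = mesh a δ u / c := by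
  unfold mesh; ring

namespace IsFBM

variable {Ω : Type*} [MeasurableSpace Ω] {μ : Measure Ω} [IsProbabilityMeasure μ]
  {a : ℝ} {B : ℝ → Ω → ℝ}

/-- Variance of an increment tilted by its difference with a neighbouring increment. -/
theorem variance_tilt_le (hB : IsFBM μ a B) (ha : 0 < a) (ha1 : a < 1) {p q : ℝ × ℝ} {x θ : ℝ}
    (hp1 : 0 ≤ p.1) (hp : p.1 ≤ p.2) (hq1 : 0 ≤ q.1) (hq : q.1 ≤ q.2)
    (h1 : |p.1 - q.1| ≤ x) (h2 : |p.2 - q.2| ≤ 2 * x)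
    (h3 : |(p.2 - p.1) - (q.2 - q.1)| ≤ x) (hθ : 0 ≤ θ) :
    (1 + θ) ^ 2 * Var[incr B p; μ] + 2 * (1 + θ) * (-θ) * cov[incr B p, incr B q; μ] +
      (-θ) ^ 2 * Var[incr B q; μ] ≤ (p.2 - p.1) ^ a + (6 * θ + 5 * θ ^ 2) * x ^ a := by
  have hx : 0 ≤ x := (abs_nonneg _).trans h1
  rw [hB.variance_incr ha hp1 (hp1.trans hp), hB.variance_incr ha hq1 (hq1.trans hq),
    hB.covariance_incr hp1 (hp1.trans hp) hq1 (hq1.trans hq)]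
  have e1 : |p.1 - q.1| ^ a ≤ x ^ a := Real.rpow_le_rpow (abs_nonneg _) h1 ha.le
  have e2 : |p.2 - q.2| ^ a ≤ 2 * x ^ a := by
    refine (Real.rpow_le_rpow (abs_nonneg _) h2 ha.le).trans ?_
    rw [Real.mul_rpow (by norm_num) hx]
    refine mul_le_mul_of_nonneg_right ?_ (by positivity)
    simpa using Real.rpow_le_rpow_of_exponent_le one_le_two ha1.le
  have e3 : |p.2 - p.1| ^ a ≤ |q.2 - q.1| ^ a + x ^ a := by
    rw [abs_of_nonneg (sub_nonneg.mpr hp), abs_of_nonneg (sub_nonneg.mpr hq)]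
    refine (Real.rpow_le_rpow (sub_nonneg.mpr hp) (show p.2 - p.1 ≤ (q.2 - q.1) + x by
      linarith [(abs_le.mp h3).2]) ha.le).trans ?_
    exact Real.rpow_add_le_add_rpow (sub_nonneg.mpr hq) hx ha.le ha1.le
  have e4 : |p.2 - p.1| ^ a ≤ |p.2 - q.1| ^ a + |p.1 - q.1| ^ a := by
    have := rpow_abs_sub_le (x := p.2) (y := q.1) (z := p.1) ha.le ha1.le
    rwa [abs_sub_comm q.1 p.1] at this
  have e5 : |q.2 - q.1| ^ a ≤ |p.1 - q.2| ^ a + |p.1 - q.1| ^ a := by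
    have := rpow_abs_sub_le (x := q.2) (y := p.1) (z := q.1) ha.le ha1.le
    rwa [abs_sub_comm q.2 p.1] at this
  set VD := |p.2 - p.1| ^ a + |q.2 - q.1| ^ a -
    (|p.2 - q.1| ^ a + |p.1 - q.2| ^ a - |p.2 - q.2| ^ a - |p.1 - q.1| ^ a) with hVD
  have hVD5 : VD ≤ 5 * x ^ a := by linarith
  have hmul : θ * (1 + θ) * VD ≤ θ * (1 + θ) * (5 * x ^ a) := by gcongr
  have hmul2 := mul_le_mul_of_nonneg_left e3 hθ
  have hp' : |p.2 - p.1| = p.2 - p.1 := abs_of_nonneg (sub_nonneg.mpr hp)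
  have key : (1 + θ) ^ 2 * |p.2 - p.1| ^ a + 2 * (1 + θ) * (-θ) *
      ((|p.2 - q.1| ^ a + |p.1 - q.2| ^ a - |p.2 - q.2| ^ a - |p.1 - q.1| ^ a) / 2) +
      (-θ) ^ 2 * |q.2 - q.1| ^ a =
      |p.2 - p.1| ^ a + θ * (|p.2 - p.1| ^ a - |q.2 - q.1| ^ a) + θ * (1 + θ) * VD := by
    rw [hVD]; ring
  rw [key, hp']
  rw [hp'] at hmul2
  linarith

set_option maxHeartbeats 800000 in
/-- Cost of a jump of size `ρ ^ (a / 4) / u` between neighbouring points of the grid of mesh `ρ`. -/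
theorem measureReal_jump_le (hB : IsFBM μ a B) (ha : 0 < a) (ha1 : a < 1) {p q : ℝ × ℝ}
    {ρ u γ Γ : ℝ} (hρ : 0 < ρ) (hρ1 : ρ ≤ 1) (hγ : 0 ≤ γ) (hγΓ : γ ≤ Γ) (hu : 0 < u)
    (hu1 : 88 + 2 * Γ ≤ u ^ 2)
    (hp1 : 0 ≤ p.1) (hp : p.1 ≤ p.2) (hp2 : p.2 - p.1 ≤ 5 / 4) (hq1 : 0 ≤ q.1) (hq : q.1 ≤ q.2)
    (h1 : |p.1 - q.1| ≤ mesh a ρ u) (h2 : |p.2 - q.2| ≤ 2 * mesh a ρ u)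
    (h3 : |(p.2 - p.1) - (q.2 - q.1)| ≤ mesh a ρ u) :
    μ.real {ω | u - γ / u < incr B p ω ∧ ρ ^ (a / 4) / u < incr B p ω - incr B q ω} ≤
      4 * exp (11 + 2 * Γ) * exp (-(1 / 2 * ρ ^ (-(a / 4)))) *
        (1 / u * (√(2 * π))⁻¹ * exp (-(u ^ 2 / 2))) *
        exp (-(a * u ^ 2 / 2 * (1 - (p.2 - p.1)))) := by
  set θ := ρ ^ (-(a / 2)) with hθ
  set g := ρ ^ (a / 4) with hg
  set τ := p.2 - p.1 with hτ
  set y := ρ ^ (-(a / 4)) with hy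
  have hθ0 : 0 < θ := by positivity
  have hy0 : 0 < y := by positivity
  have hτ0 : 0 ≤ τ := sub_nonneg.mpr hp
  have hθg : θ * g = y := by
    rw [hθ, hg, hy, ← Real.rpow_add hρ]; congr 1; ring
  have hΓ : 0 ≤ Γ := hγ.trans hγΓ
  have hu2 : 0 < u ^ 2 := by positivity
  set w := y - γ with hw
  set x := u + w / u with hx
  have hxu : u / 2 ≤ x := by
    have : -(u / 2) ≤ w / u := by
      rw [le_div_iff₀ hu]; nlinarith
    linarith
  have hx0 : 0 < x := by linarith [half_pos hu]
  have hsub : {ω | u - γ / u < incr B p ω ∧ g / u < incr B p ω - incr B q ω} ⊆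
      {ω | x < (1 + θ) * incr B p ω + (-θ) * incr B q ω} := by
    rintro ω ⟨h1, h2⟩
    have h3 := mul_lt_mul_of_pos_left h2 hθ0
    have h4 : x = (u - γ / u) + θ * (g / u) := by
      rw [hx, hw, ← hθg]; ring
    change x < _
    linarith
  refine (measureReal_mono hsub (measure_ne_top _ _)).trans ?_
  set W := 1 - a * (1 - τ) + 22 / u ^ 2 with hW
  have h22 : 22 / u ^ 2 ≤ 1 / 4 := by
    rw [div_le_iff₀ hu2]; linarith
  have h22' : 0 < 22 / u ^ 2 := by positivity
  have haτ := mul_nonneg ha.le hτ0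
  have haτ' := mul_le_mul_of_nonneg_left hp2 ha.le
  have hW0 : 0 < W := by linarith
  have hWV : (1 + θ) ^ 2 * Var[incr B p; μ] + 2 * (1 + θ) * (-θ) * cov[incr B p, incr B q; μ] +
      (-θ) ^ 2 * Var[incr B q; μ] ≤ W := by
    refine (hB.variance_tilt_le ha ha1 hp1 hp hq1 hq h1 h2 h3 hθ0.le).trans ?_
    have e1 := rpow_le_one_sub ha ha1 hτ0
    have e2 : (6 * θ + 5 * θ ^ 2) * mesh a ρ u ^ a ≤ 22 / u ^ 2 := by
      rw [mesh_rpow ha hρ hu]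
      have e3 : θ * ρ ^ a = ρ ^ (a / 2) := by
        rw [hθ, ← Real.rpow_add hρ]; congr 1; ring
      have e4 : θ ^ 2 * ρ ^ a = 1 := by
        rw [hθ, ← Real.rpow_natCast, ← Real.rpow_mul hρ.le, ← Real.rpow_add hρ]
        norm_num
      have e5 : ρ ^ (a / 2) ≤ 1 := Real.rpow_le_one hρ.le hρ1 (by positivity)
      rw [mul_div_assoc']
      gcongr
      have : (6 * θ + 5 * θ ^ 2) * (2 * ρ ^ a) = 12 * ρ ^ (a / 2) + 10 := by
        linear_combination 12 * e3 + 10 * e4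
      linarith
    linarith
  have hmp := hB.measurable_incr p
  have hmq := hB.measurable_incr q
  refine (measureReal_lt_le_gaussTail (by fun_prop) (hB.map_add_mul_incr p q _ _) hW0 hWV hx0).trans ?_
  refine (gaussTail_le hx0 hW0).trans ?_
  have hf1 : 1 / 2 ≤ 2 - W := by linarith
  have hf2 : 2 - W ≤ 2 := by linarith
  have hexp : u ^ 2 / 2 + a * u ^ 2 / 2 * (1 - τ) - 11 + 1 / 2 * y - 2 * Γ ≤
      x ^ 2 / 2 * (2 - W) := by
    have e1 : u ^ 2 + 2 * w ≤ x ^ 2 := by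
      have : x ^ 2 = u ^ 2 + 2 * w + (w / u) ^ 2 := by rw [hx]; field_simp; ring
      linarith [sq_nonneg (w / u)]
    have e2 : (u ^ 2 + 2 * w) / 2 * (2 - W) ≤ x ^ 2 / 2 * (2 - W) := by gcongr
    have e3 : u ^ 2 / 2 * (2 - W) = u ^ 2 / 2 + a * u ^ 2 / 2 * (1 - τ) - 11 := by
      rw [hW]; field_simp; ring
    have e4 : y * (1 / 2) ≤ y * (2 - W) := by gcongr
    have e5 : γ * (2 - W) ≤ Γ * 2 := by gcongr
    rw [hw] at e2
    linarith
  have hsq : √W ≤ 2 := Real.sqrt_le_iff.mpr ⟨by norm_num, by linarith⟩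
  have hfrac : √W / x ≤ 4 * (1 / u) := by
    calc √W / x ≤ 2 / (u / 2) := by gcongr
      _ = _ := by field_simp; norm_num
  calc √W / x * (√(2 * π))⁻¹ * exp (-(x ^ 2 / 2 * (2 - W))) ≤
      4 * (1 / u) * (√(2 * π))⁻¹ *
        exp (-(u ^ 2 / 2 + a * u ^ 2 / 2 * (1 - τ) - 11 + 1 / 2 * y - 2 * Γ)) := by gcongr
    _ = _ := by
      have : exp (-(u ^ 2 / 2 + a * u ^ 2 / 2 * (1 - τ) - 11 + 1 / 2 * y - 2 * Γ)) =
        exp (11 + 2 * Γ) * exp (-(1 / 2 * y)) * exp (-(u ^ 2 / 2)) *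
          exp (-(a * u ^ 2 / 2 * (1 - τ))) := by
        rw [← exp_add, ← exp_add, ← exp_add]; congr 1; ring
      rw [this]; ring

end IsFBM

/-- Points `(s, s + τ)` of the grid of mesh `h`. -/
def gridPt (h : ℝ) (i d : ℕ) : ℝ × ℝ := (i * h, i * h + d * h)

theorem gridPt_parent (x : ℝ) (hx : 0 ≤ x) (i d : ℕ) :
    |(gridPt x i d).1 - (gridPt (2 * x) (i / 2) (d / 2)).1| ≤ x ∧
    |(gridPt x i d).2 - (gridPt (2 * x) (i / 2) (d / 2)).2| ≤ 2 * x ∧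
    |((gridPt x i d).2 - (gridPt x i d).1) - ((gridPt (2 * x) (i / 2) (d / 2)).2 -
      (gridPt (2 * x) (i / 2) (d / 2)).1)| ≤ x := by
  have key : ∀ j : ℕ, ∃ r : ℝ, 0 ≤ r ∧ r ≤ 1 ∧ (j : ℝ) = 2 * (j / 2 : ℕ) + r := by
    intro j
    refine ⟨(j % 2 : ℕ), by positivity, ?_, ?_⟩
    · exact_mod_cast Nat.lt_succ_iff.mp (Nat.mod_lt j two_pos)
    · exact_mod_cast (Nat.div_add_mod j 2).symm
  obtain ⟨r, hr0, hr1, hr⟩ := key i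
  obtain ⟨r', hr0', hr1', hr'⟩ := key d
  have h1 := mul_le_mul_of_nonneg_right hr1 hx
  have h2 := mul_le_mul_of_nonneg_right hr1' hx
  have h3 := mul_nonneg hr0 hx
  have h4 := mul_nonneg hr0' hx
  simp only [gridPt, abs_le]
  rw [hr, hr']
  refine ⟨⟨?_, ?_⟩, ⟨?_, ?_⟩, ?_, ?_⟩ <;> linarith

namespace IsFBM

variable {Ω : Type*} [MeasurableSpace Ω] {μ : Measure Ω} [IsProbabilityMeasure μ]
  {a : ℝ} {B : ℝ → Ω → ℝ}

theorem measureReal_level_jump_le (hB : IsFBM μ a B) (ha : 0 < a) (ha1 : a < 1)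
    {ρ u γ Γ : ℝ} (hρ : 0 < ρ) (hρ1 : ρ ≤ 1) (hγ : 0 ≤ γ) (hγΓ : γ ≤ Γ) (hu : 0 < u)
    (hu1 : 88 + 2 * Γ ≤ u ^ 2) (M E : ℕ) (hE : E * mesh a ρ u ≤ 5 / 4) :
    μ.real {ω | ∃ i < M, ∃ d < E, u - γ / u < incr B (gridPt (mesh a ρ u) i d) ω ∧
      ρ ^ (a / 4) / u < incr B (gridPt (mesh a ρ u) i d) ω -
        incr B (gridPt (2 * mesh a ρ u) (i / 2) (d / 2)) ω} ≤
      M * (4 * exp (11 + 2 * Γ) * exp (-(1 / 2 * ρ ^ (-(a / 4)))) *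
        (1 / u * (√(2 * π))⁻¹ * exp (-(u ^ 2 / 2))) *
        (exp (-(a * u ^ 2 / 2 * (1 - E * mesh a ρ u))) *
          (1 + 1 / (a * u ^ 2 / 2 * mesh a ρ u)))) := by
  have hx := mesh_pos (a := a) hρ hu
  set x := mesh a ρ u with hxdef
  set A := 4 * exp (11 + 2 * Γ) * exp (-(1 / 2 * ρ ^ (-(a / 4)))) *
        (1 / u * (√(2 * π))⁻¹ * exp (-(u ^ 2 / 2))) with hA
  have hA0 : 0 ≤ A := by positivity
  have hsub : {ω | ∃ i < M, ∃ d < E, u - γ / u < incr B (gridPt x i d) ω ∧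
      ρ ^ (a / 4) / u < incr B (gridPt x i d) ω -
        incr B (gridPt (2 * x) (i / 2) (d / 2)) ω} ⊆
      ⋃ i ∈ Finset.range M, ⋃ d ∈ Finset.range E, {ω | u - γ / u < incr B (gridPt x i d) ω ∧
      ρ ^ (a / 4) / u < incr B (gridPt x i d) ω -
        incr B (gridPt (2 * x) (i / 2) (d / 2)) ω} := by
    rintro ω ⟨i, hi, d, hd, hlt⟩
    simp only [mem_iUnion, Finset.mem_range]
    exact ⟨i, hi, d, hd, hlt⟩
  refine (measureReal_mono hsub (measure_ne_top _ _)).trans ?_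
  refine (measureReal_biUnion_finset_le _ _).trans ?_
  rw [← Finset.card_range M, ← nsmul_eq_mul, Finset.card_range M]
  nth_rewrite 2 [← Finset.card_range M]
  refine Finset.sum_le_card_nsmul _ _ _ fun i _ => ?_
  refine (measureReal_biUnion_finset_le _ _).trans ?_
  refine le_trans (Finset.sum_le_sum (g := fun d : ℕ => A *
    exp (-(a * u ^ 2 / 2 * (1 - d * x)))) fun d hd => ?_) ?_
  · rw [Finset.mem_range] at hd
    obtain ⟨h1, h2, h3⟩ := gridPt_parent x hx.le i d
    have hd' : (d : ℝ) * x ≤ E * x := by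
      have : (d : ℝ) ≤ E := by exact_mod_cast hd.le
      gcongr
    have hlag : (gridPt x i d).2 - (gridPt x i d).1 = d * x := by simp [gridPt]
    have := hB.measureReal_jump_le (γ := γ) ha ha1 hρ hρ1 hγ hγΓ hu hu1
      (show 0 ≤ (gridPt x i d).1 by simp only [gridPt]; positivity)
      (by simp only [gridPt, le_add_iff_nonneg_right]; positivity) (by rw [hlag]; linarith)
      (show 0 ≤ (gridPt (2 * x) (i / 2) (d / 2)).1 by simp only [gridPt]; positivity)
      (by simp only [gridPt, le_add_iff_nonneg_right]; positivity) h1 h2 h3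
    rwa [hlag] at this
  · rw [← Finset.mul_sum]
    exact mul_le_mul_of_nonneg_left (sum_exp_neg_lag_le (by positivity) hx E) hA0

/-- The exponent budget spent on refining a grid. -/
noncomputable def chainLoss (a : ℝ) : ℝ := (1 - (2 : ℝ) ^ (-(a / 4)))⁻¹

theorem chainLoss_pos {a : ℝ} (ha : 0 < a) : 0 < chainLoss a :=
  inv_pos.mpr (sub_pos.mpr (two_rpow_neg_lt_one (by positivity)))

set_option maxHeartbeats 800000 in
/-- Refining the grid once changes the exceedance probability by a summable amount. -/
theorem exists_measureReal_refine_le (hB : IsFBM μ a B) (ha : 0 < a) (ha1 : a < 1) {T : ℝ}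
    (hT : 0 < T) (Γ : ℝ) : ∃ C > 0, ∀ δ : ℝ, 0 < δ → δ ≤ 1 → ∀ᶠ u in atTop, ∀ N D : ℕ,
      N * mesh a δ u ≤ T + 2 * mesh a δ u → D * mesh a δ u ≤ 1 + 2 * mesh a δ u →
      ∀ (k : ℕ) (γ : ℝ), 0 ≤ γ → γ ≤ Γ →
      μ.real {ω | ∃ i < N * 2 ^ (k + 1), ∃ d < D * 2 ^ (k + 1),
        u - γ / u < incr B (gridPt (mesh a δ u / 2 ^ (k + 1)) i d) ω} ≤
      μ.real {ω | ∃ i < N * 2 ^ k, ∃ d < D * 2 ^ k,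
        u - (γ + (δ / 2 ^ (k + 1)) ^ (a / 4)) / u < incr B (gridPt (mesh a δ u / 2 ^ k) i d) ω} +
      C * δ ^ 2 * (δ / 2 ^ (k + 1)) * mainRate a δ u := by
  obtain ⟨C₁, hC₁, hexp⟩ := exists_exp_neg_mul_rpow_neg_le (show 0 < a / 4 by positivity)
    (show (0 : ℝ) < 1 / 2 by norm_num) 3
  refine ⟨(T + 1) * (1 + 2 / a) * exp 1 * (4 * exp (11 + 2 * Γ)) * C₁, by positivity,
    fun δ hδ hδ1 => ?_⟩
  have hlim0 : Tendsto (mesh a δ) atTop (nhds 0) := tendsto_mesh ha δ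
  have hlim1 : Tendsto (fun u => u ^ 2 * mesh a δ u) atTop (nhds 0) := tendsto_sq_mul_mesh ha ha1 δ
  filter_upwards [hlim0.eventually (gt_mem_nhds (show (0 : ℝ) < 1 / 8 by norm_num)),
    hlim1.eventually (gt_mem_nhds one_pos), eventually_gt_atTop 0,
    (tendsto_pow_atTop two_ne_zero).eventually_ge_atTop (88 + 2 * Γ)]
    with u hh hh1 hu hu1 N D hN hD k γ hγ hγΓ
  have hh0 := mesh_pos (a := a) hδ hu
  set h := mesh a δ u with hhdef
  set ρ := δ / 2 ^ (k + 1) with hρdef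
  have hpow1 : (1 : ℝ) ≤ 2 ^ (k + 1) := one_le_pow₀ one_le_two
  have hρ : 0 < ρ := by positivity
  have hρ1 : ρ ≤ 1 := (div_le_self hδ.le hpow1).trans hδ1
  have hx : mesh a ρ u = h / 2 ^ (k + 1) := mesh_div _ _ _ _
  have hx2 : h / 2 ^ k = 2 * mesh a ρ u := by rw [hx, pow_succ]; field_simp
  rw [← hx, hx2]
  have hx0 := mesh_pos (a := a) hρ hu
  have hMx : ((D * 2 ^ (k + 1) : ℕ) : ℝ) * mesh a ρ u = D * h := by
    rw [hx]; push_cast; field_simp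
  have hlevel := hB.measureReal_level_jump_le ha ha1 hρ hρ1 hγ hγΓ hu hu1 (N * 2 ^ (k + 1))
    (D * 2 ^ (k + 1)) (by rw [hMx]; linarith)
  have hsub : {ω | ∃ i < N * 2 ^ (k + 1), ∃ d < D * 2 ^ (k + 1),
        u - γ / u < incr B (gridPt (mesh a ρ u) i d) ω} ⊆
      {ω | ∃ i < N * 2 ^ k, ∃ d < D * 2 ^ k,
        u - (γ + ρ ^ (a / 4)) / u < incr B (gridPt (2 * mesh a ρ u) i d) ω} ∪
      {ω | ∃ i < N * 2 ^ (k + 1), ∃ d < D * 2 ^ (k + 1),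
        u - γ / u < incr B (gridPt (mesh a ρ u) i d) ω ∧
        ρ ^ (a / 4) / u < incr B (gridPt (mesh a ρ u) i d) ω -
        incr B (gridPt (2 * mesh a ρ u) (i / 2) (d / 2)) ω} := by
    rintro ω ⟨i, hi, d, hd, hlt⟩
    by_cases hj : ρ ^ (a / 4) / u < incr B (gridPt (mesh a ρ u) i d) ω -
        incr B (gridPt (2 * mesh a ρ u) (i / 2) (d / 2)) ω
    · exact Or.inr ⟨i, hi, d, hd, hlt, hj⟩
    · refine Or.inl ⟨i / 2, by rw [pow_succ, ← mul_assoc] at hi; omega, d / 2,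
        by rw [pow_succ, ← mul_assoc] at hd; omega, ?_⟩
      rw [add_div]
      linarith
  refine (measureReal_mono hsub (measure_ne_top _ _)).trans ((measureReal_union_le _ _).trans ?_)
  refine add_le_add_right (hlevel.trans ?_) _
  rw [hMx]
  have hg : gaussTail u 1 = mainRate a δ u * (u ^ 2 * h ^ 2) := by
    unfold mainRate; rw [← hhdef]; field_simp
  have hg2 : 1 / u * (√(2 * π))⁻¹ * exp (-(u ^ 2 / 2)) = mainRate a δ u * (u ^ 2 * h ^ 2) := by
    rw [← hg]; unfold gaussTail; rw [Real.sqrt_one, neg_div]; ring_nf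
  have hR := mainRate_pos (a := a) hδ hu
  rw [hg2]
  have hNR : ((N * 2 ^ (k + 1) : ℕ) : ℝ) ≤ (T + 1) * 2 ^ (k + 1) / h := by
    push_cast
    rw [le_div_iff₀ hh0]
    have : (N : ℝ) * h ≤ T + 1 := by linarith
    calc (N : ℝ) * 2 ^ (k + 1) * h = N * h * 2 ^ (k + 1) := by ring
      _ ≤ _ := by gcongr
  have hE : exp (-(a * u ^ 2 / 2 * (1 - D * h))) ≤ exp 1 := by
    rw [exp_le_exp]
    have h1 : a * u ^ 2 / 2 * (D * h - 1) ≤ a * u ^ 2 / 2 * (2 * h) := by gcongr; linarith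
    have h2 : a * (u ^ 2 * h) ≤ 1 * 1 := by gcongr
    linarith
  have hS : 1 + 1 / (a * u ^ 2 / 2 * mesh a ρ u) ≤ (1 + 2 / a) * (2 ^ (k + 1) / (u ^ 2 * h)) := by
    rw [hx]
    have h1 : 1 ≤ 2 ^ (k + 1) / (u ^ 2 * h) := by
      rw [le_div_iff₀ (by positivity)]; linarith
    have h2 : 1 / (a * u ^ 2 / 2 * (h / 2 ^ (k + 1))) = 2 / a * (2 ^ (k + 1) / (u ^ 2 * h)) := by
      field_simp
    rw [h2, add_mul, one_mul]
    linarith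
  calc _ ≤ (T + 1) * 2 ^ (k + 1) / h * (4 * exp (11 + 2 * Γ) * (C₁ * ρ ^ 3) *
        (mainRate a δ u * (u ^ 2 * h ^ 2)) *
        (exp 1 * ((1 + 2 / a) * (2 ^ (k + 1) / (u ^ 2 * h))))) := by
        have := hexp ρ hρ hρ1
        gcongr
    _ = _ := by
        rw [hρdef]
        field_simp

theorem exists_measureReal_chain_le (hB : IsFBM μ a B) (ha : 0 < a) (ha1 : a < 1) {T : ℝ}
    (hT : 0 < T) : ∃ C > 0, ∀ δ : ℝ, 0 < δ → δ ≤ 1 → ∀ᶠ u in atTop, ∀ N D : ℕ,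
      N * mesh a δ u ≤ T + 2 * mesh a δ u → D * mesh a δ u ≤ 1 + 2 * mesh a δ u →
      ∀ k : ℕ,
      μ.real {ω | ∃ i < N * 2 ^ k, ∃ d < D * 2 ^ k,
        u < incr B (gridPt (mesh a δ u / 2 ^ k) i d) ω} ≤
      μ.real {ω | ∃ i < N, ∃ d < D,
        u - chainLoss a * δ ^ (a / 4) / u < incr B (gridPt (mesh a δ u) i d) ω} +
      C * δ ^ 3 * mainRate a δ u := by
  obtain ⟨C, hC, hmain⟩ := hB.exists_measureReal_refine_le ha ha1 hT (chainLoss a)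
  refine ⟨C, hC, fun δ hδ hδ1 => ?_⟩
  filter_upwards [hmain δ hδ hδ1, eventually_gt_atTop 0] with u hstep hu N D hN hD k
  have hR := mainRate_pos (a := a) hδ hu
  have hind : ∀ (k : ℕ) (γ : ℝ), 0 ≤ γ →
      γ + ∑ j ∈ Finset.range k, (δ / 2 ^ (j + 1)) ^ (a / 4) ≤ chainLoss a →
      μ.real {ω | ∃ i < N * 2 ^ k, ∃ d < D * 2 ^ k,
        u - γ / u < incr B (gridPt (mesh a δ u / 2 ^ k) i d) ω} ≤
      μ.real {ω | ∃ i < N, ∃ d < D,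
        u - (γ + ∑ j ∈ Finset.range k, (δ / 2 ^ (j + 1)) ^ (a / 4)) / u <
          incr B (gridPt (mesh a δ u) i d) ω} +
      C * δ ^ 2 * (∑ j ∈ Finset.range k, δ / 2 ^ (j + 1)) * mainRate a δ u := by
    intro k
    induction k with
    | zero => intro γ _ _; simp
    | succ k ih =>
      intro γ hγ hsum
      rw [Finset.sum_range_succ] at hsum
      have h0 : 0 ≤ ∑ j ∈ Finset.range k, (δ / 2 ^ (j + 1)) ^ (a / 4) :=
        Finset.sum_nonneg fun j _ => by positivity
      have h1 : 0 ≤ (δ / 2 ^ (k + 1)) ^ (a / 4) := by positivity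
      have s1 := hstep N D hN hD k γ hγ (by linarith)
      have s2 := ih (γ + (δ / 2 ^ (k + 1)) ^ (a / 4)) (by linarith) (by linarith)
      rw [Finset.sum_range_succ, Finset.sum_range_succ]
      have e : γ + (∑ j ∈ Finset.range k, (δ / 2 ^ (j + 1)) ^ (a / 4) +
        (δ / 2 ^ (k + 1)) ^ (a / 4)) = γ + (δ / 2 ^ (k + 1)) ^ (a / 4) +
        ∑ j ∈ Finset.range k, (δ / 2 ^ (j + 1)) ^ (a / 4) := by ring
      rw [e]
      linarith
  have hS : ∑ j ∈ Finset.range k, (δ / 2 ^ (j + 1)) ^ (a / 4) ≤ chainLoss a * δ ^ (a / 4) := by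
    rw [mul_comm]
    exact sum_div_two_pow_rpow_le hδ (by positivity) k
  have hδ' : δ ^ (a / 4) ≤ 1 := Real.rpow_le_one hδ.le hδ1 (by positivity)
  have hΓ : chainLoss a * δ ^ (a / 4) ≤ chainLoss a :=
    mul_le_of_le_one_right (chainLoss_pos ha).le hδ'
  have h := hind k 0 le_rfl (by linarith)
  simp only [zero_div, sub_zero, zero_add] at h
  refine h.trans (add_le_add ?_ ?_)
  · refine measureReal_mono ?_ (measure_ne_top _ _)
    rintro ω ⟨i, hi, d, hd, hlt⟩
    refine ⟨i, hi, d, hd, lt_of_le_of_lt ?_ hlt⟩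
    gcongr
  · have hs := sum_div_two_pow_le hδ k
    calc C * δ ^ 2 * (∑ j ∈ Finset.range k, δ / 2 ^ (j + 1)) * mainRate a δ u
        ≤ C * δ ^ 2 * δ * mainRate a δ u := by gcongr
      _ = _ := by ring

end IsFBM

theorem tendsto_floor_mul_div_two_pow {h s : ℝ} (hh : 0 < h) (hs : 0 ≤ s) :
    Tendsto (fun k : ℕ => (⌊s / (h / 2 ^ k)⌋₊ : ℝ) * (h / 2 ^ k)) atTop (nhds s) := by
  have h0 : Tendsto (fun k : ℕ => h / 2 ^ k) atTop (nhds 0) :=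
    tendsto_const_nhds.div_atTop (tendsto_pow_atTop_atTop_of_one_lt one_lt_two)
  refine tendsto_of_tendsto_of_tendsto_of_le_of_le (g := fun k : ℕ => s - h / 2 ^ k)
    (h := fun _ => s) (by simpa using h0.const_sub s) tendsto_const_nhds (fun k => ?_) fun k => ?_
  · have hk : 0 < h / 2 ^ k := by positivity
    have := (Nat.lt_floor_add_one (s / (h / 2 ^ k))).le
    rw [div_le_iff₀ hk] at this
    change s - h / 2 ^ k ≤ _
    linarith
  · have hk : 0 < h / 2 ^ k := by positivity
    have := Nat.floor_le (show 0 ≤ s / (h / 2 ^ k) by positivity)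
    rwa [le_div_iff₀ hk] at this

theorem floor_lt_mul_two_pow {h s : ℝ} (hh : 0 < h) {N : ℕ} (hN : s < N * h) (k : ℕ) (hs : 0 ≤ s) :
    ⌊s / (h / 2 ^ k)⌋₊ < N * 2 ^ k := by
  rw [Nat.floor_lt (by positivity)]
  push_cast
  rw [div_lt_iff₀ (by positivity)]
  calc s < N * h := hN
    _ = _ := by field_simp

namespace IsFBM

variable {Ω : Type*} [MeasurableSpace Ω] {μ : Measure Ω} [IsProbabilityMeasure μ]
  {a : ℝ} {B : ℝ → Ω → ℝ}

theorem measureReal_exists_le_of_grid (hc : ∀ᵐ ω ∂μ, Continuous fun t => B t ω) {h T u c : ℝ}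
    (hh : 0 < h) {N D : ℕ} (hN : T < N * h) (hD : 1 < D * h)
    (hgrid : ∀ k : ℕ, μ.real {ω | ∃ i < N * 2 ^ k, ∃ d < D * 2 ^ k,
        u < incr B (gridPt (h / 2 ^ k) i d) ω} ≤ c) :
    μ.real {ω | ∃ τ ∈ Icc (0 : ℝ) 1, ∃ s ∈ Icc (0 : ℝ) T, u < incr B (s, s + τ) ω} ≤ c := by
  set E : ℕ → Set Ω := fun k => {ω | ∃ i < N * 2 ^ k, ∃ d < D * 2 ^ k,
        u < incr B (gridPt (h / 2 ^ k) i d) ω} with hE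
  have hc0 : 0 ≤ c := measureReal_nonneg.trans (hgrid 0)
  have hsub : ∀ᵐ ω ∂μ, (∃ τ ∈ Icc (0 : ℝ) 1, ∃ s ∈ Icc (0 : ℝ) T, u < incr B (s, s + τ) ω) →
      ω ∈ ⋃ m, ⋂ k ∈ Ici m, E k := by
    filter_upwards [hc] with ω hω
    rintro ⟨τ, hτ, s, hs, hlt⟩
    have h1 := tendsto_floor_mul_div_two_pow hh hs.1
    have h2 := tendsto_floor_mul_div_two_pow hh hτ.1
    have h3 : Tendsto (fun k : ℕ => incr B (gridPt (h / 2 ^ k) ⌊s / (h / 2 ^ k)⌋₊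
        ⌊τ / (h / 2 ^ k)⌋₊) ω) atTop (nhds (incr B (s, s + τ) ω)) :=
      ((hω.tendsto _).comp (h1.add h2)).sub ((hω.tendsto _).comp h1)
    obtain ⟨m, hm⟩ := eventually_atTop.mp (h3.eventually (lt_mem_nhds hlt))
    refine mem_iUnion.mpr ⟨m, mem_iInter₂.mpr fun k hk => ?_⟩
    exact ⟨_, floor_lt_mul_two_pow hh (hs.2.trans_lt hN) k hs.1, _,
      floor_lt_mul_two_pow hh (hτ.2.trans_lt hD) k hτ.1, hm k hk⟩
  have hmono : Monotone fun m : ℕ => ⋂ k ∈ Ici m, E k := fun m m' hmm =>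
    biInter_subset_biInter_left (Ici_subset_Ici.mpr hmm)
  have hle : μ {ω | ∃ τ ∈ Icc (0 : ℝ) 1, ∃ s ∈ Icc (0 : ℝ) T, u < incr B (s, s + τ) ω} ≤
      ENNReal.ofReal c := by
    refine (measure_mono_ae (t := ⋃ m, ⋂ k ∈ Ici m, E k) hsub).trans ?_
    rw [hmono.measure_iUnion]
    refine iSup_le fun m => ?_
    refine (measure_mono (biInter_subset_of_mem (mem_Ici.mpr le_rfl))).trans ?_
    rw [← ENNReal.ofReal_toReal (measure_ne_top μ (E m))]
    exact ENNReal.ofReal_le_ofReal (hgrid m)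
  exact ENNReal.toReal_le_of_le_ofReal hc0 hle

/-- Probability that the incremental field exceeds `u`. -/
noncomputable def exceed (μ : Measure Ω) (B : ℝ → Ω → ℝ) (T u : ℝ) : ℝ :=
  μ.real {ω | ∃ τ ∈ Icc (0 : ℝ) 1, ∃ s ∈ Icc (0 : ℝ) T, u < incr B (s, s + τ) ω}

theorem exists_exceed_le (hB : IsFBM μ a B) (ha : 0 < a) (ha1 : a < 1)
    (hc : ∀ᵐ ω ∂μ, Continuous fun t => B t ω) {T : ℝ} (hT : 0 < T) :
    ∃ C > 0, ∀ δ : ℝ, 0 < δ → δ ≤ 1 → ∀ n : ℕ, 0 < n → ∀ ε > 0, ∀ᶠ u in atTop,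
      exceed μ B T u ≤ (2 * T / a * exp (chainLoss a * δ ^ (a / 4)) *
        (pickands μ a B δ n / n) ^ 2 + C * δ ^ 3 + ε) * mainRate a δ u := by
  obtain ⟨C, hC, hchain⟩ := hB.exists_measureReal_chain_le ha ha1 hT
  refine ⟨C, hC, fun δ hδ hδ1 n hn ε hε => ?_⟩
  have : NeZero n := ⟨hn.ne'⟩
  obtain ⟨η, hη, hη1, hnear⟩ := hB.exists_measureReal_near_le ha ha1 hδ hT n
    (chainLoss a * δ ^ (a / 4)) (half_pos hε)
  filter_upwards [hchain δ hδ hδ1, hnear, hB.eventually_measureReal_far_le (T := T) ha ha1 hδ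
    (chainLoss a * δ ^ (a / 4)) hη hη1 (half_pos hε), eventually_gt_atTop 0] with u h1 h2 h3 hu
  have hh := mesh_pos (a := a) hδ hu
  set h := mesh a δ u with hhdef
  have hcl : ∀ x : ℝ, 0 < x → x < (⌈x / h⌉₊ + 1 : ℕ) * h ∧ (⌈x / h⌉₊ + 1 : ℕ) * h ≤ x + 2 * h := by
    intro x hx
    have h1 := Nat.le_ceil (x / h)
    have h2 := Nat.ceil_lt_add_one (show 0 ≤ x / h by positivity)
    rw [div_le_iff₀ hh] at h1
    have h2' : (⌈x / h⌉₊ : ℝ) * h < (x / h + 1) * h := by gcongr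
    rw [add_mul, div_mul_cancel₀ _ hh.ne'] at h2'
    push_cast
    constructor <;> linarith
  obtain ⟨hN1, hN2⟩ := hcl T hT
  obtain ⟨hD1, hD2⟩ := hcl 1 one_pos
  set N := ⌈T / h⌉₊ + 1
  set D := ⌈1 / h⌉₊ + 1
  refine measureReal_exists_le_of_grid hc hh hN1 hD1 fun k => (h1 N D hN2 hD2 k).trans ?_
  have h2' := h2 N D hN2 hD2
  have h3' := h3 N D hN2
  have hsub : {ω | ∃ i < N, ∃ d < D, u - chainLoss a * δ ^ (a / 4) / u < incr B (gridPt h i d) ω} ⊆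
      {ω | ∃ i < N, ∃ d < D, 1 - η ≤ (d : ℝ) * h ∧ u - chainLoss a * δ ^ (a / 4) / u <
        incr B (i * h, i * h + d * h) ω} ∪
      {ω | ∃ i < N, ∃ d < D, (d : ℝ) * h < 1 - η ∧ u - chainLoss a * δ ^ (a / 4) / u <
        incr B (i * h, i * h + d * h) ω} := by
    rintro ω ⟨i, hi, d, hd, hlt⟩
    rcases le_or_gt (1 - η) (d * h) with h0 | h0
    · exact Or.inl ⟨i, hi, d, hd, h0, hlt⟩
    · exact Or.inr ⟨i, hi, d, hd, h0, hlt⟩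
  have := (measureReal_mono hsub (measure_ne_top μ _)).trans (measureReal_union_le _ _)
  linarith

end IsFBM

theorem mainRate_eq (a u : ℝ) {δ : ℝ} (hδ : 0 < δ) : mainRate a δ u = mainRate a 1 u / δ ^ 2 := by
  have : mesh a δ u = δ * mesh a 1 u := by unfold mesh; ring
  unfold mainRate
  rw [this]
  field_simp

namespace IsFBM

variable {Ω : Type*} [MeasurableSpace Ω] {μ : Measure Ω} [IsProbabilityMeasure μ]
  {a : ℝ} {B : ℝ → Ω → ℝ}

omit [IsProbabilityMeasure μ] in
theorem pickands_nonneg (δ : ℝ) (n : ℕ) [NeZero n] : 0 ≤ pickands μ a B δ n :=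
  integral_nonneg fun _ => (exp_pos _).le

/-- Upper bound in the tail asymptotics. -/
theorem eventually_exceed_le (hB : IsFBM μ a B) (ha : 0 < a) (ha1 : a < 1)
    (hc : ∀ᵐ ω ∂μ, Continuous fun t => B t ω) {T : ℝ} (hT : 0 < T) {HH : ℝ} (hHH : 0 < HH)
    (hP : Tendsto (fun lam : ℝ => lam⁻¹ * ∫ ω, exp (⨆ t : Icc (0 : ℝ) lam, drift a B t ω) ∂μ)
      atTop (nhds HH)) {ε : ℝ} (hε : 0 < ε) :
    ∀ᶠ u in atTop, exceed μ B T u ≤ (2 * T / a * HH ^ 2 + ε) * mainRate a 1 u := by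
  obtain ⟨C, hC, hup⟩ := hB.exists_exceed_le ha ha1 hc hT
  have hlim : Tendsto (fun δ : ℝ => 2 * T / a * exp (chainLoss a * δ ^ (a / 4)) * (HH + δ) ^ 2 +
      (C + 1) * δ) (nhdsWithin 0 (Ioi 0)) (nhds (2 * T / a * HH ^ 2)) := by
    have : Continuous (fun δ : ℝ => 2 * T / a * exp (chainLoss a * δ ^ (a / 4)) * (HH + δ) ^ 2 +
      (C + 1) * δ) := by
      have h := Real.continuous_rpow_const (q := a / 4) (by positivity)
      fun_prop
    have h0 := (this.tendsto 0).mono_left (nhdsWithin_le_nhds (s := Ioi 0))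
    simpa [Real.zero_rpow (show a / 4 ≠ 0 by positivity)] using h0
  obtain ⟨δ, hδlt, hδ1, hδ⟩ := ((hlim.eventually (gt_mem_nhds
    (show 2 * T / a * HH ^ 2 < 2 * T / a * HH ^ 2 + ε by linarith))).and
    ((eventually_nhdsWithin_of_eventually_nhds (ge_mem_nhds one_pos)).and
      eventually_mem_nhdsWithin)).exists
  have hδ0 : 0 < δ := hδ
  obtain ⟨n, hn, hn0⟩ := (((hB.pickands_asymptotics ha hc hHH hP hδ0).1 δ hδ0).and
    (eventually_gt_atTop 0)).exists
  have : NeZero n := ⟨hn0.ne'⟩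
  have hnR : (0 : ℝ) < n := by exact_mod_cast hn0
  filter_upwards [hup δ hδ0 hδ1 n hn0 (δ ^ 3) (by positivity), eventually_gt_atTop 0] with u hu hu0
  refine hu.trans ?_
  rw [mainRate_eq a u hδ0, mul_div_assoc', div_eq_mul_inv, mul_right_comm]
  refine mul_le_mul_of_nonneg_right ?_ (mainRate_pos one_pos hu0).le
  refine le_trans (le_of_eq ?_) (le_trans (add_le_add_left (mul_le_mul_of_nonneg_left
    (pow_le_pow_left₀ (by have := pickands_nonneg (μ := μ) (a := a) (B := B) δ n; positivity) hn 2)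
    (show 0 ≤ 2 * T / a * exp (chainLoss a * δ ^ (a / 4)) by positivity)) ((C + 1) * δ)) hδlt.le)
  field_simp
  ring

/-- Variance of the average of two increments. -/
theorem variance_average_le (hB : IsFBM μ a B) (ha : 0 < a) (ha1 : a < 1) {T : ℝ} (hT : 0 < T)
    {p q : ℝ × ℝ} (hp1 : 0 ≤ p.1) (hpT : p.1 ≤ T) (hp : p.1 ≤ p.2) (hp2 : p.2 - p.1 ≤ 1)
    (hq1 : 0 ≤ q.1) (hqT : q.1 ≤ T) (hq : q.1 ≤ q.2) (hq2 : q.2 - q.1 ≤ 1) :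
    (1 / 2) ^ 2 * Var[incr B p; μ] + 2 * (1 / 2) * (1 / 2) * cov[incr B p, incr B q; μ] +
      (1 / 2) ^ 2 * Var[incr B q; μ] ≤ 1 - a / 8 * (1 - (p.2 - p.1)) -
        (16 * (T + 1) ^ a)⁻¹ * (|p.1 - q.1| ^ a + |p.2 - q.2| ^ a) := by
  rw [hB.variance_incr ha hp1 (hp1.trans hp), hB.variance_incr ha hq1 (hq1.trans hq),
    hB.covariance_incr hp1 (hp1.trans hp) hq1 (hq1.trans hq),
    abs_of_nonneg (sub_nonneg.mpr hp), abs_of_nonneg (sub_nonneg.mpr hq)]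
  have hp0 := sub_nonneg.mpr hp
  have hq0 := sub_nonneg.mpr hq
  have hM : (1 : ℝ) ≤ (T + 1) ^ a := Real.one_le_rpow (by linarith) ha.le
  have hb1 : |p.1 - q.1| ^ a ≤ (T + 1) ^ a :=
    Real.rpow_le_rpow (abs_nonneg _) (abs_le.mpr ⟨by linarith, by linarith⟩) ha.le
  have hb2 : |p.2 - q.2| ^ a ≤ (T + 1) ^ a :=
    Real.rpow_le_rpow (abs_nonneg _) (abs_le.mpr ⟨by linarith, by linarith⟩) ha.le
  set X := |p.1 - q.1| ^ a with hX
  set Y := |p.2 - q.2| ^ a with hY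
  have hX0 : 0 ≤ X := by positivity
  have hY0 : 0 ≤ Y := by positivity
  set c := (16 * (T + 1) ^ a)⁻¹ with hc
  have hc0 : 0 < c := by positivity
  have hc4 : c ≤ 1 / 4 := by
    rw [hc, inv_le_comm₀ (by positivity) (by norm_num)]; linarith
  have hc8 : c * (X + Y) ≤ 1 / 8 := by
    calc c * (X + Y) ≤ c * ((T + 1) ^ a + (T + 1) ^ a) := by gcongr
      _ = 1 / 8 := by rw [hc]; field_simp; norm_num
  have hc4' : c * (X + Y) ≤ 1 / 4 * (X + Y) := by gcongr
  have hlag : a * (1 - (p.2 - p.1)) ≤ 1 := by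
    calc a * (1 - (p.2 - p.1)) ≤ 1 * 1 := by gcongr; linarith
      _ = 1 := one_mul 1
  have v1 := rpow_le_one_sub ha ha1 hp0
  have v2 := rpow_le_one_sub ha ha1 hq0
  have w1 : 0 ≤ a * (1 - (p.2 - p.1)) := mul_nonneg ha.le (by linarith)
  have w2 : 0 ≤ a * (1 - (q.2 - q.1)) := mul_nonneg ha.le (by linarith)
  by_cases h : q.1 ≤ p.2 ∧ p.1 ≤ q.2
  · have c1 := rpow_le_one_sub ha ha1 (sub_nonneg.mpr h.1)
    have c2 := rpow_le_one_sub ha ha1 (sub_nonneg.mpr h.2)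
    rw [abs_of_nonneg (sub_nonneg.mpr h.1), abs_sub_comm p.1, abs_of_nonneg (sub_nonneg.mpr h.2)]
    have e : a * (1 - (p.2 - q.1)) + a * (1 - (q.2 - p.1)) =
      a * (1 - (p.2 - p.1)) + a * (1 - (q.2 - q.1)) := by ring
    linarith
  · have key : |p.2 - q.1| ^ a + |p.1 - q.2| ^ a ≤ X + Y + (p.2 - p.1) ^ a := by
      rw [not_and_or, not_le, not_le] at h
      rcases h with h | h
      · have k1 : |p.2 - q.1| ^ a ≤ X := Real.rpow_le_rpow (abs_nonneg _) (by
          rw [abs_sub_comm, abs_sub_comm p.1, abs_of_pos (by linarith), abs_of_nonneg (by linarith)]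
          linarith) ha.le
        have k2 := rpow_abs_sub_le (x := p.1) (y := p.2) (z := q.2) ha.le ha1.le
        rw [abs_sub_comm p.1 p.2, abs_of_nonneg hp0] at k2
        linarith
      · have k1 : |p.1 - q.2| ^ a ≤ Y := Real.rpow_le_rpow (abs_nonneg _) (by
          rw [abs_of_pos (by linarith), abs_of_nonneg (by linarith)]
          linarith) ha.le
        have k2 := rpow_abs_sub_le (x := p.2) (y := p.1) (z := q.1) ha.le ha1.le
        rw [abs_of_nonneg hp0] at k2
        linarith
    linarith

theorem measureReal_pair_le (hB : IsFBM μ a B) (ha : 0 < a) (ha1 : a < 1) {T u : ℝ} (hT : 0 < T)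
    {p q : ℝ × ℝ} (hp1 : 0 ≤ p.1) (hpT : p.1 ≤ T) (hp : p.1 ≤ p.2) (hp2 : p.2 - p.1 ≤ 1)
    (hq1 : 0 ≤ q.1) (hqT : q.1 ≤ T) (hq : q.1 ≤ q.2) (hq2 : q.2 - q.1 ≤ 1) (hu : 0 < u) :
    μ.real {ω | u < incr B p ω ∧ u < incr B q ω} ≤ gaussTail u 1 *
      exp (-(a * u ^ 2 / 16 * (1 - (p.2 - p.1)))) *
      exp (-(u ^ 2 / 2 * ((16 * (T + 1) ^ a)⁻¹ * (|p.1 - q.1| ^ a + |p.2 - q.2| ^ a)))) := by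
  have hV := hB.variance_average_le ha ha1 hT hp1 hpT hp hp2 hq1 hqT hq hq2
  have hmap := hB.map_add_mul_incr p q (1 / 2) (1 / 2)
  set W := 1 - a / 8 * (1 - (p.2 - p.1)) -
    (16 * (T + 1) ^ a)⁻¹ * (|p.1 - q.1| ^ a + |p.2 - q.2| ^ a) with hW
  have hM : (1 : ℝ) ≤ (T + 1) ^ a := Real.one_le_rpow (by linarith) ha.le
  have hsub : {ω | u < incr B p ω ∧ u < incr B q ω} ⊆
      {ω | u < 1 / 2 * incr B p ω + 1 / 2 * incr B q ω} := by
    rintro ω ⟨h1, h2⟩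
    change u < 1 / 2 * incr B p ω + 1 / 2 * incr B q ω
    linarith
  have hb1 : |p.1 - q.1| ^ a ≤ (T + 1) ^ a :=
    Real.rpow_le_rpow (abs_nonneg _) (abs_le.mpr ⟨by linarith, by linarith⟩) ha.le
  have hb2 : |p.2 - q.2| ^ a ≤ (T + 1) ^ a :=
    Real.rpow_le_rpow (abs_nonneg _) (abs_le.mpr ⟨by linarith, by linarith⟩) ha.le
  have hc8 : (16 * (T + 1) ^ a)⁻¹ * (|p.1 - q.1| ^ a + |p.2 - q.2| ^ a) ≤ 1 / 8 := by
    calc _ ≤ (16 * (T + 1) ^ a)⁻¹ * ((T + 1) ^ a + (T + 1) ^ a) := by gcongr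
      _ = 1 / 8 := by field_simp; norm_num
  have hc0 : 0 ≤ (16 * (T + 1) ^ a)⁻¹ * (|p.1 - q.1| ^ a + |p.2 - q.2| ^ a) := by positivity
  have hlag : a * (1 - (p.2 - p.1)) ≤ 1 := by
    calc a * (1 - (p.2 - p.1)) ≤ 1 * 1 := by gcongr; linarith
      _ = 1 := one_mul 1
  have w1 : 0 ≤ a * (1 - (p.2 - p.1)) := mul_nonneg ha.le (by linarith)
  have hW0 : 0 < W := by rw [hW]; linarith
  have hW1 : W ≤ 1 := by rw [hW]; linarith
  refine (measureReal_mono hsub (measure_ne_top _ _)).trans ?_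
  refine (measureReal_lt_le_gaussTail (((hB.measurable_incr p).const_mul _).add
    ((hB.measurable_incr q).const_mul _)) hmap hW0 hV hu).trans ((gaussTail_le hu hW0).trans ?_)
  unfold gaussTail
  rw [mul_assoc, mul_assoc _ (exp _), mul_assoc _ (exp _), ← exp_add, ← exp_add, mul_assoc]
  have he : -(u ^ 2 / 2 * (2 - W)) = -u ^ 2 / (2 * 1) + (-(a * u ^ 2 / 16 * (1 - (p.2 - p.1))) +
      -(u ^ 2 / 2 * ((16 * (T + 1) ^ a)⁻¹ * (|p.1 - q.1| ^ a + |p.2 - q.2| ^ a)))) := by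
    rw [hW]; ring
  rw [he]
  gcongr

end IsFBM

/-- Bonferroni lower bound for the measure of a finite union. -/
theorem sum_measureReal_sub_le_measureReal_biUnion {Ω ι : Type*} [MeasurableSpace Ω]
    {μ : Measure Ω} [IsFiniteMeasure μ] [DecidableEq ι] (S : Finset ι) {A : ι → Set Ω}
    (hA : ∀ i ∈ S, MeasurableSet (A i)) :
    ∑ i ∈ S, μ.real (A i) - ∑ i ∈ S, ∑ j ∈ S.erase i, μ.real (A i ∩ A j) ≤
      μ.real (⋃ i ∈ S, A i) := by
  induction S using Finset.induction_on with
  | empty => simp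
  | insert x S hx ih =>
    have ih' := ih fun i hi => hA i (Finset.mem_insert_of_mem hi)
    have hun : MeasurableSet (⋃ i ∈ S, A i) :=
      Finset.measurableSet_biUnion S fun i hi => hA i (Finset.mem_insert_of_mem hi)
    have h1 := measureReal_union_add_inter (μ := μ) (s := A x) (t := ⋃ i ∈ S, A i) hun (measure_ne_top _ _)
      (measure_ne_top _ _)
    have h2 : μ.real (A x ∩ ⋃ i ∈ S, A i) ≤ ∑ j ∈ S, μ.real (A x ∩ A j) := by
      rw [inter_iUnion₂]
      exact measureReal_biUnion_finset_le _ _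
    have h3 : ∑ i ∈ S, ∑ j ∈ S.erase i, μ.real (A i ∩ A j) ≤
        ∑ i ∈ S, ∑ j ∈ (insert x S).erase i, μ.real (A i ∩ A j) := by
      refine Finset.sum_le_sum fun i _ => Finset.sum_le_sum_of_subset_of_nonneg ?_
        fun _ _ _ => measureReal_nonneg
      exact Finset.erase_subset_erase _ (Finset.subset_insert _ _)
    rw [Finset.set_biUnion_insert, Finset.sum_insert hx, Finset.sum_insert hx,
      Finset.erase_insert hx]
    linarith

theorem summable_exp_neg_mul_rpow {b c : ℝ} (hb : 0 < b) (hc : 0 < c) :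
    Summable fun k : ℕ => exp (-(c * (k : ℝ) ^ b)) := by
  obtain ⟨C, hC, h⟩ := exists_exp_neg_mul_rpow_neg_le hb hc 2
  rw [← summable_nat_add_iff 1]
  have hs : Summable fun k : ℕ => C * (1 / ((k + 1 : ℕ) : ℝ) ^ 2) :=
    ((summable_nat_add_iff 1).mpr (Real.summable_one_div_nat_pow.mpr one_lt_two)).mul_left C
  refine Summable.of_nonneg_of_le (fun k => (exp_pos _).le) (fun k => ?_) hs
  have hk : (0 : ℝ) < (k + 1 : ℕ) := by positivity
  have := h (1 / ((k + 1 : ℕ) : ℝ)) (by positivity) (by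
    rw [div_le_one hk]; exact_mod_cast Nat.succ_pos k)
  rwa [one_div, Real.inv_rpow hk.le, Real.rpow_neg hk.le, inv_inv, inv_pow, ← one_div] at this

theorem sum_natAbs_sub_le {g : ℕ → ℝ} (hg0 : ∀ k, 0 ≤ g k) (hg : Summable g) (S : Finset ℕ)
    (b : ℤ) : ∑ x ∈ S, g (b - x).natAbs ≤ 2 * ∑' k, g k := by
  have h : ∀ S' : Finset ℕ, Set.InjOn (fun x : ℕ => (b - x).natAbs) S' →
      ∑ x ∈ S', g (b - x).natAbs ≤ ∑' k, g k := by
    intro S' hinj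
    rw [← Finset.sum_image (f := g) hinj]
    exact hg.sum_le_tsum _ fun k _ => hg0 k
  rw [← Finset.sum_filter_add_sum_filter_not S (fun x : ℕ => (x : ℤ) ≤ b), two_mul]
  refine add_le_add (h _ ?_) (h _ ?_)
  · intro x hx y hy hxy
    simp only [Finset.coe_filter, mem_ofPred_eq] at hx hy hxy
    omega
  · intro x hx y hy hxy
    simp only [Finset.coe_filter, mem_ofPred_eq] at hx hy hxy
    omega

/-- Double sum over lattice points of a stretched exponential kernel. -/
theorem sum_sum_exp_natAbs_le {b c : ℝ} (hb : 0 < b) (hc : 0 < c) (S : Finset (ℕ × ℕ)) (i j : ℤ) :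
    ∑ x ∈ S, exp (-(c * (((i - x.1).natAbs : ℝ) ^ b + ((j - (x.1 + x.2)).natAbs : ℝ) ^ b))) ≤
      (2 * ∑' k : ℕ, exp (-(c * (k : ℝ) ^ b))) ^ 2 := by
  have hs := summable_exp_neg_mul_rpow hb hc
  set g : ℕ → ℝ := fun k => exp (-(c * (k : ℝ) ^ b)) with hg
  have hg0 : ∀ k, 0 ≤ g k := fun k => (exp_pos _).le
  have hS : S ⊆ S.image Prod.fst ×ˢ S.image Prod.snd := Finset.subset_product
  refine (Finset.sum_le_sum_of_subset_of_nonneg hS fun _ _ _ => (exp_pos _).le).trans ?_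
  rw [Finset.sum_product, sq]
  calc _ = ∑ x ∈ S.image Prod.fst, g (i - x).natAbs *
        ∑ y ∈ S.image Prod.snd, g ((j - x) - y).natAbs := by
        refine Finset.sum_congr rfl fun x _ => ?_
        rw [Finset.mul_sum]
        refine Finset.sum_congr rfl fun y _ => ?_
        rw [hg, ← exp_add, sub_sub]
        congr 1
        ring
    _ ≤ ∑ x ∈ S.image Prod.fst, g (i - x).natAbs * (2 * ∑' k, g k) :=
        Finset.sum_le_sum fun x _ =>
          mul_le_mul_of_nonneg_left (sum_natAbs_sub_le hg0 hs _ _) (hg0 _)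
    _ ≤ _ := by
        rw [← Finset.sum_mul]
        exact mul_le_mul_of_nonneg_right (sum_natAbs_sub_le hg0 hs _ _)
          (mul_nonneg two_pos.le (tsum_nonneg hg0))

theorem mul_natAbs_le_natAbs_sub {n m : ℕ} {I I' p p' : ℕ} (hp : p < n) (hp' : p' < n) :
    m * ((I : ℤ) - I').natAbs ≤ (((I * (n + m) + p : ℕ) : ℤ) - ((I' * (n + m) + p' : ℕ) : ℤ)).natAbs := by
  zify
  have hp1 : (p : ℤ) < n := by exact_mod_cast hp
  have hp1' : (p' : ℤ) < n := by exact_mod_cast hp'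
  rcases lt_trichotomy I I' with h | h | h
  · have h' : (I : ℤ) + 1 ≤ I' := by exact_mod_cast h
    rw [abs_of_neg (by linarith), le_abs]
    right
    nlinarith
  · subst h
    simp
  · have h' : (I' : ℤ) + 1 ≤ I := by exact_mod_cast h
    rw [abs_of_pos (by linarith), le_abs]
    left
    nlinarith

theorem le_sum_exp_neg_lag {c g : ℝ} (hc : 0 < c) (hg : 0 < g) {K₀ K₁ : ℕ} (hK : K₀ ≤ K₁) :
    exp (-(c * g)) / (c * g) * (exp (-(c * (1 - K₁ * g))) - exp (-(c * (1 - K₀ * g)))) ≤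
      ∑ K ∈ Finset.Ico K₀ K₁, exp (-(c * (1 - K * g))) := by
  have hx : 0 < c * g := by positivity
  rw [← Finset.sum_Ico_sub (fun K : ℕ => exp (-(c * (1 - K * g)))) hK, Finset.mul_sum]
  refine Finset.sum_le_sum fun K _ => ?_
  have e : exp (-(c * (1 - K * g))) = exp (-(c * g)) * exp (-(c * (1 - (K + 1 : ℕ) * g))) := by
    rw [← exp_add]; congr 1; push_cast; ring
  rw [e, div_mul_eq_mul_div, mul_div_assoc]
  refine mul_le_mul_of_nonneg_left ?_ (exp_pos _).le
  rw [div_le_iff₀ hx]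
  have h1 := add_one_le_exp (-(c * g))
  have h2 := mul_le_mul_of_nonneg_left (show 1 - exp (-(c * g)) ≤ c * g by linarith)
    (exp_pos (-(c * (1 - (K + 1 : ℕ) * g)))).le
  linarith

theorem le_gaussTail_rpow {a τ η u : ℝ} (ha : 0 < a) (ha1 : a < 1) (hη1 : η < 1)
    (hτ : 1 - η ≤ τ) (hτ1 : τ ≤ 1) (hu : 0 < u) :
    (1 - η) * gaussTail u 1 * exp (-(a * u ^ 2 / (2 * (1 - η)) * (1 - τ))) ≤
      gaussTail u (τ ^ a) := by
  have h1η : 0 < 1 - η := by linarith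
  have hτ0 : 0 < τ := by linarith
  have hV : 1 - η ≤ τ ^ a := by
    refine hτ.trans ?_
    simpa using Real.rpow_le_rpow_of_exponent_ge hτ0 hτ1 ha1.le
  have hV0 : 0 < τ ^ a := by positivity
  have hV1 : τ ^ a ≤ 1 := Real.rpow_le_one hτ0.le hτ1 ha.le
  have hs : 1 - η ≤ √(τ ^ a) := by
    refine Real.le_sqrt_of_sq_le (le_trans ?_ hV)
    have : 0 ≤ η := by linarith
    nlinarith
  have hinv : (τ ^ a)⁻¹ ≤ 1 + a * (1 - τ) / (1 - η) := by
    have h := rpow_le_one_sub ha ha1 (inv_pos.mpr hτ0).le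
    rw [Real.inv_rpow hτ0.le] at h
    refine h.trans ?_
    have : 1 - a * (1 - τ⁻¹) = 1 + a * (1 - τ) / τ := by field_simp; ring
    rw [this]
    have : 0 ≤ a * (1 - τ) := mul_nonneg ha.le (by linarith)
    gcongr
  unfold gaussTail
  rw [Real.sqrt_one, mul_assoc, mul_assoc, ← exp_add, ← mul_assoc, ← mul_assoc, mul_one_div]
  have he : -u ^ 2 / (2 * 1) + -(a * u ^ 2 / (2 * (1 - η)) * (1 - τ)) ≤ -u ^ 2 / (2 * τ ^ a) := by
    have := mul_le_mul_of_nonneg_left hinv (show 0 ≤ u ^ 2 / 2 by positivity)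
    have e1 : -u ^ 2 / (2 * τ ^ a) = -(u ^ 2 / 2 * (τ ^ a)⁻¹) := by field_simp
    have e2 : a * u ^ 2 / (2 * (1 - η)) * (1 - τ) = u ^ 2 / 2 * (a * (1 - τ) / (1 - η)) := by
      field_simp
    rw [e1, e2]
    linarith
  gcongr

/-- Indices of the blocks of period `g` inside the strip of lags in `[1 - η, 1]`. -/
noncomputable def blockIndex (T η g : ℝ) : Finset (ℕ × ℕ) :=
  Finset.range ⌊T / g⌋₊ ×ˢ Finset.Ico ⌈(1 - η) / g⌉₊ ⌊1 / g⌋₊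

theorem of_mem_blockIndex {T η g : ℝ} (hT : 0 < T) (hg : 0 < g) {x : ℕ × ℕ}
    (hx : x ∈ blockIndex T η g) : (x.1 + 1) * g ≤ T ∧ 1 - η ≤ x.2 * g ∧ (x.2 + 1) * g ≤ 1 := by
  simp only [blockIndex, Finset.mem_product, Finset.mem_range, Finset.mem_Ico] at hx
  obtain ⟨h1, h2, h3⟩ := hx
  refine ⟨?_, ?_, ?_⟩
  · have : ((x.1 + 1 : ℕ) : ℝ) ≤ T / g := (Nat.le_floor_iff (by positivity)).mp h1
    rw [le_div_iff₀ hg] at this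
    exact_mod_cast this
  · have := Nat.ceil_le.mp h2
    rwa [div_le_iff₀ hg] at this
  · have : ((x.2 + 1 : ℕ) : ℝ) ≤ 1 / g := (Nat.le_floor_iff (by positivity)).mp h3
    rw [le_div_iff₀ hg] at this
    exact_mod_cast this

namespace IsFBM

variable {Ω : Type*} [MeasurableSpace Ω] {μ : Measure Ω} [IsProbabilityMeasure μ]
  {a : ℝ} {B : ℝ → Ω → ℝ}

/-- Exceedance of level `u` on an `n × n` block of the grid of mesh `h`. -/
def blockEvent (B : ℝ → Ω → ℝ) (h g u : ℝ) (n : ℕ) (x : ℕ × ℕ) : Set Ω :=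
  {ω | ∃ p : Fin n × Fin n, u < incr B (x.1 * g + p.1 * h, x.1 * g + x.2 * g + p.2 * h) ω}

set_option maxHeartbeats 800000 in
theorem exists_le_sum_blockEvent (hB : IsFBM μ a B) (ha : 0 < a) (ha1 : a < 1) {δ T : ℝ}
    (hδ : 0 < δ) (hT : 0 < T) (n : ℕ) [NeZero n] {L : ℕ} (hL : 0 < L) {ε : ℝ} (hε : 0 < ε) :
    ∃ η > 0, η ≤ 1 / 2 ∧ ∀ᶠ u in atTop,
      (2 * T / a * (pickands μ a B δ n / L) ^ 2 - ε) * mainRate a δ u ≤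
      ∑ x ∈ blockIndex T η (L * mesh a δ u),
        μ.real (blockEvent B (mesh a δ u) (L * mesh a δ u) u n x) := by
  set p := pickands μ a B δ n with hp
  have hp0 : 0 ≤ p := pickands_nonneg δ n
  rcases hp0.eq_or_lt with hpz | hp0
  · refine ⟨1 / 2, by norm_num, le_rfl, ?_⟩
    filter_upwards [eventually_gt_atTop 0] with u hu
    have := mainRate_pos (a := a) hδ hu
    rw [← hpz]
    refine le_trans ?_ (Finset.sum_nonneg fun _ _ => measureReal_nonneg)
    simp only [zero_div, ne_eq, OfNat.ofNat_ne_zero, not_false_eq_true, zero_pow, mul_zero, zero_sub]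
    rw [neg_mul]
    exact neg_nonpos.mpr (by positivity)
  have hLR : (0 : ℝ) < L := by exact_mod_cast hL
  set Q := 2 * T / a * (p / L) ^ 2 with hQ
  have hQ0 : 0 < Q := by positivity
  set e := min (1 / 2) (ε / (6 * Q)) with he
  have he0 : 0 < e := lt_min (by norm_num) (by positivity)
  have he2 : e ≤ 1 / 2 := min_le_left _ _
  have heQ : e * (6 * Q) ≤ ε := by
    rw [← le_div_iff₀ (by positivity)]
    exact min_le_right _ _
  obtain ⟨η₀, hη₀, -, hblock⟩ := hB.eventually_block ha ha1 hδ n 0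
    (show 0 < e * p ^ 2 by positivity)
  set η := min (η₀ / 2) e with hη
  have hηpos : 0 < η := lt_min (by positivity) he0
  have hηe : η ≤ e := min_le_right _ _
  have hηη : η < η₀ := lt_of_le_of_lt (min_le_left _ _) (by linarith)
  refine ⟨η, hηpos, hηe.trans he2, ?_⟩
  have hη1 : η < 1 := by linarith
  have h1η : 0 < 1 - η := by linarith
  set h := mesh a δ with hh
  have hlim0 : Tendsto (fun u => L * h u) atTop (nhds 0) := by
    simpa using (tendsto_mesh ha δ).const_mul (L : ℝ)
  have hlim1 : Tendsto (fun u => a * u ^ 2 / (2 * (1 - η)) * (L * h u)) atTop (nhds 0) := by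
    have := (tendsto_sq_mul_mesh ha ha1 δ).const_mul (a * L / (2 * (1 - η)))
    rw [mul_zero] at this
    refine this.congr fun u => ?_
    rw [hh]; ring
  have hlim2 : Tendsto (fun u => exp (-(a * u ^ 2 / (2 * (1 - η)) * (η - L * h u)))) atTop
      (nhds 0) := by
    refine tendsto_exp_atBot.comp (tendsto_neg_atTop_atBot.comp ?_)
    refine Tendsto.atTop_mul_pos hηpos ?_ (by simpa using hlim0.const_sub η)
    exact ((tendsto_pow_atTop two_ne_zero).const_mul_atTop ha).atTop_div_const (by positivity)
  have hexp : Tendsto (fun u => exp (-(a * u ^ 2 / (2 * (1 - η)) * (L * h u)))) atTop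
      (nhds 1) := by
    have := (continuous_exp.tendsto _).comp hlim1.neg
    rwa [neg_zero, exp_zero] at this
  have hF : Tendsto (fun u => (1 - e) * p ^ 2 * (1 - η) * (T - L * h u) * (2 * (1 - η) / (a * L ^ 2))
      * (exp (-(a * u ^ 2 / (2 * (1 - η)) * (L * h u))) *
        (exp (-(a * u ^ 2 / (2 * (1 - η)) * (L * h u))) -
          exp (-(a * u ^ 2 / (2 * (1 - η)) * (η - L * h u)))))) atTop
      (nhds ((1 - e) * p ^ 2 * (1 - η) * (T - 0) * (2 * (1 - η) / (a * L ^ 2)) *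
        (1 * (1 - 0)))) :=
    (((hlim0.const_sub T).const_mul _).mul_const _).mul (hexp.mul (hexp.sub hlim2))
  have hval : Q - ε < (1 - e) * p ^ 2 * (1 - η) * (T - 0) * (2 * (1 - η) / (a * L ^ 2)) *
        (1 * (1 - 0)) := by
    have e1 : (1 - e) * p ^ 2 * (1 - η) * (T - 0) * (2 * (1 - η) / (a * L ^ 2)) * (1 * (1 - 0)) =
        Q * ((1 - e) * (1 - η) ^ 2) := by rw [hQ]; field_simp; ring
    have e2 : 1 - 3 * e ≤ (1 - e) * (1 - η) ^ 2 := by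
      have : (1 - e) ^ 2 ≤ (1 - η) ^ 2 := by
        refine pow_le_pow_left₀ (by linarith) (by linarith) 2
      calc 1 - 3 * e ≤ (1 - e) * (1 - e) ^ 2 := by
            have := mul_nonneg (sq_nonneg e) (show 0 ≤ 3 - e by linarith)
            linarith
        _ ≤ _ := by gcongr; linarith
    rw [e1]
    have := mul_le_mul_of_nonneg_left e2 hQ0.le
    linarith
  filter_upwards [hF.eventually (lt_mem_nhds hval), hblock, eventually_gt_atTop 0,
    hlim0.eventually (gt_mem_nhds hηpos), hlim0.eventually (gt_mem_nhds hT),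
    hlim0.eventually (gt_mem_nhds (show 0 < η / 2 by positivity))]
    with u hu hb hu0 hg1 hgT hg2
  have hh0 : 0 < h u := mesh_pos hδ hu0
  set g := L * h u with hg
  have hg0 : 0 < g := by positivity
  set c := a * u ^ 2 / (2 * (1 - η)) with hc
  have hc0 : 0 < c := by positivity
  have hR := mainRate_pos (a := a) hδ hu0
  have hG : gaussTail u 1 = mainRate a δ u * (u ^ 2 * h u ^ 2) := by
    unfold mainRate; rw [hh]; rw [hh] at hh0; field_simp
  refine (mul_le_mul_of_nonneg_right hu.le hR.le).trans ?_
  have hterm : ∀ x ∈ blockIndex T η g, (1 - e) * p ^ 2 * ((1 - η) * gaussTail u 1 *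
      exp (-(c * (1 - x.2 * g)))) ≤ μ.real (blockEvent B (h u) g u n x) := by
    intro x hx
    obtain ⟨-, h2, h3⟩ := of_mem_blockIndex hT hg0 hx
    have h4 : (x.2 : ℝ) * g ≤ 1 := by linarith
    have := (hb (x.1 * g) (x.2 * g) (by positivity) (abs_lt.mpr ⟨by linarith, by linarith⟩)).1
    simp only [zero_div, sub_zero] at this
    refine le_trans ?_ this
    rw [show p ^ 2 - e * p ^ 2 = (1 - e) * p ^ 2 by ring]
    exact mul_le_mul_of_nonneg_left (le_gaussTail_rpow ha ha1 hη1 h2 h4 hu0)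
      (mul_nonneg (by linarith) (by positivity))
  refine le_trans ?_ (Finset.sum_le_sum hterm)
  unfold blockIndex
  rw [Finset.sum_product]
  simp only
  rw [Finset.sum_const, Finset.card_range, nsmul_eq_mul, ← Finset.mul_sum, ← Finset.mul_sum]
  have hK0 : ((⌈(1 - η) / g⌉₊ : ℕ) : ℝ) * g ≤ 1 - η + g := by
    have := (Nat.ceil_lt_add_one (show 0 ≤ (1 - η) / g by positivity)).le
    have := mul_le_mul_of_nonneg_right this hg0.le
    rwa [add_mul, div_mul_cancel₀ _ hg0.ne', one_mul] at this
  have hfl : ∀ y : ℝ, y - g ≤ (⌊y / g⌋₊ : ℝ) * g := by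
    intro y
    have := mul_le_mul_of_nonneg_right (Nat.lt_floor_add_one (y / g)).le hg0.le
    rw [add_mul, div_mul_cancel₀ _ hg0.ne', one_mul] at this
    linarith
  have hK1 := hfl 1
  have hN := hfl T
  have hK : ⌈(1 - η) / g⌉₊ ≤ ⌊1 / g⌋₊ := by
    have : ((⌈(1 - η) / g⌉₊ : ℕ) : ℝ) * g ≤ (⌊1 / g⌋₊ : ℝ) * g := by linarith
    exact_mod_cast le_of_mul_le_mul_right this hg0
  have hsum := le_sum_exp_neg_lag hc0 hg0 hK
  have hsum2 : exp (-(c * g)) / (c * g) * (exp (-(c * g)) - exp (-(c * (η - g)))) ≤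
      ∑ K ∈ Finset.Ico ⌈(1 - η) / g⌉₊ ⌊1 / g⌋₊, exp (-(c * (1 - K * g))) := by
    refine le_trans (mul_le_mul_of_nonneg_left (sub_le_sub ?_ ?_) (by positivity)) hsum
    · rw [exp_le_exp, neg_le_neg_iff]
      exact mul_le_mul_of_nonneg_left (by linarith) hc0.le
    · rw [exp_le_exp, neg_le_neg_iff]
      exact mul_le_mul_of_nonneg_left (by linarith) hc0.le
  have hdiff : 0 ≤ exp (-(c * g)) - exp (-(c * (η - g))) := by
    rw [sub_nonneg, exp_le_exp, neg_le_neg_iff]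
    exact mul_le_mul_of_nonneg_left (by linarith) hc0.le
  have hNg : (T - g) / g ≤ (⌊T / g⌋₊ : ℝ) := by rwa [div_le_iff₀ hg0]
  have hGpos := gaussTail_pos hu0 one_pos
  have hTg : 0 < T - g := by linarith
  have h1e : 0 < 1 - e := by linarith
  calc _ = (T - g) / g * ((1 - e) * p ^ 2 * ((1 - η) * gaussTail u 1 *
        (exp (-(c * g)) / (c * g) * (exp (-(c * g)) - exp (-(c * (η - g))))))) := by
        rw [hG]
        have hcg : c * g * g = a * L ^ 2 / (2 * (1 - η)) * (u ^ 2 * h u ^ 2) := by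
          rw [hc, hg]; field_simp
        have hrew : 2 * (1 - η) / (a * L ^ 2) = u ^ 2 * h u ^ 2 / (c * g * g) := by
          rw [hcg]; field_simp
        rw [hrew]
        field_simp
    _ ≤ _ := by gcongr

end IsFBM

theorem mul_natAbs_rpow_le {n m I I' p p' : ℕ} (hp : p < n) (hp' : p' < n) {h a : ℝ} (hh : 0 < h)
    (ha : 0 < a) : h ^ a * ((m : ℝ) ^ a * (((I : ℤ) - I').natAbs : ℝ) ^ a) ≤
      |(I * ((n + m : ℕ) * h) + p * h) - (I' * ((n + m : ℕ) * h) + p' * h)| ^ a := by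
  have key : |(I * ((n + m : ℕ) * h) + p * h) - (I' * ((n + m : ℕ) * h) + p' * h)| =
      h * ((((I * (n + m) + p : ℕ) : ℤ) - ((I' * (n + m) + p' : ℕ) : ℤ)).natAbs : ℝ) := by
    rw [Nat.cast_natAbs, Int.cast_abs, ← abs_of_pos hh, ← abs_mul, abs_of_pos hh]
    congr 1
    push_cast
    ring
  rw [key, ← Real.mul_rpow (by positivity) (by positivity),
    ← Real.mul_rpow (by positivity) (by positivity)]
  refine Real.rpow_le_rpow (by positivity) ?_ ha.le
  refine mul_le_mul_of_nonneg_left ?_ hh.le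
  exact_mod_cast mul_natAbs_le_natAbs_sub hp hp'

theorem one_le_natAbs_rpow_add {a : ℝ} (ha : 0 < a) {x y : ℕ × ℕ} (hxy : x ≠ y) :
    1 ≤ (((x.1 : ℤ) - y.1).natAbs : ℝ) ^ a +
      (((x.1 + x.2 : ℤ)) - (y.1 + y.2)).natAbs ^ a := by
  have h1 : ∀ k : ℕ, k ≠ 0 → (1 : ℝ) ≤ (k : ℝ) ^ a := fun k hk =>
    Real.one_le_rpow (by exact_mod_cast Nat.one_le_iff_ne_zero.mpr hk) ha.le
  by_cases h : ((x.1 : ℤ) - y.1).natAbs = 0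
  · have h2 : ((x.1 + x.2 : ℤ) - (y.1 + y.2)).natAbs ≠ 0 := by
      intro h3
      exact hxy (Prod.ext (by omega) (by omega))
    have := h1 _ h2
    have h0 : (0 : ℝ) ≤ (((x.1 : ℤ) - y.1).natAbs : ℝ) ^ a := by positivity
    linarith
  · have := h1 _ h
    have h0 : (0 : ℝ) ≤ (((x.1 + x.2 : ℤ) - (y.1 + y.2)).natAbs : ℝ) ^ a := by positivity
    linarith

/-- Position of the points of a block in the parameter set. -/
theorem blockPoint_mem {T η h g : ℝ} {n : ℕ} (hT : 0 < T) (hh : 0 < h) (hg : 0 < g)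
    (hη : η ≤ 1 / 2) (hng : n * h ≤ g) {z : ℕ × ℕ} (hz : z ∈ blockIndex T η g)
    (p : Fin n × Fin n) :
    0 ≤ (z.1 : ℝ) * g + p.1 * h ∧ (z.1 : ℝ) * g + p.1 * h ≤ T ∧
      (z.1 : ℝ) * g + p.1 * h ≤ z.1 * g + z.2 * g + p.2 * h ∧
      z.1 * g + z.2 * g + p.2 * h - (z.1 * g + p.1 * h) ≤ 1 ∧
      z.1 * g + z.2 * g + p.2 * h - (z.1 * g + p.1 * h) ≤ z.2 * g + n * h := by
  obtain ⟨h1, h2, h3⟩ := of_mem_blockIndex hT hg hz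
  have hp : ∀ i : Fin n, 0 ≤ (i : ℝ) * h ∧ (i : ℝ) * h ≤ n * h := by
    intro i
    have : ((i : ℕ) : ℝ) ≤ n := by exact_mod_cast i.2.le
    exact ⟨by positivity, by gcongr⟩
  obtain ⟨a1, a2⟩ := hp p.1
  obtain ⟨b1, b2⟩ := hp p.2
  have hz1 : (0 : ℝ) ≤ (z.1 : ℝ) * g := by positivity
  have hz2 : g ≤ (z.2 : ℝ) * g := by
    have : z.2 ≠ 0 := by
      intro h0
      rw [h0, Nat.cast_zero, zero_mul] at h2
      linarith
    have h1z : (1 : ℝ) ≤ z.2 := by exact_mod_cast Nat.one_le_iff_ne_zero.mpr this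
    exact le_mul_of_one_le_left hg.le h1z
  refine ⟨by linarith, by linarith, by linarith, by linarith, by linarith⟩

namespace IsFBM

variable {Ω : Type*} [MeasurableSpace Ω] {μ : Measure Ω} [IsProbabilityMeasure μ]
  {a : ℝ} {B : ℝ → Ω → ℝ}

/-- Rate of decay of correlations between blocks. -/
noncomputable def blockDecay (a δ T : ℝ) : ℝ := (16 * (T + 1) ^ a)⁻¹ * δ ^ a / 2

theorem blockDecay_pos {a δ T : ℝ} (hδ : 0 < δ) (hT : 0 < T) : 0 < blockDecay a δ T := by
  unfold blockDecay; positivity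

set_option maxHeartbeats 800000 in
theorem measureReal_blockEvent_inter_le (hB : IsFBM μ a B) (ha : 0 < a) (ha1 : a < 1)
    {δ T u η : ℝ} (hδ : 0 < δ) (hT : 0 < T) (hη : η ≤ 1 / 2) (hu : 0 < u) {n m : ℕ}
    (hm : 1 ≤ m) (hsmall : a * u ^ 2 / 16 * (n * mesh a δ u) ≤ 1) {x y : ℕ × ℕ}
    (hx : x ∈ blockIndex T η ((n + m : ℕ) * mesh a δ u))
    (hy : y ∈ blockIndex T η ((n + m : ℕ) * mesh a δ u)) (hxy : x ≠ y) :
    μ.real (blockEvent B (mesh a δ u) ((n + m : ℕ) * mesh a δ u) u n x ∩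
      blockEvent B (mesh a δ u) ((n + m : ℕ) * mesh a δ u) u n y) ≤
    n ^ 4 * (gaussTail u 1 * exp 1 * exp (-(blockDecay a δ T * (m : ℝ) ^ a)) *
      exp (-(a * u ^ 2 / 16 * (1 - x.2 * ((n + m : ℕ) * mesh a δ u))))) *
      exp (-(blockDecay a δ T * ((((x.1 : ℤ) - y.1).natAbs : ℝ) ^ a +
      (((x.1 + x.2 : ℤ)) - (y.1 + y.2)).natAbs ^ a))) := by
  have hh := mesh_pos (a := a) hδ hu
  have hha := mesh_rpow (u := u) ha hδ hu
  set h := mesh a δ u with hhdef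
  have hL : (0 : ℝ) < (n + m : ℕ) := by exact_mod_cast (by omega : 0 < n + m)
  set g := ((n + m : ℕ) : ℝ) * h with hg
  have hg0 : 0 < g := by positivity
  set κ := blockDecay a δ T with hκ
  have hκ0 : 0 < κ := blockDecay_pos hδ hT
  set X := (((x.1 : ℤ) - y.1).natAbs : ℝ) ^ a with hX
  set Y := (((x.1 + x.2 : ℤ) - (y.1 + y.2)).natAbs : ℝ) ^ a with hY
  have hXY : 1 ≤ X + Y := one_le_natAbs_rpow_add ha hxy
  have hma : (1 : ℝ) ≤ (m : ℝ) ^ a := Real.one_le_rpow (by exact_mod_cast hm) ha.le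
  have hG := gaussTail_pos hu one_pos
  set R := gaussTail u 1 * exp 1 * exp (-(κ * (m : ℝ) ^ a)) *
      exp (-(a * u ^ 2 / 16 * (1 - x.2 * g))) * exp (-(κ * (X + Y))) with hR
  have hng : (n : ℝ) * h ≤ g := by rw [hg]; gcongr; omega
  have hpt := fun z hz p => blockPoint_mem (η := η) (z := z) hT hh hg0 hη hng hz p
  have hsub : blockEvent B h g u n x ∩ blockEvent B h g u n y ⊆
      ⋃ r ∈ (Finset.univ : Finset ((Fin n × Fin n) × (Fin n × Fin n))),
        {ω | u < incr B (x.1 * g + r.1.1 * h, x.1 * g + x.2 * g + r.1.2 * h) ω ∧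
          u < incr B (y.1 * g + r.2.1 * h, y.1 * g + y.2 * g + r.2.2 * h) ω} := by
    rintro ω ⟨⟨p, hp⟩, q, hq⟩
    simp only [mem_iUnion]
    exact ⟨(p, q), Finset.mem_univ _, hp, hq⟩
  have hterm : ∀ r ∈ (Finset.univ : Finset ((Fin n × Fin n) × (Fin n × Fin n))),
      μ.real {ω | u < incr B (x.1 * g + r.1.1 * h, x.1 * g + x.2 * g + r.1.2 * h) ω ∧
          u < incr B (y.1 * g + r.2.1 * h, y.1 * g + y.2 * g + r.2.2 * h) ω} ≤ R := by
    rintro ⟨p, q⟩ -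
    obtain ⟨p1, p2, p3, p4, p5⟩ := hpt x hx p
    obtain ⟨q1, q2, q3, q4, -⟩ := hpt y hy q
    refine (hB.measureReal_pair_le ha ha1 hT p1 p2 p3 p4 q1 q2 q3 q4 hu).trans ?_
    simp only
    have d1 := mul_natAbs_rpow_le (m := m) (I := x.1) (I' := y.1) p.1.2 q.1.2 hh ha
    have d2 := mul_natAbs_rpow_le (m := m) (I := x.1 + x.2) (I' := y.1 + y.2) p.2.2 q.2.2 hh ha
    rw [← hg] at d1 d2
    push_cast at d2
    rw [add_mul, add_mul, ← hY] at d2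
    rw [← hX] at d1
    set E₁ := |(x.1 : ℝ) * g + p.1 * h - (y.1 * g + q.1 * h)| ^ a
    set E₂ := |(x.1 : ℝ) * g + x.2 * g + p.2 * h - (y.1 * g + y.2 * g + q.2 * h)| ^ a
    have hdist : κ * (m : ℝ) ^ a + κ * (X + Y) ≤
        u ^ 2 / 2 * ((16 * (T + 1) ^ a)⁻¹ * (E₁ + E₂)) := by
      have hsum : h ^ a * ((m : ℝ) ^ a * (X + Y)) ≤ E₁ + E₂ := by linarith
      have h3 : u ^ 2 / 2 * ((16 * (T + 1) ^ a)⁻¹ * (h ^ a * ((m : ℝ) ^ a * (X + Y)))) =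
          2 * κ * ((m : ℝ) ^ a * (X + Y)) := by
        rw [hha, hκ, blockDecay]; field_simp
      have h4 : u ^ 2 / 2 * ((16 * (T + 1) ^ a)⁻¹ * (h ^ a * ((m : ℝ) ^ a * (X + Y)))) ≤
          u ^ 2 / 2 * ((16 * (T + 1) ^ a)⁻¹ * (E₁ + E₂)) := by gcongr
      have h5 : κ * (m : ℝ) ^ a * 1 ≤ κ * (m : ℝ) ^ a * (X + Y) :=
        mul_le_mul_of_nonneg_left hXY (by positivity)
      have h6 : κ * (X + Y) * 1 ≤ κ * (X + Y) * (m : ℝ) ^ a :=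
        mul_le_mul_of_nonneg_left hma (by positivity)
      linarith
    have hlag : -(a * u ^ 2 / 16 * (1 - (x.1 * g + x.2 * g + p.2 * h - (x.1 * g + p.1 * h)))) ≤
        1 + -(a * u ^ 2 / 16 * (1 - x.2 * g)) := by
      have := mul_le_mul_of_nonneg_left p5 (show 0 ≤ a * u ^ 2 / 16 by positivity)
      linarith
    have e : R = gaussTail u 1 * exp (1 + -(a * u ^ 2 / 16 * (1 - x.2 * g))) *
        exp (-(κ * (m : ℝ) ^ a + κ * (X + Y))) := by
      rw [hR, exp_add, neg_add, exp_add]; ring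
    rw [e]
    gcongr
  refine (measureReal_mono hsub (measure_ne_top _ _)).trans
    ((measureReal_biUnion_finset_le _ _).trans ((Finset.sum_le_card_nsmul _ _ _ hterm).trans
      (le_of_eq ?_)))
  rw [nsmul_eq_mul, Finset.card_univ]
  simp only [Fintype.card_prod, Fintype.card_fin, Nat.cast_mul]
  rw [hR]
  ring

theorem exists_sum_blockEvent_inter_le (hB : IsFBM μ a B) (ha : 0 < a) (ha1 : a < 1)
    {δ T : ℝ} (hδ : 0 < δ) (hT : 0 < T) : ∃ C > 0, ∀ n m : ℕ, 1 ≤ m → ∀ η ≤ (1 / 2 : ℝ),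
    ∀ᶠ u in atTop,
      ∑ x ∈ blockIndex T η ((n + m : ℕ) * mesh a δ u),
        ∑ y ∈ (blockIndex T η ((n + m : ℕ) * mesh a δ u)).erase x,
          μ.real (blockEvent B (mesh a δ u) ((n + m : ℕ) * mesh a δ u) u n x ∩
            blockEvent B (mesh a δ u) ((n + m : ℕ) * mesh a δ u) u n y) ≤
      C * (n ^ 4 * exp (-(blockDecay a δ T * (m : ℝ) ^ a))) * mainRate a δ u := by
  have hκ0 : 0 < blockDecay a δ T := blockDecay_pos hδ hT
  set κ := blockDecay a δ T with hκ
  set S := (2 * ∑' k : ℕ, exp (-(κ * (k : ℝ) ^ a))) ^ 2 with hS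
  have hS0 : 0 < S := by
    have := (summable_exp_neg_mul_rpow ha hκ0).tsum_pos (fun k => (exp_pos _).le) 0 (exp_pos _)
    positivity
  refine ⟨T * (1 + 16 / a) * exp 1 * S, by positivity, fun n m hm η hη => ?_⟩
  have hL : (1 : ℝ) ≤ (n + m : ℕ) := by exact_mod_cast (by omega : 1 ≤ n + m)
  have hlim1 := tendsto_sq_mul_mesh ha ha1 δ
  filter_upwards [eventually_gt_atTop 0, (hlim1.const_mul (a / 16 * n)).eventually
    (gt_mem_nhds (show a / 16 * n * 0 < 1 by norm_num)),
    (hlim1.const_mul ((n + m : ℕ) : ℝ)).eventually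
    (gt_mem_nhds (show ((n + m : ℕ) : ℝ) * 0 < 1 by norm_num))] with u hu hs1 hs2
  have hsmall : a * u ^ 2 / 16 * (n * mesh a δ u) ≤ 1 := by
    calc _ = a / 16 * n * (u ^ 2 * mesh a δ u) := by ring
      _ ≤ 1 := hs1.le
  have hh := mesh_pos (a := a) hδ hu
  have hpair := fun x hx y hy hxy => hB.measureReal_blockEvent_inter_le (n := n) (m := m)
    (x := x) (y := y) ha ha1 hδ hT hη hu hm hsmall hx hy hxy
  have hG := gaussTail_pos hu one_pos
  rw [← hκ] at hpair
  have hGR : gaussTail u 1 / (u ^ 2 * mesh a δ u ^ 2) = mainRate a δ u := rfl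
  set h := mesh a δ u with hhdef
  have hgh : h ≤ ((n + m : ℕ) : ℝ) * h := le_mul_of_one_le_left hh.le hL
  set g := ((n + m : ℕ) : ℝ) * h with hg
  have hg0 : 0 < g := by positivity
  set A := (n : ℝ) ^ 4 * (gaussTail u 1 * exp 1 * exp (-(κ * (m : ℝ) ^ a))) with hA
  have hA0 : 0 ≤ A := by positivity
  have hrow : ∀ x ∈ blockIndex T η g, ∑ y ∈ (blockIndex T η g).erase x,
      μ.real (blockEvent B h g u n x ∩ blockEvent B h g u n y) ≤
      A * S * exp (-(a * u ^ 2 / 16 * (1 - x.2 * g))) := by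
    intro x hx
    refine (Finset.sum_le_sum fun y hy => hpair x hx y (Finset.mem_of_mem_erase hy)
      (Finset.ne_of_mem_erase hy).symm).trans ?_
    rw [← Finset.mul_sum]
    refine (mul_le_mul_of_nonneg_left (sum_sum_exp_natAbs_le ha hκ0 _ _ _)
      (by positivity)).trans (le_of_eq ?_)
    rw [hA, hS]
    ring
  refine (Finset.sum_le_sum hrow).trans ?_
  rw [← Finset.mul_sum]
  have hsum : ∑ x ∈ blockIndex T η g, exp (-(a * u ^ 2 / 16 * (1 - x.2 * g))) ≤
      T / g * ((1 + 16 / a) / (u ^ 2 * g)) := by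
    unfold blockIndex
    rw [Finset.sum_product]
    simp only
    rw [Finset.sum_const, Finset.card_range, nsmul_eq_mul]
    have hc : 0 < a * u ^ 2 / 16 := by positivity
    have hfl : ∀ y : ℝ, 0 < y → (⌊y / g⌋₊ : ℝ) ≤ y / g := fun y hy => Nat.floor_le (by positivity)
    have h1 : ∑ K ∈ Finset.Ico ⌈(1 - η) / g⌉₊ ⌊1 / g⌋₊, exp (-(a * u ^ 2 / 16 * (1 - K * g))) ≤
        (1 + 16 / a) / (u ^ 2 * g) := by
      refine (Finset.sum_le_sum_of_subset_of_nonneg (t := Finset.range ⌊1 / g⌋₊) ?_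
        fun _ _ _ => (exp_pos _).le).trans ?_
      · intro K hK
        exact Finset.mem_range.mpr (Finset.mem_Ico.mp hK).2
      refine (sum_exp_neg_lag_le hc hg0 _).trans ?_
      have h2 : exp (-(a * u ^ 2 / 16 * (1 - (⌊1 / g⌋₊ : ℝ) * g))) ≤ 1 := by
        rw [exp_le_one_iff, neg_nonpos]
        refine mul_nonneg hc.le ?_
        have := hfl 1 one_pos
        rw [le_div_iff₀ hg0] at this
        linarith
      have h3 : 1 + 1 / (a * u ^ 2 / 16 * g) ≤ (1 + 16 / a) / (u ^ 2 * g) := by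
        have h4 : 1 ≤ 1 / (u ^ 2 * g) := by
          rw [le_div_iff₀ (by positivity)]
          have : u ^ 2 * g = ((n + m : ℕ) : ℝ) * (u ^ 2 * h) := by rw [hg]; ring
          linarith
        have h5 : 1 / (a * u ^ 2 / 16 * g) = 16 / a / (u ^ 2 * g) := by field_simp
        rw [h5, add_div]
        linarith
      calc _ ≤ 1 * ((1 + 16 / a) / (u ^ 2 * g)) := by gcongr
        _ = _ := one_mul _
    have h0 := hfl T hT
    exact mul_le_mul h0 h1 (Finset.sum_nonneg fun _ _ => (exp_pos _).le) (by positivity)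
  calc _ ≤ A * S * (T / g * ((1 + 16 / a) / (u ^ 2 * g))) := by gcongr
    _ = A * S * T * (1 + 16 / a) / (u ^ 2 * g ^ 2) := by field_simp
    _ ≤ A * S * T * (1 + 16 / a) / (u ^ 2 * h ^ 2) := by gcongr
    _ = _ := by rw [← hGR, hA]; ring

omit [IsProbabilityMeasure μ] in
theorem measurableSet_blockEvent (hB : IsFBM μ a B) (h g u : ℝ) (n : ℕ) (x : ℕ × ℕ) :
    MeasurableSet (blockEvent B h g u n x) := by
  have : blockEvent B h g u n x = ⋃ p : Fin n × Fin n,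
      {ω | u < incr B (x.1 * g + p.1 * h, x.1 * g + x.2 * g + p.2 * h) ω} := by
    ext ω; simp only [blockEvent, mem_ofPred_eq, mem_iUnion]
  rw [this]
  exact MeasurableSet.iUnion fun p => measurableSet_lt measurable_const (hB.measurable_incr _)

theorem measureReal_biUnion_blockEvent_le_exceed {T η h g u : ℝ} {n : ℕ} (hT : 0 < T) (hh : 0 < h)
    (hg : 0 < g) (hη : η ≤ 1 / 2) (hng : n * h ≤ g) :
    μ.real (⋃ x ∈ blockIndex T η g, blockEvent B h g u n x) ≤ exceed μ B T u := by
  refine measureReal_mono ?_ (measure_ne_top _ _)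
  intro ω hω
  simp only [mem_iUnion] at hω
  obtain ⟨x, hx, p, hp⟩ := hω
  obtain ⟨h1, h2, h3, h4, -⟩ := blockPoint_mem hT hh hg hη hng hx p
  refine ⟨x.1 * g + x.2 * g + p.2 * h - (x.1 * g + p.1 * h), ⟨by linarith, h4⟩,
    x.1 * g + p.1 * h, ⟨h1, h2⟩, ?_⟩
  rwa [add_sub_cancel]

theorem exists_le_exceed (hB : IsFBM μ a B) (ha : 0 < a) (ha1 : a < 1) {δ T : ℝ} (hδ : 0 < δ)
    (hT : 0 < T) : ∃ C > 0, ∀ n m : ℕ, 1 ≤ n → 1 ≤ m → ∀ ε > 0, ∀ᶠ u in atTop,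
      (2 * T / a * (pickands μ a B δ n / (n + m : ℕ)) ^ 2 - ε -
        C * (n ^ 4 * exp (-(blockDecay a δ T * (m : ℝ) ^ a)))) * mainRate a δ u ≤
      exceed μ B T u := by
  obtain ⟨C, hC, hpair⟩ := hB.exists_sum_blockEvent_inter_le ha ha1 hδ hT
  refine ⟨C, hC, fun n m hn hm ε hε => ?_⟩
  have : NeZero n := ⟨by omega⟩
  obtain ⟨η, -, hη, hsum⟩ := hB.exists_le_sum_blockEvent ha ha1 hδ hT n (L := n + m) (by omega) hε
  filter_upwards [hsum, hpair n m hm η hη, eventually_gt_atTop 0] with u h1 h2 hu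
  have hh := mesh_pos (a := a) hδ hu
  have hg : 0 < ((n + m : ℕ) : ℝ) * mesh a δ u :=
    mul_pos (by exact_mod_cast (by omega : 0 < n + m)) hh
  have hng : (n : ℝ) * mesh a δ u ≤ ((n + m : ℕ) : ℝ) * mesh a δ u := by gcongr; omega
  have h3 := measureReal_biUnion_blockEvent_le_exceed (μ := μ) (B := B) (u := u) hT hh hg hη hng
  have h4 := sum_measureReal_sub_le_measureReal_biUnion (μ := μ)
    (blockIndex T η ((n + m : ℕ) * mesh a δ u)) fun x _ =>
      hB.measurableSet_blockEvent (mesh a δ u) ((n + m : ℕ) * mesh a δ u) u n x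
  rw [sub_mul]
  linarith

theorem tendsto_pow_mul_exp_neg_mul_rpow {κ : ℝ} (hκ : 0 < κ) (ha : 0 < a) (s : ℕ) :
    Tendsto (fun k : ℕ => (k : ℝ) ^ s * exp (-(κ * (k : ℝ) ^ a))) atTop (nhds 0) := by
  have h := (tendsto_rpow_mul_exp_neg_mul_atTop_nhds_zero (s / a) κ hκ).comp
    ((tendsto_rpow_atTop ha).comp tendsto_natCast_atTop_atTop)
  refine h.congr fun k => ?_
  simp only [Function.comp_apply]
  rw [← Real.rpow_mul k.cast_nonneg, mul_div_cancel₀ _ ha.ne', Real.rpow_natCast, neg_mul]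

/-- Lower bound in the tail asymptotics. -/
theorem eventually_le_exceed (hB : IsFBM μ a B) (ha : 0 < a) (ha1 : a < 1)
    (hc : ∀ᵐ ω ∂μ, Continuous fun t => B t ω) {T : ℝ} (hT : 0 < T) {HH : ℝ} (hHH : 0 < HH)
    (hP : Tendsto (fun lam : ℝ => lam⁻¹ * ∫ ω, exp (⨆ t : Icc (0 : ℝ) lam, drift a B t ω) ∂μ)
      atTop (nhds HH)) {ε : ℝ} (hε : 0 < ε) :
    ∀ᶠ u in atTop, (2 * T / a * HH ^ 2 - ε) * mainRate a 1 u ≤ exceed μ B T u := by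
  -- choice of the loss in the Pickands constant
  have hcont : Tendsto (fun x : ℝ => 2 * T / a * (HH - x) ^ 2) (nhdsWithin 0 (Ioi 0))
      (nhds (2 * T / a * HH ^ 2)) := by
    have : Continuous (fun x : ℝ => 2 * T / a * (HH - x) ^ 2) := by fun_prop
    have h0 := (this.tendsto 0).mono_left (nhdsWithin_le_nhds (s := Ioi 0))
    simpa using h0
  obtain ⟨x, hx, hx0, hxH⟩ := ((hcont.eventually_const_lt
    (show 2 * T / a * HH ^ 2 - ε / 4 < 2 * T / a * HH ^ 2 by linarith)).and
    (Ioo_mem_nhdsGT hHH)).exists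
  obtain ⟨δ, hδ, hδ0⟩ := ((hB.pickands_asymptotics ha hc hHH hP hx0).2.and
    self_mem_nhdsWithin).exists
  replace hδ0 : 0 < δ := hδ0
  obtain ⟨C, hC, hlow⟩ := hB.exists_le_exceed ha ha1 hδ0 hT
  have hκ := blockDecay_pos (a := a) hδ0 hT
  -- choice of the block size
  have hratio : Tendsto (fun k : ℕ => 2 * T / a * ((HH - x) * ((k : ℝ) / (k + 1))) ^ 2 -
      C * ((k : ℝ) ^ 8 * exp (-(blockDecay a δ T * (k : ℝ) ^ a))) / δ ^ 2) atTop
      (nhds (2 * T / a * ((HH - x) * 1) ^ 2 - C * 0 / δ ^ 2)) :=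
    ((((tendsto_natCast_div_add_atTop (1 : ℝ)).const_mul _).pow 2).const_mul _).sub
      (((tendsto_pow_mul_exp_neg_mul_rpow hκ ha 8).const_mul C).div_const _)
  rw [mul_zero, zero_div, sub_zero, mul_one] at hratio
  have hsq : Tendsto (fun k : ℕ => k ^ 2) atTop atTop := tendsto_pow_atTop two_ne_zero
  obtain ⟨k, hk, hpk, hk1⟩ := ((hratio.eventually_const_lt hx).and ((hsq.eventually hδ).and
    (eventually_ge_atTop 1))).exists
  have hk0 : (0 : ℝ) < k := by exact_mod_cast hk1
  filter_upwards [hlow (k ^ 2) k (Nat.one_le_pow _ _ hk1) hk1 (ε / 4 * δ ^ 2) (by positivity),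
    eventually_gt_atTop 0] with u hu hu0
  refine le_trans ?_ hu
  rw [mainRate_eq a u hδ0, mul_div_assoc', mul_div_right_comm _ (mainRate a 1 u)]
  refine mul_le_mul_of_nonneg_right ?_ (mainRate_pos one_pos hu0).le
  have hp : ((HH - x) * ((k : ℝ) / (k + 1))) ^ 2 ≤
      (pickands μ a B δ (k ^ 2) / (k ^ 2 + k : ℕ)) ^ 2 / δ ^ 2 := by
    rw [← div_pow]
    refine pow_le_pow_left₀ (mul_nonneg (by linarith) (by positivity)) ?_ 2
    push_cast at hpk ⊢
    calc (HH - x) * ((k : ℝ) / (k + 1)) ≤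
        pickands μ a B δ (k ^ 2) / (k ^ 2 * δ) * (k / (k + 1)) := by gcongr
      _ = _ := by field_simp
  have hp' : 2 * T / a * ((HH - x) * ((k : ℝ) / (k + 1))) ^ 2 ≤
      2 * T / a * ((pickands μ a B δ (k ^ 2) / (k ^ 2 + k : ℕ)) ^ 2 / δ ^ 2) := by gcongr
  have e : (2 * T / a * (pickands μ a B δ (k ^ 2) / (k ^ 2 + k : ℕ)) ^ 2 - ε / 4 * δ ^ 2 -
      C * (((k ^ 2 : ℕ) : ℝ) ^ 4 * exp (-(blockDecay a δ T * (k : ℝ) ^ a)))) / δ ^ 2 =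
      2 * T / a * ((pickands μ a B δ (k ^ 2) / (k ^ 2 + k : ℕ)) ^ 2 / δ ^ 2) - ε / 4 -
      C * ((k : ℝ) ^ 8 * exp (-(blockDecay a δ T * (k : ℝ) ^ a))) / δ ^ 2 := by
    rw [show ((k ^ 2 : ℕ) : ℝ) ^ 4 = (k : ℝ) ^ 8 by push_cast; ring]
    field_simp
  rw [e]
  linarith

end IsFBM

theorem lt_iSup_iSup_iff {X Y : Type*} [TopologicalSpace X] [TopologicalSpace Y] [CompactSpace X]
    [CompactSpace Y] [Nonempty X] [Nonempty Y] {f : X → Y → ℝ}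
    (hf : Continuous fun p : X × Y => f p.1 p.2) {u : ℝ} :
    u < ⨆ (x) (y), f x y ↔ ∃ x y, u < f x y := by
  obtain ⟨M, hM⟩ := (isCompact_range hf).bddAbove
  have hM' : ∀ x y, f x y ≤ M := fun x y => hM ⟨(x, y), rfl⟩
  have h1 : ∀ x, BddAbove (range (f x)) := fun x => ⟨M, by rintro _ ⟨y, rfl⟩; exact hM' x y⟩
  have h2 : BddAbove (range fun x => ⨆ y, f x y) :=
    ⟨M, by rintro _ ⟨x, rfl⟩; exact ciSup_le (hM' x)⟩
  simp only [lt_ciSup_iff h2, lt_ciSup_iff (h1 _)]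

namespace IsFBM

variable {Ω : Type*} [MeasurableSpace Ω] {μ : Measure Ω} [IsProbabilityMeasure μ]
  {a : ℝ} {B : ℝ → Ω → ℝ}

omit [IsProbabilityMeasure μ] in
theorem toReal_measure_lt_iSup_eq_exceed (hc : ∀ᵐ ω ∂μ, Continuous fun t => B t ω) {T : ℝ}
    (hT : 0 < T) (u : ℝ) :
    (μ {ω | u < ⨆ (τ : Icc (0 : ℝ) 1) (s : Icc (0 : ℝ) T),
      (B ((s : ℝ) + (τ : ℝ)) ω - B (s : ℝ) ω)}).toReal = exceed μ B T u := by
  have : Nonempty (Icc (0 : ℝ) T) := ⟨⟨0, left_mem_Icc.mpr hT.le⟩⟩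
  refine congrArg ENNReal.toReal (measure_congr ?_)
  filter_upwards [hc] with ω hω
  refine propext ?_
  change (u < ⨆ (τ : Icc (0 : ℝ) 1) (s : Icc (0 : ℝ) T),
    (B ((s : ℝ) + (τ : ℝ)) ω - B (s : ℝ) ω)) ↔
    ∃ τ ∈ Icc (0 : ℝ) 1, ∃ s ∈ Icc (0 : ℝ) T, u < incr B (s, s + τ) ω
  rw [lt_iSup_iSup_iff (f := fun (τ : Icc (0 : ℝ) 1) (s : Icc (0 : ℝ) T) =>
    B ((s : ℝ) + (τ : ℝ)) ω - B (s : ℝ) ω)]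
  · simp only [Subtype.exists, incr, exists_prop]
  · exact (hω.comp (by fun_prop : Continuous fun p : Icc (0 : ℝ) 1 × Icc (0 : ℝ) T =>
      (p.2 : ℝ) + (p.1 : ℝ))).sub (hω.comp (by fun_prop : Continuous
        fun p : Icc (0 : ℝ) 1 × Icc (0 : ℝ) T => (p.2 : ℝ)))

theorem tendsto_exceed_div_mainRate (hB : IsFBM μ a B) (ha : 0 < a) (ha1 : a < 1)
    (hc : ∀ᵐ ω ∂μ, Continuous fun t => B t ω) {T : ℝ} (hT : 0 < T) {HH : ℝ} (hHH : 0 < HH)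
    (hP : Tendsto (fun lam : ℝ => lam⁻¹ * ∫ ω, exp (⨆ t : Icc (0 : ℝ) lam, drift a B t ω) ∂μ)
      atTop (nhds HH)) :
    Tendsto (fun u => exceed μ B T u / mainRate a 1 u) atTop (nhds (2 * T / a * HH ^ 2)) := by
  rw [tendsto_order]
  constructor
  · intro b hb
    filter_upwards [hB.eventually_le_exceed ha ha1 hc hT hHH hP (half_pos (sub_pos.mpr hb)),
      eventually_gt_atTop 0] with u hu hu0
    rw [← le_div_iff₀ (mainRate_pos one_pos hu0)] at hu
    linarith
  · intro b hb
    filter_upwards [hB.eventually_exceed_le ha ha1 hc hT hHH hP (half_pos (sub_pos.mpr hb)),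
      eventually_gt_atTop 0] with u hu hu0
    rw [← div_le_iff₀ (mainRate_pos one_pos hu0)] at hu
    linarith

end IsFBM

theorem mainRate_one_eq (H : ℝ) {u : ℝ} (hu : 0 < u) :
    mainRate (2 * H) 1 u = (1 / 2 : ℝ) ^ (1 / H) * u ^ (2 / H - 2) * gaussTail u 1 := by
  have h1 : ((2 : ℝ) ^ (1 / (2 * H))) ^ 2 = ((1 / 2 : ℝ) ^ (1 / H))⁻¹ := by
    rw [← Real.rpow_two, ← Real.rpow_mul (by norm_num), ← Real.inv_rpow (by norm_num)]
    norm_num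
    congr 1
    ring
  have h2 : u ^ 2 * (u ^ (-(2 / (2 * H)))) ^ 2 = (u ^ (2 / H - 2))⁻¹ := by
    rw [← Real.rpow_two, ← Real.rpow_two, ← Real.rpow_mul hu.le, ← Real.rpow_add hu,
      ← Real.rpow_neg hu.le]
    congr 1
    ring
  unfold mainRate mesh
  rw [one_mul, mul_pow, mul_left_comm, h1, h2, ← mul_inv, div_inv_eq_mul]
  ring

/-- Theorem 2.1 (Hashorva–Tan): exact tail asymptotics of the Shepp statistics
`M_H(T) = sup_{τ∈[0,1], s∈[0,T]} (B_H(s+τ) - B_H(s))` for `H ∈ (0,1/2)`: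
`P(M_H(T) > u) ~ (T/H) (1/2)^{1/H} 𝓗_{2H}² u^{2/H-2} Ψ(u)` as `u → ∞`. -/
theorem shepp_fbm_tail_asymptotics
    {Ω : Type*} [MeasurableSpace Ω] (μ : Measure Ω) [IsProbabilityMeasure μ]
    (H : ℝ) (hH : H ∈ Set.Ioo (0:ℝ) (1/2))
    (B : ℝ → Ω → ℝ)
    (hmeas : ∀ t : ℝ, Measurable (B t))
    (hzero : ∀ ω, B 0 ω = 0)
    (hcont : ∀ᵐ ω ∂μ, Continuous fun t => B t ω)
    (hgauss : ∀ (n : ℕ) (c : Fin n → ℝ) (t : Fin n → ℝ),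
      ∃ v : NNReal, μ.map (fun ω => ∑ i, c i * B (t i) ω) =
        ProbabilityTheory.gaussianReal 0 v)
    (hcov : ∀ t s : ℝ, 0 ≤ t → 0 ≤ s →
      ∫ ω, B t ω * B s ω ∂μ = (t ^ (2*H) + s ^ (2*H) - |t - s| ^ (2*H)) / 2)
    (HH : ℝ) (hHH : 0 < HH)
    (hPick : Tendsto (fun lam : ℝ => lam⁻¹ *
        ∫ ω, Real.exp (⨆ t : Set.Icc (0:ℝ) lam,
          (Real.sqrt 2 * B (t:ℝ) ω - (t:ℝ) ^ (2*H))) ∂μ) atTop (nhds HH))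
    (T : ℝ) (hT : 0 < T) :
    Tendsto (fun u : ℝ =>
        (μ {ω | u < ⨆ (τ : Set.Icc (0:ℝ) (1)) (s : Set.Icc (0:ℝ) (T)),
            (B ((s:ℝ) + (τ:ℝ)) ω - B (s:ℝ) ω)}).toReal /
          ((T / H) * ((1/2 : ℝ) ^ (1/H)) * HH ^ 2 * u ^ (2/H - 2) * stdNormalTail u))
      atTop (nhds 1) := by
  obtain ⟨hH0, hH1⟩ := hH
  have hB : IsFBM μ (2 * H) B := ⟨hmeas, hzero, hgauss, hcov⟩
  have hK : 2 * T / (2 * H) * HH ^ 2 ≠ 0 := by positivity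
  have hlim := ((hB.tendsto_exceed_div_mainRate (by linarith) (by linarith) hcont hT hHH
    hPick).div_const (2 * T / (2 * H) * HH ^ 2)).div tendsto_stdNormalTail_div_gaussTail one_ne_zero
  rw [div_self hK, div_one] at hlim
  refine hlim.congr' ?_
  filter_upwards [eventually_gt_atTop 0] with u hu
  have hg := gaussTail_pos hu one_pos
  rw [IsFBM.toReal_measure_lt_iSup_eq_exceed hcont hT, Pi.div_apply, mainRate_one_eq H hu,
    div_div, div_div]
  congr 1
  field_simp
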